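/- (Extension Lemma, qualitative form) Let ℓ > 1 be an integer, G and G̃ finite groups, and π : G̃ → G a surjective group homomorphism that is a forcing extension. Suppose there exists δ > 0 such that for every ε > 0 there is a constant C > 0 with |Cl_F[ℓ]| ≤ C · Disc(F)^{1/2 − δ + ε} for every Galois number field F over ℚ with Gal(F/ℚ) ≅ G. Then there exists δ' > 0 such that for every ε > 0 there is a constant C' > 0 with |Cl_L[ℓ]| ≤ C' · Disc(L)^{1/2 − δ' + ε} for every Galois number field L over ℚ with Gal(L/ℚ) ≅ G̃. -/

import Mathlib

open NumberField

/-- The number of `ℓ`-torsion elements in the class group of a number field `F`. -/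
noncomputable def ellTorsion (F : Type*) [Field F] [NumberField F] (ℓ : ℕ) : ℕ :=
  Nat.card {x : ClassGroup (𝓞 F) // x ^ ℓ = 1}

/-- A surjective group homomorphism `π : G̃ → G` is a forcing extension if there is a conjugacy
class `C` of `G` such that for every `c ∈ C`, every preimage of `c` has the same order as `c`. -/
def IsForcingExtension {G₁ G₂ : Type*} [Group G₁] [Group G₂] (π : G₁ →* G₂) : Prop :=
  Function.Surjective π ∧
    ∃ c₀ : G₂, ∀ c : G₂, IsConj c₀ c → ∀ g : G₁, π g = c → orderOf g = orderOf c

section IdealCount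

open UniqueFactorizationMonoid Ideal

variable {K : Type} [Field K] [NumberField K]

/-- The ideals dividing a nonzero ideal are counted by the exponents in its factorization. -/
theorem ncard_dvd_ideal_le (J : Ideal (𝓞 K)) (hJ : J ≠ ⊥) [DecidableEq (Ideal (𝓞 K))] :
    {I : Ideal (𝓞 K) | I ∣ J}.Finite ∧ {I : Ideal (𝓞 K) | I ∣ J}.ncard ≤
      ∏ P ∈ (normalizedFactors J).toFinset, ((normalizedFactors J).count P + 1) := by
  rw [← Multiset.card_Iic]
  have hmaps : ∀ I ∈ {I : Ideal (𝓞 K) | I ∣ J},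
      normalizedFactors I ∈ (Finset.Iic (normalizedFactors J) : Finset (Multiset (Ideal (𝓞 K)))) := by
    intro I hI
    have hI0 : I ≠ 0 := ne_zero_of_dvd_ne_zero hJ hI
    rw [Finset.mem_Iic]
    exact (dvd_iff_normalizedFactors_le_normalizedFactors hI0 hJ).1 hI
  have hinj : Set.InjOn (fun I : Ideal (𝓞 K) => normalizedFactors I) {I | I ∣ J} := by
    intro I hI I' hI' h
    have hI0 : I ≠ 0 := ne_zero_of_dvd_ne_zero hJ hI
    have hI0' : I' ≠ 0 := ne_zero_of_dvd_ne_zero hJ hI'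
    rw [← Ideal.prod_normalizedFactors_eq_self hI0, ← Ideal.prod_normalizedFactors_eq_self hI0']
    exact congrArg Multiset.prod h
  constructor
  · exact Set.Finite.of_injOn (f := fun I : Ideal (𝓞 K) => normalizedFactors I)
      (t := ((Finset.Iic (normalizedFactors J) : Finset (Multiset (Ideal (𝓞 K)))) : Set _))
      (fun I hI => hmaps I hI) hinj (Finset.finite_toSet _)
  · rw [← Set.ncard_coe_finset]
    exact Set.ncard_le_ncard_of_injOn _ hmaps hinj (Finset.finite_toSet _)

theorem absNorm_eq_prod_normalizedFactors (J : Ideal (𝓞 K)) (hJ : J ≠ ⊥)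
    [DecidableEq (Ideal (𝓞 K))] :
    absNorm J = ∏ P ∈ (normalizedFactors J).toFinset,
      absNorm P ^ ((normalizedFactors J).count P) := by
  conv_lhs => rw [← Ideal.prod_normalizedFactors_eq_self hJ, Finset.prod_multiset_count]
  rw [map_prod]
  simp

theorem two_le_absNorm_of_isPrime (P : Ideal (𝓞 K)) (hP : P.IsPrime) (h0 : P ≠ ⊥) :
    2 ≤ absNorm P := by
  have h1 : absNorm P ≠ 0 := by rwa [Ne, absNorm_eq_zero_iff]
  have h2 : absNorm P ≠ 1 := by
    rw [Ne, absNorm_eq_one_iff]; exact hP.ne_top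
  omega

theorem two_pow_card_normalizedFactors_le (J : Ideal (𝓞 K)) (hJ : J ≠ ⊥)
    [DecidableEq (Ideal (𝓞 K))] :
    2 ^ (normalizedFactors J).toFinset.card ≤ absNorm J := by
  rw [absNorm_eq_prod_normalizedFactors J hJ, ← Finset.prod_const]
  refine Finset.prod_le_prod' fun P hP => ?_
  rw [Multiset.mem_toFinset] at hP
  have hp := prime_of_normalized_factor P hP
  have h2 := two_le_absNorm_of_isPrime P (Ideal.isPrime_of_prime hp) hp.ne_zero
  calc 2 ≤ absNorm P := h2
    _ = absNorm P ^ 1 := (pow_one _).symm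
    _ ≤ _ := Nat.pow_le_pow_right (by omega) (Multiset.one_le_count_iff_mem.2 hP)

theorem card_primes_norm_lt (B : ℕ) (s : Finset (Ideal (𝓞 K)))
    (hs : ∀ P ∈ s, P.IsPrime ∧ P ≠ ⊥ ∧ absNorm P < B) :
    s.card ≤ B * (B * Module.finrank ℚ K) := by
  classical
  have hsub : s ⊆ (Finset.range B).biUnion fun m =>
      if m = 0 then ∅ else
      (normalizedFactors (Ideal.span {(m : 𝓞 K)})).toFinset := by
    intro P hP
    obtain ⟨h1, h2, h3⟩ := hs P hP
    have h4 := two_le_absNorm_of_isPrime P h1 h2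
    rw [Finset.mem_biUnion]
    refine ⟨absNorm P, Finset.mem_range.2 h3, ?_⟩
    rw [if_neg (by omega), Multiset.mem_toFinset, mem_normalizedFactors_iff' ]
    · refine ⟨(Ideal.prime_of_isPrime h2 h1).irreducible, by simp, ?_⟩
      rw [Ideal.dvd_iff_le]
      exact Ideal.span_singleton_absNorm_le P
    · simp only [ne_eq, Ideal.zero_eq_bot, Ideal.span_singleton_eq_bot, Nat.cast_eq_zero]
      omega
  refine (Finset.card_le_card hsub).trans (Finset.card_biUnion_le.trans ?_)
  refine (Finset.sum_le_card_nsmul _ _ (B * Module.finrank ℚ K) ?_).trans (by simp)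
  intro m hm
  rw [Finset.mem_range] at hm
  split_ifs with h
  · simp
  · have hJ : Ideal.span {(m : 𝓞 K)} ≠ ⊥ := by simpa using h
    have := two_pow_card_normalizedFactors_le _ hJ
    rw [absNorm_span_natCast, RingOfIntegers.rank] at this
    have h2 : m ^ Module.finrank ℚ K ≤ 2 ^ (m * Module.finrank ℚ K) := by
      rw [pow_mul]; exact Nat.pow_le_pow_left Nat.lt_two_pow_self.le _
    exact ((Nat.pow_le_pow_iff_right (by norm_num)).1 (this.trans h2)).trans
      (Nat.mul_le_mul_right _ hm.le)

theorem exists_add_one_le_mul_two_rpow (ε : ℝ) (hε : 0 < ε) :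
    ∃ C : ℝ, 1 ≤ C ∧ ∀ e : ℕ, (e + 1 : ℝ) ≤ C * (2 : ℝ) ^ (ε * e) := by
  refine ⟨1 + 1 / (ε * Real.log 2), ?_, fun e => ?_⟩
  · have := Real.log_pos (one_lt_two)
    have : 0 < 1 / (ε * Real.log 2) := by positivity
    linarith
  · have h2 := Real.log_pos (one_lt_two)
    have h1 : (2 : ℝ) ^ (ε * e) = Real.exp (ε * Real.log 2 * e) := by
      rw [Real.rpow_def_of_pos two_pos]; ring_nf
    have h3 := Real.add_one_le_exp (ε * Real.log 2 * e)
    have h4 : 1 ≤ Real.exp (ε * Real.log 2 * e) := Real.one_le_exp (by positivity)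
    rw [h1, add_mul, one_mul, div_mul_eq_mul_div, one_mul]
    have : (e : ℝ) ≤ Real.exp (ε * Real.log 2 * e) / (ε * Real.log 2) := by
      rw [le_div_iff₀ (by positivity)]; nlinarith
    linarith

/-- The number of divisors of an ideal of norm `N` is at most `C N ^ ε`, uniformly among number
fields of bounded degree. -/
theorem exists_ncard_dvd_ideal_le_rpow (n : ℕ) (ε : ℝ) (hε : 0 < ε) :
    ∃ C : ℝ, 0 < C ∧ ∀ (K : Type) [Field K] [NumberField K], Module.finrank ℚ K ≤ n →
      ∀ J : Ideal (𝓞 K), J ≠ ⊥ →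
        ({I : Ideal (𝓞 K) | I ∣ J}.ncard : ℝ) ≤ C * (absNorm J : ℝ) ^ ε := by
  classical
  obtain ⟨C, hC1, hC⟩ := exists_add_one_le_mul_two_rpow ε hε
  set B : ℕ := ⌈(2 : ℝ) ^ (1 / ε)⌉₊ with hB
  refine ⟨C ^ (B * (B * n)), by positivity, ?_⟩
  intro K _ _ hK J hJ
  refine (Nat.cast_le.2 (ncard_dvd_ideal_le J hJ).2).trans ?_
  rw [absNorm_eq_prod_normalizedFactors J hJ]
  push_cast
  rw [← Real.finsetProd_rpow _ _ (fun P _ => by positivity)]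
  set s := (normalizedFactors J).toFinset
  have key : ∀ P ∈ s, ((normalizedFactors J).count P + 1 : ℝ) ≤
      (if absNorm P < B then C else 1) *
        ((absNorm P : ℝ) ^ (normalizedFactors J).count P) ^ ε := by
    intro P hP
    rw [Multiset.mem_toFinset] at hP
    have hp := prime_of_normalized_factor P hP
    have h2 := two_le_absNorm_of_isPrime P (Ideal.isPrime_of_prime hp) hp.ne_zero
    set e := (normalizedFactors J).count P
    have h2' : (2 : ℝ) ≤ absNorm P := by exact_mod_cast h2
    rw [← Real.rpow_natCast, ← Real.rpow_mul (by positivity)]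
    split_ifs with h
    · refine (hC e).trans ?_
      gcongr ?_ * ?_
      rw [mul_comm ε]
      exact Real.rpow_le_rpow (by norm_num) h2' (by positivity)
    · push Not at h
      have h3 : (2 : ℝ) ^ (1 / ε) ≤ absNorm P := (Nat.le_ceil _).trans (by exact_mod_cast h)
      have h4 : (2 : ℝ) ≤ (absNorm P : ℝ) ^ ε := by
        calc (2 : ℝ) = ((2 : ℝ) ^ (1 / ε)) ^ ε := by
              rw [← Real.rpow_mul (by norm_num)]; field_simp; simp
          _ ≤ _ := Real.rpow_le_rpow (by positivity) h3 hε.le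
      rw [one_mul, mul_comm (e : ℝ), Real.rpow_mul (by positivity), Real.rpow_natCast]
      calc (e + 1 : ℝ) ≤ 2 ^ e := by exact_mod_cast Nat.lt_two_pow_self
        _ ≤ _ := by gcongr
  refine (Finset.prod_le_prod (fun _ _ => by positivity) key).trans ?_
  rw [Finset.prod_mul_distrib]
  gcongr ?_ * ?_
  rw [Finset.prod_ite, Finset.prod_const, Finset.prod_const_one, mul_one]
  refine pow_le_pow_right₀ hC1 ((card_primes_norm_lt B _ ?_).trans
    (Nat.mul_le_mul_left _ (Nat.mul_le_mul_left _ hK)))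
  intro P hP
  rw [Finset.mem_filter, Multiset.mem_toFinset] at hP
  have hp := prime_of_normalized_factor P hP.1
  exact ⟨Ideal.isPrime_of_prime hp, hp.ne_zero, hP.2⟩

/-- The number of ideals of norm `m` is at most `C m ^ ε`, uniformly among number
fields of bounded degree. -/
theorem exists_ncard_absNorm_eq_le_rpow (n : ℕ) (ε : ℝ) (hε : 0 < ε) :
    ∃ C : ℝ, 0 < C ∧ ∀ (K : Type) [Field K] [NumberField K], Module.finrank ℚ K ≤ n →
      ∀ m : ℕ, m ≠ 0 →
        ({I : Ideal (𝓞 K) | absNorm I = m}.ncard : ℝ) ≤ C * (m : ℝ) ^ ε := by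
  classical
  obtain ⟨C, hC0, hC⟩ := exists_ncard_dvd_ideal_le_rpow n (ε / (n + 1)) (by positivity)
  refine ⟨C, hC0, fun K _ _ hK m hm => ?_⟩
  have hJ : Ideal.span {(m : 𝓞 K)} ≠ ⊥ := by simpa using hm
  have h1 := hC K hK _ hJ
  have h2 : {I : Ideal (𝓞 K) | absNorm I = m}.ncard ≤
      {I : Ideal (𝓞 K) | I ∣ Ideal.span {(m : 𝓞 K)}}.ncard := by
    refine Set.ncard_le_ncard ?_ (ncard_dvd_ideal_le _ hJ).1
    intro I hI
    simp only [Set.mem_ofPred_eq] at hI ⊢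
    rw [Ideal.dvd_iff_le, ← hI]
    exact Ideal.span_singleton_absNorm_le I
  refine (Nat.cast_le.2 h2).trans (h1.trans ?_)
  gcongr ?_ * ?_
  rw [absNorm_span_natCast, RingOfIntegers.rank]
  push_cast
  rw [← Real.rpow_natCast, ← Real.rpow_mul (by positivity)]
  refine Real.rpow_le_rpow_of_exponent_le (by exact_mod_cast Nat.one_le_iff_ne_zero.2 hm) ?_
  have : (Module.finrank ℚ K : ℝ) ≤ n + 1 := by
    have : (Module.finrank ℚ K : ℝ) ≤ n := by exact_mod_cast hK
    linarith
  rw [mul_div_assoc', div_le_iff₀ (by positivity)]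
  nlinarith

end IdealCount

section LatticeCount

open MeasureTheory Pointwise

variable {E : Type*} [NormedAddCommGroup E] [NormedSpace ℝ E] [FiniteDimensional ℝ E]
  [MeasurableSpace E] [BorelSpace E] {ι : Type*} [Fintype ι]

theorem tsum_vadd_inter_fundamentalDomain (μ : Measure E) [μ.IsAddHaarMeasure]
    (L : Submodule ℤ E) [Countable L] (b : Module.Basis ι ℝ E) (hb : ∀ i, b i ∈ L) (t : Set E) :
    ∑' x : L, μ (((x : E) +ᵥ t) ∩ ZSpan.fundamentalDomain b) =
      (ENat.card (L.toAddSubgroup ⧸ (Submodule.span ℤ (Set.range b)).toAddSubgroup.addSubgroupOf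
        L.toAddSubgroup) : ENNReal) * μ t := by
  set L' := Submodule.span ℤ (Set.range b)
  have hle : L'.toAddSubgroup ≤ L.toAddSubgroup := by
    show L' ≤ L
    rw [Submodule.span_le]; rintro _ ⟨i, rfl⟩; exact hb i
  set S := L'.toAddSubgroup.addSubgroupOf L.toAddSubgroup
  have hdom := ZSpan.isAddFundamentalDomain b μ
  have hcount : Countable L' := by
    have : Function.Injective (Submodule.inclusion (show L' ≤ L from hle)) :=
      Submodule.inclusion_injective _
    exact this.countable
  have key : ∀ x : E, ∑' y : S, μ (((x + ((y : L.toAddSubgroup) : E)) +ᵥ t) ∩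
      ZSpan.fundamentalDomain b) = μ t := by
    intro x
    have hm : MeasurableConstVAdd L' E :=
      (inferInstance : MeasurableConstVAdd L'.toAddSubgroup E)
    have hv : VAddInvariantMeasure L' E μ :=
      (inferInstance : VAddInvariantMeasure L'.toAddSubgroup E μ)
    have h1 := hdom.measure_eq_tsum (x +ᵥ t)
    rw [measure_vadd] at h1
    rw [h1]
    change _ = ∑' g : L'.toAddSubgroup, μ (((g : E) +ᵥ x +ᵥ t) ∩ ZSpan.fundamentalDomain b)
    rw [← (AddSubgroup.addSubgroupOfEquivOfLe hle).toEquiv.tsum_eq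
      (fun g : L'.toAddSubgroup => μ (((g : E) +ᵥ x +ᵥ t) ∩ ZSpan.fundamentalDomain b))]
    refine tsum_congr fun y => ?_
    rw [vadd_vadd, add_comm x]
    rfl
  have h2 : ∑' x : L.toAddSubgroup, μ (((x : E) +ᵥ t) ∩ ZSpan.fundamentalDomain b) =
      ∑' p : (L.toAddSubgroup ⧸ S) × S, μ (((((Quotient.out p.1 : L.toAddSubgroup) : E) +
        ((p.2 : L.toAddSubgroup) : E)) +ᵥ t) ∩ ZSpan.fundamentalDomain b) := by
    have hbij : Function.Bijective
        (fun p : (L.toAddSubgroup ⧸ S) × S => (Quotient.out p.1 : L.toAddSubgroup) + p.2) := by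
      constructor
      · rintro ⟨q₁, s₁⟩ ⟨q₂, s₂⟩ h
        simp only at h
        have h' : q₁ = q₂ := by
          have := congrArg (QuotientAddGroup.mk (s := S)) h
          rw [QuotientAddGroup.mk_add_of_mem _ s₁.2, QuotientAddGroup.mk_add_of_mem _ s₂.2,
            QuotientAddGroup.out_eq', QuotientAddGroup.out_eq'] at this
          exact this
        subst h'
        simpa using h
      · intro x
        refine ⟨⟨QuotientAddGroup.mk x, ⟨-(Quotient.out (QuotientAddGroup.mk (s := S) x)) + x, ?_⟩⟩, ?_⟩
        · rw [← QuotientAddGroup.eq, QuotientAddGroup.out_eq']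
        · simp
    rw [← (Equiv.ofBijective _ hbij).tsum_eq]
    refine tsum_congr fun p => ?_
    rfl
  change ∑' x : L.toAddSubgroup, μ (((x : E) +ᵥ t) ∩ ZSpan.fundamentalDomain b) = _
  rw [h2, ENNReal.tsum_prod (f := fun (q : L.toAddSubgroup ⧸ S) (y : S) =>
    μ (((((Quotient.out q : L.toAddSubgroup) : E) +
        ((y : L.toAddSubgroup) : E)) +ᵥ t) ∩ ZSpan.fundamentalDomain b))]
  simp_rw [key]
  rw [ENNReal.tsum_const]

/-- Counting lattice points in a symmetric convex body which contains, up to a factor `ρ`,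
linearly independent vectors of the lattice. -/
theorem abs_ncard_inter_sub_le (μ : Measure E) [μ.IsAddHaarMeasure]
    (L : Submodule ℤ E) [DiscreteTopology L] [IsZLattice ℝ L]
    (b : Module.Basis ι ℝ E) (hb : ∀ i, b i ∈ L) (B : Set E) (hconv : Convex ℝ B)
    (hsymm : ∀ x ∈ B, -x ∈ B) (hbdd : Bornology.IsBounded B)
    (h0 : (0 : E) ∈ B) (ρ : ℝ) (hρ : 0 ≤ ρ) (hbB : ∀ i, ∃ y ∈ B, b i = ρ • y) :
    ((L : Set E) ∩ B).Finite ∧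
    |(((L : Set E) ∩ B).ncard : ℝ) - μ.real B / ZLattice.covolume L μ| ≤
      μ.real B / ZLattice.covolume L μ *
        ((1 + Fintype.card ι * ρ) ^ (Fintype.card ι) - 1) := by
  classical
  have hcountL : Countable L := inferInstance
  have hfin : ((L : Set E) ∩ B).Finite := by
    rw [Set.inter_comm]
    refine Metric.finite_isBounded_inter_isClosed ?_ hbdd ?_
    · exact (inferInstance : DiscreteTopology L.toAddSubgroup).isDiscrete
    · exact @AddSubgroup.isClosed_of_discrete E _ _ _ _ L.toAddSubgroup
        (inferInstanceAs (DiscreteTopology L))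
  refine ⟨hfin, ?_⟩
  set n := Fintype.card ι
  have hn : Module.finrank ℝ E = n := Module.finrank_eq_card_basis b
  set P := ZSpan.fundamentalDomain b
  set r : ℝ := n * ρ
  have hr : 0 ≤ r := by positivity
  have hconvs : ∀ (x y : E) (a c : ℝ), x ∈ B → y ∈ B → 0 ≤ a → 0 ≤ c → a + c ≤ 1 →
      a • x + c • y ∈ B := by
    intro x y a c hx hy ha hc hac
    have := hconv.sum_mem (t := Finset.univ) (w := ![a, c, 1 - a - c]) (z := ![x, y, 0])
      (by intro i _; fin_cases i <;> simp <;> linarith) (by simp [Fin.sum_univ_three])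
      (by intro i _; fin_cases i <;> simp [hx, hy, h0])
    simpa [Fin.sum_univ_three] using this
  have hsum : ∀ (y : ι → E) (a : ι → ℝ), (∀ i, y i ∈ B) → (∀ i, 0 ≤ a i ∧ a i ≤ 1) →
      ∃ z ∈ B, ∑ i, a i • y i = (n : ℝ) • z := by
    intro y a hy ha
    rcases Nat.eq_zero_or_pos n with h | h
    · have : IsEmpty ι := Fintype.card_eq_zero_iff.1 h
      exact ⟨0, h0, by simp⟩
    have hn0 : (0 : ℝ) < n := by exact_mod_cast h
    refine ⟨∑ i, (1 / (n : ℝ)) • (a i • y i), ?_, ?_⟩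
    · refine hconv.sum_mem (fun _ _ => by positivity) ?_ ?_
      · rw [Finset.sum_const, Finset.card_univ, nsmul_eq_mul]
        exact mul_one_div_cancel hn0.ne'
      · intro i _
        have := hconvs (y i) 0 (a i) 0 (hy i) h0 (ha i).1 le_rfl (by linarith [(ha i).2])
        simpa using this
    · rw [← Finset.smul_sum, smul_smul]
      field_simp
      simp
  have hP : ∀ p ∈ P, ∃ z ∈ B, p = r • z := by
    intro p hp
    rw [ZSpan.mem_fundamentalDomain] at hp
    choose y hy hby using hbB
    obtain ⟨z, hz, h⟩ := hsum y (fun i => b.repr p i) hy (fun i => ⟨(hp i).1, (hp i).2.le⟩)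
    refine ⟨z, hz, ?_⟩
    rw [← b.sum_repr p]
    simp_rw [hby]
    rw [show r • z = ρ • ((n : ℝ) • z) by rw [smul_smul, mul_comm ρ], ← h, Finset.smul_sum]
    exact Finset.sum_congr rfl fun i _ => smul_comm _ _ _
  -- the index relation
  set q : ENNReal := (ENat.card (L.toAddSubgroup ⧸
    (Submodule.span ℤ (Set.range b)).toAddSubgroup.addSubgroupOf L.toAddSubgroup) : ENNReal)
  have hcov := ZLattice.isAddFundamentalDomain (Module.Free.chooseBasis ℤ L) μ
  set F := ZSpan.fundamentalDomain ((Module.Free.chooseBasis ℤ L).ofZLatticeBasis ℝ) with hF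
  have hFtop : μ F ≠ ⊤ := (ZSpan.fundamentalDomain_isBounded _).measure_lt_top.ne
  have hF0 : μ F ≠ 0 := ZSpan.measure_fundamentalDomain_ne_zero _
  have hPtop : μ P ≠ ⊤ := (ZSpan.fundamentalDomain_isBounded _).measure_lt_top.ne
  have hP0 : μ P ≠ 0 := ZSpan.measure_fundamentalDomain_ne_zero _
  have hBtop : μ B ≠ ⊤ := hbdd.measure_lt_top.ne
  have hq : μ P = q * μ F := by
    rw [← tsum_vadd_inter_fundamentalDomain μ L b hb F]
    have hm : MeasurableConstVAdd L E := (inferInstance : MeasurableConstVAdd L.toAddSubgroup E)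
    have hv : VAddInvariantMeasure L E μ :=
      (inferInstance : VAddInvariantMeasure L.toAddSubgroup E μ)
    rw [hcov.measure_eq_tsum' P]
    refine tsum_congr fun g => ?_
    rw [Set.inter_comm]
    rfl
  have hcovF : ZLattice.covolume L μ = μ.real F :=
    ZLattice.covolume_eq_measure_fundamentalDomain L μ hcov
  have hqtop : q ≠ ⊤ := by
    intro h; rw [h, ENNReal.top_mul hF0] at hq; exact hPtop hq
  have hq0 : q ≠ 0 := by
    intro h; rw [h, zero_mul] at hq; exact hP0 hq
  have hvol : ∀ c : ℝ, 0 ≤ c → (q * μ (c • B)).toReal = q.toReal * (c ^ n * μ.real B) := by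
    intro c hc
    rw [Measure.addHaar_smul, hn, ENNReal.toReal_mul, ENNReal.toReal_mul, abs_of_nonneg (by positivity),
      ENNReal.toReal_ofReal (by positivity)]
    rfl
  set N := ((L : Set E) ∩ B).ncard with hN
  have hcardsum : ∀ a : ENNReal, ∑' x : L, (if (x : E) ∈ B then a else 0) = N * a := by
    intro a
    have h1 : ∑' x : L, (if (x : E) ∈ B then a else 0) =
        ∑' x : L, Set.indicator {x : L | (x : E) ∈ B} (fun _ => a) x := by
      refine tsum_congr fun x => ?_
      simp [Set.indicator_apply]
    rw [h1, ← tsum_subtype, ENNReal.tsum_const]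
    congr 1
    have h2 : N = {x : L | (x : E) ∈ B}.ncard := by
      rw [hN, ← Set.ncard_image_of_injective _ Subtype.val_injective]
      congr 1
      ext x; simp [and_comm]
    have h3 : {x : L | (x : E) ∈ B}.Finite := by
      refine Set.Finite.of_finite_image (f := Subtype.val) (hfin.subset ?_)
        Subtype.val_injective.injOn
      rintro _ ⟨x, hx, rfl⟩; exact ⟨x.2, hx⟩
    rw [h2, ← ENat.toENNReal_coe, h3.cast_ncard_eq]
    rfl
  have hupper : (N : ENNReal) * μ P ≤ q * μ ((1 + r) • B) := by
    rw [← hcardsum, ← tsum_vadd_inter_fundamentalDomain μ L b hb]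
    refine ENNReal.tsum_le_tsum fun x => ?_
    split_ifs with hx
    · refine measure_mono fun p hp => ⟨?_, hp⟩
      obtain ⟨z, hz, rfl⟩ := hP p hp
      rw [Set.mem_vadd_set]
      refine ⟨r • z - x, ?_, by simp⟩
      rw [Set.mem_smul_set_iff_inv_smul_mem₀ (by positivity), smul_sub, sub_eq_add_neg, ← smul_neg,
        smul_smul]
      refine hconvs z (-x) _ _ hz (hsymm _ hx) (by positivity) (by positivity) ?_
      rw [← mul_add_one, add_comm r]
      exact (inv_mul_cancel₀ (by positivity)).le
    · exact zero_le
  have hlower : r ≤ 1 → q * μ ((1 - r) • B) ≤ (N : ENNReal) * μ P := by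
    intro hr1
    rw [← hcardsum, ← tsum_vadd_inter_fundamentalDomain μ L b hb]
    refine ENNReal.tsum_le_tsum fun x => ?_
    split_ifs with hx
    · exact measure_mono Set.inter_subset_right
    · rw [nonpos_iff_eq_zero]
      convert! measure_empty (μ := μ)
      rw [Set.eq_empty_iff_forall_notMem]
      rintro p ⟨hp1, hp2⟩
      obtain ⟨z, hz, rfl⟩ := hP p hp2
      obtain ⟨y, ⟨w, hw, rfl⟩, hy⟩ := hp1
      apply hx
      have : (x : E) = r • z + (1 - r) • (-w) := by
        simp only [vadd_eq_add] at hy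
        rw [← hy]; simp
      rw [this]
      exact hconvs z (-w) _ _ hz (hsymm _ hw) hr (by linarith) (by linarith)
  have hPr : μ.real P = q.toReal * ZLattice.covolume L μ := by
    rw [hcovF, Measure.real, hq, ENNReal.toReal_mul]; rfl
  have hcpos := ZLattice.covolume_pos L μ
  have hqpos : 0 < q.toReal := ENNReal.toReal_pos hq0 hqtop
  have hBnn : 0 ≤ μ.real B := measureReal_nonneg
  have hU : (N : ℝ) * ZLattice.covolume L μ ≤ (1 + r) ^ n * μ.real B := by
    have := ENNReal.toReal_mono ?_ hupper
    · rw [hvol _ (by positivity), ENNReal.toReal_mul, ENNReal.toReal_natCast] at this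
      change (N : ℝ) * μ.real P ≤ _ at this
      rw [hPr] at this
      refine le_of_mul_le_mul_left ?_ hqpos
      linarith
    · refine ENNReal.mul_ne_top hqtop ?_
      rw [Measure.addHaar_smul]
      exact ENNReal.mul_ne_top ENNReal.ofReal_ne_top hBtop
  have hLw : r ≤ 1 → (1 - r) ^ n * μ.real B ≤ (N : ℝ) * ZLattice.covolume L μ := by
    intro hr1
    have := ENNReal.toReal_mono ?_ (hlower hr1)
    · rw [hvol _ (by linarith), ENNReal.toReal_mul, ENNReal.toReal_natCast] at this
      change _ ≤ (N : ℝ) * μ.real P at this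
      rw [hPr] at this
      refine le_of_mul_le_mul_left ?_ hqpos
      linarith
    · exact ENNReal.mul_ne_top (ENNReal.natCast_ne_top _) hPtop
  have hV : 0 ≤ μ.real B / ZLattice.covolume L μ := by positivity
  rw [abs_le]
  constructor
  · rcases le_or_gt r 1 with hr1 | hr1
    · have h1 : (1 - r) ^ n * (μ.real B / ZLattice.covolume L μ) ≤ N := by
        rw [mul_div_assoc', div_le_iff₀ hcpos]; exact hLw hr1
      have h2 : 2 ≤ (1 + r) ^ n + (1 - r) ^ n := by
        have h3 := one_add_mul_le_pow (by linarith : (-2 : ℝ) ≤ r) n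
        have h4 := one_add_mul_le_pow (by linarith : (-2 : ℝ) ≤ -r) n
        rw [← sub_eq_add_neg] at h4
        linarith
      nlinarith
    · have h3 := one_add_mul_le_pow (by linarith : (-2 : ℝ) ≤ r) n
      have hn1 : (1 : ℝ) ≤ n := by
        rcases Nat.eq_zero_or_pos n with h | h
        · simp [r, h] at hr1; linarith
        · exact_mod_cast h
      have h4 : 1 ≤ (1 + r) ^ n - 1 := by nlinarith
      have : (0 : ℝ) ≤ N := by positivity
      nlinarith
  · have : (N : ℝ) ≤ (1 + r) ^ n * (μ.real B / ZLattice.covolume L μ) := by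
      rw [mul_div_assoc', le_div_iff₀ hcpos]; exact hU
    linarith

end LatticeCount

/-- The absolute value of the discriminant of a number field, as a real number. -/
noncomputable def absDisc (K : Type*) [Field K] [NumberField K] : ℝ := |(discr K : ℝ)|

section MinkowskiTheory

open NumberField.InfinitePlace NumberField.mixedEmbedding Module MeasureTheory
open scoped nonZeroDivisors NNReal ENNReal

variable {K : Type*} [Field K] [NumberField K]

theorem one_le_absDisc (K : Type*) [Field K] [NumberField K] : 1 ≤ absDisc K := by
  have h : (1 : ℤ) ≤ |discr K| := Int.one_le_abs (discr_ne_zero K)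
  have h2 : ((1 : ℤ) : ℝ) ≤ ((|discr K| : ℤ) : ℝ) := Int.cast_le.mpr h
  simpa [absDisc] using h2

theorem absDisc_pos (K : Type*) [Field K] [NumberField K] : 0 < absDisc K :=
  zero_lt_one.trans_le (one_le_absDisc K)

theorem one_le_sqrt_absDisc (K : Type*) [Field K] [NumberField K] : 1 ≤ √(absDisc K) := by
  rw [Real.one_le_sqrt]; exact one_le_absDisc K

theorem minkowskiBound_le (I : (FractionalIdeal (𝓞 K)⁰ K)ˣ) :
    minkowskiBound K I ≤
      ENNReal.ofReal (2 ^ finrank ℚ K * √(absDisc K) * FractionalIdeal.absNorm (I : FractionalIdeal (𝓞 K)⁰ K)) := by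
  classical
  rw [minkowskiBound, volume_fundamentalDomain_fractionalIdealLatticeBasis,
    volume_fundamentalDomain_latticeBasis, mixedEmbedding.finrank]
  have h1 : ((NNReal.sqrt ‖discr K‖₊ : ℝ≥0) : ℝ≥0∞) = ENNReal.ofReal (√(absDisc K)) := by
    rw [ENNReal.ofReal, absDisc]
    congr 1
    ext
    rw [Real.coe_sqrt, coe_nnnorm, Int.norm_eq_abs, Real.coe_toNNReal _ (Real.sqrt_nonneg _)]
  have h2 : ((2 : ℝ≥0∞)⁻¹) ^ nrComplexPlaces K ≤ 1 := pow_le_one₀ (by positivity) (by simp)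
  have h0 : (0:ℝ) ≤ FractionalIdeal.absNorm (I : FractionalIdeal (𝓞 K)⁰ K) :=
    Rat.cast_nonneg.mpr (FractionalIdeal.absNorm_nonneg I.val)
  rw [ENNReal.ofReal_mul (by positivity), ENNReal.ofReal_mul (by positivity),
    ENNReal.ofReal_pow (by norm_num), h1]
  calc _ ≤ ENNReal.ofReal ↑(FractionalIdeal.absNorm (I : FractionalIdeal (𝓞 K)⁰ K)) *
      (1 * ENNReal.ofReal (√(absDisc K))) * 2 ^ finrank ℚ K := by gcongr
    _ = _ := by
      rw [ENNReal.ofReal_ofNat]; ring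

/-- The fractional ideal, as a unit, attached to a nonzero ideal. -/
noncomputable def fracUnit (J : Ideal (𝓞 K)) (hJ : J ≠ ⊥) : (FractionalIdeal (𝓞 K)⁰ K)ˣ :=
  Units.mk0 (J : FractionalIdeal (𝓞 K)⁰ K) (FractionalIdeal.coeIdeal_ne_zero.mpr hJ)

theorem absNorm_fracUnit (J : Ideal (𝓞 K)) (hJ : J ≠ ⊥) :
    (FractionalIdeal.absNorm (fracUnit (K := K) J hJ : FractionalIdeal (𝓞 K)⁰ K) : ℝ)
      = Ideal.absNorm J := by
  simp [fracUnit, FractionalIdeal.coeIdeal_absNorm]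

theorem exists_ne_zero_mem_ideal_lt_of_prod_lt (J : Ideal (𝓞 K)) (hJ : J ≠ ⊥)
    (f : InfinitePlace K → ℝ) (hf : ∀ w, 0 ≤ f w)
    (h : 2 ^ finrank ℚ K * √(absDisc K) * Ideal.absNorm J < ∏ w, f w ^ mult w) :
    ∃ a ∈ J, a ≠ 0 ∧ ∀ w : InfinitePlace K, w (a : K) < f w := by
  classical
  lift f to InfinitePlace K → ℝ≥0 using hf
  have hlt : minkowskiBound K (fracUnit J hJ) < volume (convexBodyLT K f) := by
    refine (minkowskiBound_le _).trans_lt ?_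
    rw [absNorm_fracUnit, convexBodyLT_volume]
    calc _ < ENNReal.ofReal (∏ w, (f w : ℝ) ^ mult w) := by
          rw [ENNReal.ofReal_lt_ofReal_iff_of_nonneg (by positivity)]; exact h
      _ = ∏ w, ((f w : ℝ≥0∞)) ^ mult w := by
          rw [ENNReal.ofReal_prod_of_nonneg (fun _ _ ↦ by positivity)]
          refine Finset.prod_congr rfl fun w _ ↦ ?_
          rw [ENNReal.ofReal_pow (by positivity), ENNReal.ofReal_coe_nnreal]
      _ ≤ _ := by
          conv_lhs => rw [← one_mul (∏ w, ((f w : ℝ≥0∞)) ^ mult w)]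
          rw [ENNReal.ofNNReal_finsetProd]
          simp only [ENNReal.coe_pow]
          gcongr
          exact ENNReal.one_le_coe_iff.mpr (one_le_convexBodyLTFactor K)
  obtain ⟨a, ha, ha0, hlt⟩ := exists_ne_zero_mem_ideal_lt K _ hlt
  obtain ⟨b, hb, rfl⟩ := (FractionalIdeal.mem_coeIdeal _).mp ha
  exact ⟨b, hb, by rintro rfl; simp at ha0, hlt⟩

theorem exists_primitive_element_le (K : Type*) [Field K] [NumberField K] :
    ∃ a : 𝓞 K, IntermediateField.adjoin ℚ {(a : K)} = ⊤ ∧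
      ∀ w : InfinitePlace K, w (a : K) ≤ 2 ^ (finrank ℚ K + 2) * absDisc K := by
  have hD := one_le_absDisc K
  set B : ℝ≥0 := ⟨2 ^ (finrank ℚ K + 1) * absDisc K, by positivity⟩ with hBdef
  have hBr : (B : ℝ) = 2 ^ (finrank ℚ K + 1) * absDisc K := rfl
  have hsq : √(absDisc K) ≤ absDisc K := by
    rw [Real.sqrt_le_left (by positivity)]; nlinarith
  have hp : (1:ℝ) ≤ 2 ^ finrank ℚ K := one_le_pow₀ (by norm_num)
  have hmk : minkowskiBound K ↑1 < B := by
    refine (minkowskiBound_le _).trans_lt ?_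
    rw [← ENNReal.ofReal_coe_nnreal, ENNReal.ofReal_lt_ofReal_iff_of_nonneg (by simp), hBr]
    simp only [Units.val_one, FractionalIdeal.absNorm_one, Rat.cast_one, mul_one, pow_succ]
    nlinarith
  obtain ⟨w₀⟩ : Nonempty (InfinitePlace K) := inferInstance
  rcases isReal_or_isComplex w₀ with hw | hw
  · obtain ⟨a, ha, hlt⟩ := exists_primitive_element_lt_of_isReal K hw (B := B)
      (hmk.trans_le (le_mul_of_one_le_left (by simp) (by exact_mod_cast one_le_convexBodyLTFactor K)))
    refine ⟨a, ha, fun w ↦ (hlt w).le.trans ?_⟩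
    rw [NNReal.coe_max, hBr, pow_add, pow_add, NNReal.coe_one]
    apply max_le <;> nlinarith
  · obtain ⟨a, ha, hlt⟩ := exists_primitive_element_lt_of_isComplex K hw (B := B)
      (hmk.trans_le (le_mul_of_one_le_left (by simp) (by exact_mod_cast one_le_convexBodyLT'Factor K)))
    refine ⟨a, ha, fun w ↦ (hlt w).le.trans ?_⟩
    rw [Real.sqrt_le_left (by positivity), hBr, pow_add, pow_add]
    have h1 : (1:ℝ) ≤ 2 ^ finrank ℚ K * absDisc K := by nlinarith
    nlinarith

theorem span_range_mixedEmbedding_eq_top {ι : Type*} (v : Basis ι ℚ K) :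
    Submodule.span ℝ (Set.range fun i ↦ mixedEmbedding K (v i)) = ⊤ := by
  rw [eq_top_iff, ← (mixedEmbedding.latticeBasis K).span_eq, Submodule.span_le]
  rintro _ ⟨j, rfl⟩
  rw [latticeBasis_apply]
  have key : ∀ x : K, mixedEmbedding K x ∈
      Submodule.span ℝ (Set.range fun i ↦ mixedEmbedding K (v i)) := by
    intro x
    have hx : x ∈ Submodule.span ℚ (Set.range v) := by rw [v.span_eq]; trivial
    induction hx using Submodule.span_induction with
    | mem y hy => obtain ⟨i, rfl⟩ := hy; exact Submodule.subset_span ⟨i, rfl⟩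
    | zero => simp
    | add a b _ _ ha hb => rw [map_add]; exact Submodule.add_mem _ ha hb
    | smul q a _ ha =>
      have : mixedEmbedding K (q • a) = (q : ℝ) • mixedEmbedding K a := by
        rw [map_rat_smul (mixedEmbedding K) q a, Rat.cast_smul_eq_qsmul]
      rw [this]
      exact Submodule.smul_mem _ _ ha
  exact key _

/-- An `ℝ`-basis of the mixed space from a `ℚ`-basis of the field. -/
noncomputable def mixedBasis {ι : Type*} [Fintype ι] (v : Basis ι ℚ K) : Basis ι ℝ (mixedSpace K) :=
  basisOfTopLeSpanOfCardEqFinrank (fun i ↦ mixedEmbedding K (v i))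
    (span_range_mixedEmbedding_eq_top v).ge
    (by rw [mixedEmbedding.finrank, finrank_eq_card_basis v])

theorem mixedBasis_apply {ι : Type*} [Fintype ι] (v : Basis ι ℚ K) (i : ι) :
    mixedBasis v i = mixedEmbedding K (v i) := by simp [mixedBasis]

theorem mixedEmbedding_mem_smul_convexBodyLT {K : Type*} [Field K] (f : InfinitePlace K → ℝ≥0) {ρ : ℝ} (hρ : 0 < ρ) (x : K)
    (hx : ∀ w : InfinitePlace K, w x < ρ * f w) :
    ∃ y ∈ convexBodyLT K f, mixedEmbedding K x = ρ • y := by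
  refine ⟨ρ⁻¹ • mixedEmbedding K x, ?_, by rw [smul_inv_smul₀ hρ.ne']⟩
  have h : ∀ w : InfinitePlace K, ρ⁻¹ * w x < f w := fun w ↦ by
    rw [inv_mul_lt_iff₀ hρ]; exact hx w
  simp only [convexBodyLT, Set.mem_prod, Set.mem_pi, Set.mem_univ, true_imp_iff,
    mem_ball_zero_iff]
  constructor
  · rintro ⟨w, hw⟩
    have := h w
    rw [← norm_embedding_of_isReal hw] at this
    simpa [_root_.norm_smul, abs_of_pos hρ] using this
  · rintro ⟨w, hw⟩
    have := h w
    rw [← norm_embedding_eq] at this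
    simpa [_root_.norm_smul, abs_of_pos hρ] using this

/-- The constant in the asymptotic count of lattice points in boxes. -/
noncomputable def boxConst (K : Type*) [Field K] [NumberField K] : ℝ :=
  2 ^ nrRealPlaces K * (2 * Real.pi) ^ nrComplexPlaces K / √(absDisc K)

theorem abs_ncard_box_sub_le_aux (J : Ideal (𝓞 K)) (hJ : J ≠ ⊥) (f : InfinitePlace K → ℝ)
    (hf : ∀ w, 0 < f w) {ι : Type*} [Fintype ι] (v : Basis ι ℚ K)
    (hv : ∀ i, ∃ a ∈ J, v i = (a : K)) (ρ : ℝ) (hρ : 0 < ρ)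
    (hvρ : ∀ i (w : InfinitePlace K), w (v i) < ρ * f w) (X : ℝ)
    (hX : ∏ w, f w ^ mult w = X * Ideal.absNorm J) :
    {x : 𝓞 K | x ∈ J ∧ ∀ w : InfinitePlace K, w (x : K) < f w}.Finite ∧
    |({x : 𝓞 K | x ∈ J ∧ ∀ w : InfinitePlace K, w (x : K) < f w}.ncard : ℝ) - boxConst K * X| ≤
      boxConst K * X * ((1 + Fintype.card ι * ρ) ^ (Fintype.card ι) - 1) := by
  classical
  lift f to InfinitePlace K → ℝ≥0 using fun w ↦ (hf w).le
  have hNJ : (0:ℝ) < Ideal.absNorm J := by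
    exact_mod_cast Nat.pos_of_ne_zero (by rwa [Ne, Ideal.absNorm_eq_zero_iff])
  have h := abs_ncard_inter_sub_le (volume : Measure (mixedSpace K))
    (idealLattice K (fracUnit J hJ)) (mixedBasis v) (by
      intro i
      obtain ⟨a, ha, hva⟩ := hv i
      rw [mixedBasis_apply, mem_idealLattice]
      exact ⟨_, by rw [hva]; exact (FractionalIdeal.mem_coeIdeal_of_mem _ ha), rfl⟩)
    (convexBodyLT K f) (convexBodyLT_convex K f) (fun x hx ↦ convexBodyLT_neg_mem K f x hx)
    (by
      refine Bornology.IsBounded.prod ?_ ?_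
      · exact Bornology.IsBounded.pi fun _ ↦ Metric.isBounded_ball
      · exact Bornology.IsBounded.pi fun _ ↦ Metric.isBounded_ball)
    (by
      have := (convexBodyLT_mem K f (x := 0)).mpr (by simpa using hf)
      simpa using this) ρ hρ.le
    (fun i ↦ by
      rw [mixedBasis_apply]; exact mixedEmbedding_mem_smul_convexBodyLT f hρ _ (hvρ i))
  have hvol : (volume : Measure (mixedSpace K)).real (convexBodyLT K f) /
      ZLattice.covolume (idealLattice K (fracUnit J hJ)) volume = boxConst K * X := by
    rw [covolume_idealLattice, absNorm_fracUnit, measureReal_def, convexBodyLT_volume]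
    rw [ENNReal.toReal_mul, ENNReal.coe_toReal, ENNReal.coe_toReal]
    push_cast
    rw [hX, boxConst, absDisc]
    have : √|(discr K : ℝ)| ≠ 0 := by
      have := one_le_sqrt_absDisc K; rw [absDisc] at this; positivity
    rw [inv_pow, mul_pow, NNReal.coe_real_pi]
    field_simp
  rw [hvol] at h
  have himg : (idealLattice K (fracUnit J hJ) : Set (mixedSpace K)) ∩ convexBodyLT K f =
      (fun x : 𝓞 K ↦ mixedEmbedding K (x : K)) ''
        {x : 𝓞 K | x ∈ J ∧ ∀ w : InfinitePlace K, w (x : K) < f w} := by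
    ext y
    simp only [Set.mem_inter_iff, SetLike.mem_coe, mem_idealLattice, Set.mem_image]
    constructor
    · rintro ⟨⟨x, hx, rfl⟩, hy⟩
      obtain ⟨b, hb, rfl⟩ := (FractionalIdeal.mem_coeIdeal _).mp hx
      exact ⟨b, ⟨hb, (convexBodyLT_mem K f).mp hy⟩, rfl⟩
    · rintro ⟨x, ⟨hx, hlt⟩, rfl⟩
      exact ⟨⟨x, FractionalIdeal.mem_coeIdeal_of_mem _ hx, rfl⟩, (convexBodyLT_mem K f).mpr hlt⟩
  have hinj : Function.Injective (fun x : 𝓞 K ↦ mixedEmbedding K (x : K)) :=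
    (mixedEmbedding_injective K).comp RingOfIntegers.coe_injective
  rw [himg, Set.ncard_image_of_injective _ hinj] at h
  exact ⟨(Set.finite_image_iff hinj.injOn).mp h.1, h.2⟩

theorem boxConst_pos (K : Type*) [Field K] [NumberField K] : 0 < boxConst K := by
  have := one_le_sqrt_absDisc K
  have := Real.pi_pos
  rw [boxConst]; positivity

theorem boxConst_le (K : Type*) [Field K] [NumberField K] :
    boxConst K ≤ (2 * Real.pi) ^ finrank ℚ K / √(absDisc K) := by
  have h1 := one_le_sqrt_absDisc K
  have h2 : (2:ℝ) ≤ 2 * Real.pi := by linarith [Real.pi_gt_three]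
  rw [boxConst]
  gcongr
  calc (2:ℝ) ^ nrRealPlaces K * (2 * Real.pi) ^ nrComplexPlaces K
      ≤ (2 * Real.pi) ^ nrRealPlaces K * (2 * Real.pi) ^ nrComplexPlaces K := by gcongr
    _ = (2 * Real.pi) ^ (nrRealPlaces K + nrComplexPlaces K) := by rw [pow_add]
    _ ≤ _ := by
      apply pow_le_pow_right₀ (by linarith)
      have := card_add_two_mul_card_eq_rank K
      omega

theorem inv_le_boxConst (K : Type*) [Field K] [NumberField K] :
    (√(absDisc K))⁻¹ ≤ boxConst K := by
  have h1 := one_le_sqrt_absDisc K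
  have h2 : (1:ℝ) ≤ 2 * Real.pi := by linarith [Real.pi_gt_three]
  rw [boxConst, ← one_div]
  gcongr
  exact one_le_mul_of_one_le_of_one_le (one_le_pow₀ (by norm_num)) (one_le_pow₀ h2)

theorem one_add_mul_pow_sub_one_le (n : ℕ) {c x : ℝ} (hc : 0 ≤ c) (hx0 : 0 ≤ x)
    (hx1 : x ≤ 1) :
    (1 + c * x) ^ n - 1 ≤ x * (1 + c) ^ n := by
  have h := (convexOn_pow n).2 (x := 1) (y := 1 + c) (by simp) (by simp; positivity)
    (sub_nonneg.mpr hx1) hx0 (by ring)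
  simp only [smul_eq_mul, one_pow, mul_one] at h
  have : (1 - x) + x * (1 + c) = 1 + c * x := by ring
  rw [this] at h
  linarith

/-- The number of elements of an ideal in a box, with a power saving error term which is
polynomial in the discriminant. -/
theorem exists_abs_ncard_box_sub_le (n : ℕ) (hn : n ≠ 0) : ∃ C A : ℝ, 0 < C ∧ 0 < A ∧
    ∀ (K : Type) [Field K] [NumberField K], finrank ℚ K ≤ n → ∀ J : Ideal (𝓞 K), J ≠ ⊥ →
    ∀ (f : InfinitePlace K → ℝ), (∀ w, 0 < f w) → ∀ X : ℝ, 1 ≤ X →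
    ∏ w, f w ^ mult w = X * Ideal.absNorm J →
    {x : 𝓞 K | x ∈ J ∧ ∀ w : InfinitePlace K, w (x : K) < f w}.Finite ∧
    |({x : 𝓞 K | x ∈ J ∧ ∀ w : InfinitePlace K, w (x : K) < f w}.ncard : ℝ) - boxConst K * X| ≤
      C * absDisc K ^ A * X ^ (1 - 1 / (n : ℝ)) := by
  have hpi : (1:ℝ) ≤ 2 * Real.pi := by linarith [Real.pi_gt_three]
  set C₁ : ℝ := n * (2 ^ (n + 1) * (2 ^ (n + 2)) ^ n) with hC₁
  have hC₁pos : 0 ≤ C₁ := by positivity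
  refine ⟨(2 * Real.pi) ^ n * (1 + C₁) ^ n, (n + 1) * n, by positivity, by positivity, ?_⟩
  intro K _ _ hKn J hJ f hf X hX hfX
  have hD := one_le_absDisc K
  have hN0 : 0 < finrank ℚ K := finrank_pos
  have hXpos : 0 < X := by linarith
  have hNJ : (0:ℝ) < Ideal.absNorm J := by
    exact_mod_cast Nat.pos_of_ne_zero (by rwa [Ne, Ideal.absNorm_eq_zero_iff])
  have hsq : √(absDisc K) ≤ absDisc K := by
    rw [Real.sqrt_le_left (by positivity)]; nlinarith
  set N := finrank ℚ K with hN
  obtain ⟨γ, hγ, hγle⟩ := exists_primitive_element_le K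
  set Γ : ℝ := 2 ^ (N + 2) * absDisc K with hΓ
  have hΓ1 : 1 ≤ Γ := one_le_mul_of_one_le_of_one_le (one_le_pow₀ (by norm_num)) hD
  -- a short vector
  set x : ℝ := X ^ (-(1 / (n : ℝ))) with hx
  have hx0 : 0 < x := by positivity
  have hx1 : x ≤ 1 := Real.rpow_le_one_of_one_le_of_nonpos hX (by
    rw [neg_nonpos]; positivity)
  have hρN : 2 ^ (N + 1) * absDisc K / X ≤ (2 ^ (N + 1) * absDisc K * x) ^ N := by
    have h1 : (1:ℝ) ≤ 2 ^ (N + 1) * absDisc K :=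
      one_le_mul_of_one_le_of_one_le (one_le_pow₀ (by norm_num)) hD
    rw [mul_pow, div_eq_mul_inv]
    gcongr
    · exact le_self_pow₀ h1 hN0.ne'
    · rw [hx, ← Real.rpow_natCast, ← Real.rpow_mul hXpos.le, ← Real.rpow_neg_one]
      apply Real.rpow_le_rpow_of_exponent_le hX
      have hn' : (0:ℝ) < n := by positivity
      have : (N : ℝ) ≤ n := by exact_mod_cast hKn
      rw [neg_mul, neg_le_neg_iff, one_div, inv_mul_le_iff₀ hn']
      linarith
  set ρ : ℝ := 2 ^ (N + 1) * absDisc K * x with hρ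
  have hρ0 : 0 < ρ := by positivity
  obtain ⟨a, haJ, ha0, halt⟩ := exists_ne_zero_mem_ideal_lt_of_prod_lt J hJ (fun w ↦ ρ * f w)
    (fun w ↦ by have := hf w; positivity) (by
      simp_rw [mul_pow]
      rw [Finset.prod_mul_distrib, hfX, Finset.prod_pow_eq_pow_sum, sum_mult_eq, ← hN, ← mul_assoc]
      refine mul_lt_mul_of_pos_right ?_ hNJ
      calc 2 ^ N * √(absDisc K) ≤ 2 ^ N * absDisc K := by gcongr
        _ < 2 ^ (N + 1) * absDisc K := by gcongr <;> simp
        _ = 2 ^ (N + 1) * absDisc K / X * X := by field_simp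
        _ ≤ _ := by gcongr)
  have haK : (a : K) ≠ 0 := by simpa using ha0
  have hInt : IsIntegral ℚ (γ : K) := IsIntegral.of_finite ℚ _
  let pb := (PowerBasis.ofAdjoinEqTop' hInt (by
    rw [← IntermediateField.adjoin_simple_toSubalgebra_of_isAlgebraic hInt.isAlgebraic, hγ]; rfl))
  have hpbgen : pb.gen = (γ : K) := PowerBasis.ofAdjoinEqTop'_gen _ _
  have hpbdim : pb.dim = N := pb.finrank.symm
  let v : Basis (Fin pb.dim) ℚ K := pb.basis.map
    (LinearEquiv.ofBijective (LinearMap.mulLeft ℚ (a : K))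
      ⟨fun y z h ↦ mul_left_cancel₀ haK h, fun y ↦ ⟨(a : K)⁻¹ * y, by simp [haK]⟩⟩)
  have hvi : ∀ i, v i = (a : K) * (γ : K) ^ (i : ℕ) := fun i ↦ by
    rw [← hpbgen, ← pb.basis_eq_pow]
    rfl
  have hmain := abs_ncard_box_sub_le_aux J hJ f hf v
    (fun i ↦ ⟨a * γ ^ (i : ℕ), Ideal.mul_mem_right _ _ haJ, by rw [hvi]; simp⟩) (ρ * Γ ^ N)
    (by positivity) (fun i w ↦ by
      rw [hvi, map_mul, map_pow]
      calc w (a : K) * w (γ : K) ^ (i : ℕ) ≤ w (a : K) * Γ ^ N := by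
            gcongr
            refine (pow_le_pow_left₀ (apply_nonneg w _) (hγle w) _).trans ?_
            exact pow_le_pow_right₀ hΓ1 (by have := i.2; omega)
        _ < ρ * f w * Γ ^ N := by gcongr; exact halt w
        _ = _ := by ring) X hfX
  refine ⟨hmain.1, hmain.2.trans ?_⟩
  rw [Fintype.card_fin, hpbdim]
  have hV : boxConst K ≤ (2 * Real.pi) ^ n := by
    refine (boxConst_le K).trans ((div_le_self (by positivity) (one_le_sqrt_absDisc K)).trans ?_)
    exact pow_le_pow_right₀ hpi hKn
  set c : ℝ := C₁ * absDisc K ^ (n + 1) with hc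
  have hc0 : 0 ≤ c := by positivity
  have hle : N * (ρ * Γ ^ N) ≤ c * x := by
    calc N * (ρ * Γ ^ N) = N * ((2 ^ (N + 1) * (2 ^ (N + 2)) ^ N) * absDisc K ^ (N + 1)) * x := by
          rw [hρ, hΓ]; ring
      _ ≤ n * ((2 ^ (n + 1) * (2 ^ (n + 2)) ^ n) * absDisc K ^ (n + 1)) * x := by
          have h2 : (1:ℝ) ≤ 2 := by norm_num
          have h3 : ((2:ℝ) ^ (N + 2)) ^ N ≤ (2 ^ (n + 2)) ^ n := by
            rw [← pow_mul, ← pow_mul]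
            exact pow_le_pow_right₀ h2 (by gcongr)
          gcongr
      _ = c * x := by rw [hc, hC₁]; ring
  calc boxConst K * X * ((1 + N * (ρ * Γ ^ N)) ^ N - 1)
      ≤ (2 * Real.pi) ^ n * X * ((1 + c * x) ^ n - 1) := by
        have h0 : 0 ≤ N * (ρ * Γ ^ N) := by positivity
        have : (1 + N * (ρ * Γ ^ N)) ^ N ≤ (1 + c * x) ^ n :=
          (pow_le_pow_left₀ (by positivity) (by linarith) _).trans
            (pow_le_pow_right₀ (by nlinarith) hKn)
        gcongr
        rw [sub_nonneg]; exact one_le_pow₀ (by linarith)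
    _ ≤ (2 * Real.pi) ^ n * X * (x * (1 + c) ^ n) := by
        gcongr; exact one_add_mul_pow_sub_one_le n hc0 hx0.le hx1
    _ ≤ (2 * Real.pi) ^ n * X * (x * ((1 + C₁) * absDisc K ^ (n + 1)) ^ n) := by
        gcongr
        have : (1:ℝ) ≤ absDisc K ^ (n + 1) := one_le_pow₀ hD
        rw [hc]; nlinarith
    _ = _ := by
        rw [sub_eq_add_neg, Real.rpow_add hXpos, Real.rpow_one, ← hx, mul_pow _ (absDisc K ^ (n + 1)), ← pow_mul]
        have : absDisc K ^ (((n:ℝ) + 1) * n) = absDisc K ^ ((n + 1) * n) := by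
          rw [← Real.rpow_natCast]; push_cast; rfl
        rw [this]; ring

end MinkowskiTheory

section RieszMeans

open NumberField.InfinitePlace NumberField.Units NumberField.Units.dirichletUnitTheorem
open Module MeasureTheory
open scoped nonZeroDivisors NNReal ENNReal Pointwise Classical

theorem ENNReal.tsum_comp_addMonoidHom {A B : Type*} [AddCommGroup A] [AddCommGroup B] (f : A →+ B)
    (hf : Function.Surjective f) [Finite f.ker] (g : B → ℝ≥0∞) :
    ∑' a, g (f a) = Nat.card f.ker * ∑' b, g b := by
  rw [← (Equiv.sigmaFiberEquiv f).tsum_eq, ENNReal.tsum_sigma', ← ENNReal.tsum_mul_left]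
  refine tsum_congr fun b ↦ ?_
  have : ∀ c : {a // f a = b}, g (f ((Equiv.sigmaFiberEquiv f) ⟨b, c⟩)) = g b := fun c ↦
    congrArg g c.2
  simp_rw [this]
  obtain ⟨a₀, rfl⟩ := hf b
  let e : {a // f a = f a₀} ≃ f.ker :=
    { toFun := fun a ↦ ⟨a - a₀, by simp [AddMonoidHom.mem_ker, a.2]⟩
      invFun := fun k ↦ ⟨k + a₀, by simp [(AddMonoidHom.mem_ker).mp k.2]⟩
      left_inv := fun a ↦ by simp
      right_inv := fun k ↦ by simp }
  rw [ENNReal.tsum_const, ← Nat.card_congr e]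
  have : Finite {a // f a = f a₀} := Finite.of_equiv _ e.symm
  rw [ENat.card_eq_coe_natCard]
  simp

variable {K : Type*} [Field K] [NumberField K]

theorem tsum_volume_sub_logEmbedding_mem {D : Set (logSpace K)}
    (hD : IsAddFundamentalDomain (unitLattice K) D volume) (S : Set (logSpace K)) :
    ∑' u : Additive (𝓞 K)ˣ, volume ({w : logSpace K | w - logEmbedding K u ∈ S} ∩ D) =
      torsionOrder K * volume S := by
  have hmem : ∀ u, logEmbedding K u ∈ unitLattice K := fun u ↦ Submodule.mem_map_of_mem trivial
  let f : Additive (𝓞 K)ˣ →+ unitLattice K :=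
    (logEmbedding K).codRestrict (unitLattice K) hmem
  have hf : Function.Surjective f := by
    rintro ⟨_, ⟨u, _, rfl⟩⟩
    exact ⟨u, rfl⟩
  have hker : f.ker = (torsion K).toAddSubgroup := by
    rw [← logEmbedding_ker]
    ext u
    simp [f, AddMonoidHom.mem_ker]
  have hcard : Nat.card f.ker = torsionOrder K := by
    rw [hker]; rfl
  have hfin : Finite f.ker := by
    rw [hker]; exact inferInstanceAs (Finite (torsion K))
  have : VAddInvariantMeasure (unitLattice K) (logSpace K) volume :=
    inferInstanceAs (VAddInvariantMeasure (unitLattice K).toAddSubgroup (logSpace K) volume)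
  rw [← hcard, hD.measure_eq_tsum S, ← ENNReal.tsum_comp_addMonoidHom f hf]
  refine tsum_congr fun u ↦ ?_
  congr 2
  ext w
  rw [Set.mem_vadd_set_iff_neg_vadd_mem]
  have : -f u +ᵥ w = w - logEmbedding K u := by
    rw [Submodule.vadd_def]; simp [f]; abel
  rw [this]; rfl

/-- Extend a vector in the logarithmic space to a vector indexed by all infinite places whose
coordinates sum to zero. -/
noncomputable def logExtend (w : logSpace K) (v : InfinitePlace K) : ℝ :=
  if h : v = w₀ then -∑ i, w i else w ⟨v, h⟩

theorem logExtend_of_sum_eq_zero (g : InfinitePlace K → ℝ) (hg : ∑ v, g v = 0) :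
    logExtend (fun v : {v : InfinitePlace K // v ≠ w₀} ↦ g v) = g := by
  ext v
  unfold logExtend
  split_ifs with h
  · rw [Fintype.sum_eq_add_sum_subtype_ne _ w₀] at hg
    rw [h]; linarith
  · rfl

theorem logExtend_sub (w w' : logSpace K) (v : InfinitePlace K) :
    logExtend (w - w') v = logExtend w v - logExtend w' v := by
  unfold logExtend; split_ifs <;> simp; ring

theorem logExtend_smul (t : ℝ) (w : logSpace K) (v : InfinitePlace K) :
    logExtend (t • w) v = t * logExtend w v := by
  unfold logExtend; split_ifs <;> simp [Finset.mul_sum]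

theorem sum_logExtend (w : logSpace K) : ∑ v, logExtend w v = 0 := by
  classical
  rw [Fintype.sum_eq_add_sum_subtype_ne _ w₀]
  have : ∀ v : {v : InfinitePlace K // v ≠ w₀}, logExtend w v = w v := fun v ↦ by
    simp [logExtend, v.2]
  simp_rw [this]
  simp [logExtend]

theorem continuous_logExtend (v : InfinitePlace K) :
    Continuous fun w : logSpace K ↦ logExtend w v := by
  unfold logExtend; split_ifs <;> fun_prop

variable (K) in
/-- The simplex of logarithmic vectors with all coordinates bounded below. -/
def logSimplex (t : ℝ) : Set (logSpace K) :=
  {w | ∀ v : InfinitePlace K, -(t * (mult v / finrank ℚ K)) < logExtend w v}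

theorem logSimplex_of_nonpos {t : ℝ} (ht : t ≤ 0) : logSimplex K t = ∅ := by
  ext w
  simp only [logSimplex, Set.mem_ofPred_eq, Set.mem_empty_iff_false, iff_false]
  intro h
  have := sum_logExtend w
  have h2 : ∑ v : InfinitePlace K, (0:ℝ) < ∑ v, logExtend w v :=
    Finset.sum_lt_sum_of_nonempty Finset.univ_nonempty fun v _ ↦ by
      refine lt_of_le_of_lt ?_ (h v)
      rw [neg_nonneg]
      exact mul_nonpos_of_nonpos_of_nonneg ht (by positivity)
  simp at h2; linarith

theorem logSimplex_eq_smul {t : ℝ} (ht : 0 < t) : logSimplex K t = t • logSimplex K 1 := by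
  ext w
  rw [Set.mem_smul_set_iff_inv_smul_mem₀ ht.ne']
  simp only [logSimplex, Set.mem_ofPred_eq, logExtend_smul]
  refine forall_congr' fun v ↦ ?_
  rw [← mul_lt_mul_iff_right₀ ht (b := -(1 * _)), mul_inv_cancel_left₀ ht.ne']
  rw [one_mul, mul_neg]

/-- The truncated power function. -/
noncomputable def truncPow (r : ℕ) (t : ℝ) : ℝ := if 0 < t then t ^ r else 0

theorem truncPow_nonneg (r : ℕ) (t : ℝ) : 0 ≤ truncPow r t := by
  unfold truncPow; split_ifs <;> positivity

theorem volume_logSimplex (t : ℝ) :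
    volume (logSimplex K t) = ENNReal.ofReal (truncPow (rank K) t) * volume (logSimplex K 1) := by
  unfold truncPow
  split_ifs with h
  · rw [logSimplex_eq_smul h, Measure.addHaar_smul_of_nonneg _ h.le, Units.finrank_eq_rank]
  · rw [logSimplex_of_nonpos (not_lt.mp h)]; simp

theorem volume_logSimplex_one_pos : 0 < volume (logSimplex K 1) := by
  have ho : IsOpen (logSimplex K 1) := by
    have : logSimplex K 1 = ⋂ v : InfinitePlace K,
        {w | -(1 * ((mult v : ℝ) / finrank ℚ K)) < logExtend w v} := by
      ext; simp [logSimplex]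
    rw [this]
    exact isOpen_iInter_of_finite fun v ↦ isOpen_lt continuous_const (continuous_logExtend v)
  refine ho.measure_pos _ ⟨0, fun v ↦ ?_⟩
  have : logExtend (0 : logSpace K) v = 0 := by simp [logExtend]
  rw [this, one_mul, neg_lt_zero]
  have h1 : 0 < finrank ℚ K := finrank_pos
  have h2 := mult_pos (w := v)
  positivity

theorem volume_logSimplex_one_lt_top : volume (logSimplex K 1) < ⊤ := by
  refine Bornology.IsBounded.measure_lt_top ?_
  refine (Metric.isBounded_iff_subset_closedBall 0).mpr ⟨Fintype.card (InfinitePlace K), ?_⟩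
  intro w hw
  rw [mem_closedBall_zero_iff, pi_norm_le_iff_of_nonneg (by positivity)]
  have hge : ∀ v : InfinitePlace K, -1 ≤ logExtend w v := fun v ↦ by
    refine le_trans ?_ (hw v).le
    rw [neg_le_neg_iff, one_mul]
    refine div_le_one_of_le₀ ?_ (by positivity)
    have := sum_mult_eq (K := K)
    have h2 : mult v ≤ ∑ w : InfinitePlace K, mult w :=
      Finset.single_le_sum (f := fun w : InfinitePlace K ↦ mult w) (fun _ _ ↦ Nat.zero_le _)
        (Finset.mem_univ v)
    exact_mod_cast this ▸ h2
  intro i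
  have hi : logExtend w i = w i := by simp [logExtend, i.2]
  rw [Real.norm_eq_abs, ← hi, abs_le]
  have hc : (1:ℝ) ≤ Fintype.card (InfinitePlace K) := by exact_mod_cast Fintype.card_pos
  refine ⟨by linarith [hge i], ?_⟩
  classical
  have h0 := sum_logExtend w
  rw [← Finset.add_sum_erase _ _ (Finset.mem_univ (i : InfinitePlace K))] at h0
  have : ∑ v ∈ Finset.univ.erase (i : InfinitePlace K), (-1:ℝ) ≤
      ∑ v ∈ Finset.univ.erase (i : InfinitePlace K), logExtend w v :=
    Finset.sum_le_sum fun v _ ↦ hge v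
  rw [Finset.sum_const, Finset.card_erase_of_mem (Finset.mem_univ _), nsmul_eq_mul] at this
  have hle : ((Finset.univ.card (α := InfinitePlace K) - 1 : ℕ) : ℝ) ≤ Fintype.card (InfinitePlace K) := by
    rw [Finset.card_univ]; exact_mod_cast Nat.sub_le _ _
  linarith

end RieszMeans

section RieszMeans

open NumberField.InfinitePlace NumberField.Units NumberField.Units.dirichletUnitTheorem
open Module MeasureTheory
open scoped nonZeroDivisors NNReal ENNReal Pointwise Classical

variable {K : Type*} [Field K] [NumberField K]

theorem prod_pow_mult_eq_absNorm (x : 𝓞 K) :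
    ∏ w : InfinitePlace K, w (x : K) ^ mult w = (Ideal.absNorm (Ideal.span {x}) : ℝ) := by
  rw [prod_eq_abs_norm, Ideal.absNorm_span_singleton, Nat.cast_natAbs, Int.cast_abs,
    ← Algebra.coe_norm_int]
  simp

/-- The normalised position of an element in the logarithmic space. -/
noncomputable def logPos (x : 𝓞 K) : logSpace K := fun i ↦
  mult (i : InfinitePlace K) * (Real.log ((i : InfinitePlace K) (x : K)) -
    Real.log (Ideal.absNorm (Ideal.span {x})) / finrank ℚ K)

theorem logExtend_logPos {x : 𝓞 K} (hx : x ≠ 0) (v : InfinitePlace K) :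
    logExtend (logPos x) v = mult v * (Real.log (v (x : K)) -
      Real.log (Ideal.absNorm (Ideal.span {x})) / finrank ℚ K) := by
  have h := logExtend_of_sum_eq_zero (fun v : InfinitePlace K ↦
    mult v * (Real.log (v (x : K)) - Real.log (Ideal.absNorm (Ideal.span {x})) / finrank ℚ K)) ?_
  · exact congrFun h v
  · have hN : (finrank ℚ K : ℝ) ≠ 0 := by exact_mod_cast (finrank_pos (R := ℚ) (M := K)).ne'
    simp_rw [mul_sub]
    rw [Finset.sum_sub_distrib, ← Finset.sum_mul, ← Nat.cast_sum, sum_mult_eq,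
      mul_div_cancel₀ _ hN, ← prod_pow_mult_eq_absNorm, Real.log_prod]
    · simp [Real.log_pow]
    · intro v _
      exact pow_ne_zero _ ((map_ne_zero v).mpr (RingOfIntegers.coe_ne_zero_iff.mpr hx))

theorem logPos_unit_mul (u : (𝓞 K)ˣ) {x : 𝓞 K} (hx : x ≠ 0) :
    logPos ((u : 𝓞 K) * x) = logEmbedding K (Additive.ofMul u) + logPos x := by
  ext i
  have h1 : Ideal.span {(u : 𝓞 K) * x} = Ideal.span {x} :=
    Ideal.span_singleton_mul_left_unit u.isUnit x
  rw [Pi.add_apply, logEmbedding_component]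
  unfold logPos
  rw [h1, show (((u : 𝓞 K) * x : 𝓞 K) : K) = ((u : 𝓞 K) : K) * (x : K) from
    map_mul (algebraMap (𝓞 K) K) _ _, map_mul, Real.log_mul]
  · ring
  · exact (map_ne_zero _).mpr (RingOfIntegers.coe_ne_zero_iff.mpr u.ne_zero)
  · exact (map_ne_zero _).mpr (RingOfIntegers.coe_ne_zero_iff.mpr hx)

/-- Radii of the box of logarithmic volume `T` in direction `w`. -/
noncomputable def boxRadius (T : ℝ) (w : logSpace K) (v : InfinitePlace K) : ℝ :=
  Real.exp (T / finrank ℚ K + logExtend w v / mult v)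

theorem prod_boxRadius (T : ℝ) (w : logSpace K) :
    ∏ v : InfinitePlace K, boxRadius T w v ^ mult v = Real.exp T := by
  have hN : (finrank ℚ K : ℝ) ≠ 0 := by exact_mod_cast (finrank_pos (R := ℚ) (M := K)).ne'
  unfold boxRadius
  simp_rw [← Real.exp_nat_mul]
  rw [← Real.exp_sum]
  congr 1
  have : ∀ v : InfinitePlace K, (mult v : ℝ) * (T / finrank ℚ K + logExtend w v / mult v) =
      mult v * (T / finrank ℚ K) + logExtend w v := fun v ↦ by
    have : (mult v : ℝ) ≠ 0 := by exact_mod_cast (mult_pos (w := v)).ne'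
    field_simp
  simp_rw [this]
  rw [Finset.sum_add_distrib, ← Finset.sum_mul, ← Nat.cast_sum, sum_mult_eq, sum_logExtend,
    mul_div_cancel₀ _ hN, add_zero]

theorem lt_boxRadius_iff (T : ℝ) (w : logSpace K) {x : 𝓞 K} (hx : x ≠ 0) :
    (∀ v : InfinitePlace K, v (x : K) < boxRadius T w v) ↔
      w - logPos x ∈ logSimplex K (T - Real.log (Ideal.absNorm (Ideal.span {x}))) := by
  unfold logSimplex boxRadius
  rw [Set.mem_ofPred_eq]
  refine forall_congr' fun v ↦ ?_
  have hpos : 0 < v (x : K) := InfinitePlace.pos_iff.mpr (RingOfIntegers.coe_ne_zero_iff.mpr hx)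
  have hm : (0 : ℝ) < mult v := by exact_mod_cast (mult_pos (w := v))
  rw [← Real.log_lt_iff_lt_exp hpos, logExtend_sub, logExtend_logPos hx,
    ← mul_lt_mul_iff_right₀ hm, mul_add, mul_div_cancel₀ _ hm.ne', ← sub_pos, ← sub_pos (b := -_)]
  refine iff_of_eq (congrArg _ ?_)
  ring

theorem tsum_fiber_volume {D : Set (logSpace K)}
    (hD : IsAddFundamentalDomain (unitLattice K) D volume) (T : ℝ) {x₀ : 𝓞 K} (hx : x₀ ≠ 0) :
    ∑' x : {x : 𝓞 K // Ideal.span {x} = Ideal.span {x₀}},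
      volume ({w : logSpace K | ∀ v : InfinitePlace K, v ((x : 𝓞 K) : K) < boxRadius T w v} ∩ D) =
    torsionOrder K * volume (logSimplex K 1) *
      ENNReal.ofReal (truncPow (rank K) (T - Real.log (Ideal.absNorm (Ideal.span {x₀})))) := by
  let e : Additive (𝓞 K)ˣ ≃ {x : 𝓞 K // Ideal.span {x} = Ideal.span {x₀}} :=
    Equiv.ofBijective (fun u ↦ ⟨(u.toMul : 𝓞 K) * x₀,
      Ideal.span_singleton_mul_left_unit u.toMul.isUnit x₀⟩) <| by
      constructor
      · intro u u' h
        have := mul_right_cancel₀ hx (congrArg Subtype.val h)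
        exact congrArg Additive.ofMul (Units.ext this)
      · rintro ⟨x, h⟩
        obtain ⟨u, rfl⟩ := (Ideal.span_singleton_eq_span_singleton.mp h.symm)
        exact ⟨Additive.ofMul u, Subtype.ext (mul_comm _ _)⟩
  rw [← e.tsum_eq, mul_assoc, mul_comm (volume _), ← volume_logSimplex]
  have key := tsum_volume_sub_logEmbedding_mem hD
    ((fun w ↦ w - logPos x₀) ⁻¹'
      logSimplex K (T - Real.log (Ideal.absNorm (Ideal.span {x₀}))))
  have hvol : volume ((fun w ↦ w - logPos x₀) ⁻¹'
      logSimplex K (T - Real.log (Ideal.absNorm (Ideal.span {x₀})))) =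
      volume (logSimplex K (T - Real.log (Ideal.absNorm (Ideal.span {x₀})))) := by
    simp_rw [sub_eq_add_neg]
    rw [measure_preimage_add_right]
  rw [← hvol, ← key]
  refine tsum_congr fun u ↦ ?_
  congr 2
  ext w
  have hne : (u.toMul : 𝓞 K) * x₀ ≠ 0 := mul_ne_zero u.toMul.ne_zero hx
  have h1 : Ideal.span {(u.toMul : 𝓞 K) * x₀} = Ideal.span {x₀} :=
    Ideal.span_singleton_mul_left_unit u.toMul.isUnit x₀
  change (∀ v : InfinitePlace K, v (((u.toMul : 𝓞 K) * x₀ : 𝓞 K) : K) < boxRadius T w v) ↔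
    w - logEmbedding K u - logPos x₀ ∈
      logSimplex K (T - Real.log (Ideal.absNorm (Ideal.span {x₀})))
  rw [lt_boxRadius_iff T w hne, h1, logPos_unit_mul _ hx, ← sub_sub]
  rfl

theorem lintegral_encard_box {D : Set (logSpace K)}
    (hD : IsAddFundamentalDomain (unitLattice K) D volume) (T : ℝ) (J : Ideal (𝓞 K)) :
    ∫⁻ w in D, ({x : 𝓞 K | (x ∈ J ∧ x ≠ 0) ∧
        ∀ v : InfinitePlace K, v (x : K) < boxRadius T w v}.encard : ℝ≥0∞) =
      torsionOrder K * volume (logSimplex K 1) *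
        ∑' I : {I : Ideal (𝓞 K) // (J ∣ I ∧ I ≠ ⊥) ∧ Submodule.IsPrincipal I},
          ENNReal.ofReal (truncPow (rank K) (T - Real.log (Ideal.absNorm (I : Ideal (𝓞 K))))) := by
  set X := {x : 𝓞 K // x ∈ J ∧ x ≠ 0}
  have hmeas : ∀ x : X, MeasurableSet
      {w : logSpace K | ∀ v : InfinitePlace K, v ((x : 𝓞 K) : K) < boxRadius T w v} := fun x ↦ by
    have : {w : logSpace K | ∀ v : InfinitePlace K, v ((x : 𝓞 K) : K) < boxRadius T w v} =
        ⋂ v : InfinitePlace K, {w | v ((x : 𝓞 K) : K) < boxRadius T w v} := by ext; simp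
    rw [this]
    refine MeasurableSet.iInter fun v ↦ (isOpen_lt continuous_const ?_).measurableSet
    unfold boxRadius
    have := continuous_logExtend v
    fun_prop
  have hcount : ∀ w : logSpace K, ({x : 𝓞 K | (x ∈ J ∧ x ≠ 0) ∧
        ∀ v : InfinitePlace K, v (x : K) < boxRadius T w v}.encard : ℝ≥0∞) =
      ∑' x : X, Set.indicator
        {w : logSpace K | ∀ v : InfinitePlace K, v ((x : 𝓞 K) : K) < boxRadius T w v} 1 w := by
    intro w
    let s : Set X := {x | ∀ v : InfinitePlace K, v ((x : 𝓞 K) : K) < boxRadius T w v}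
    have h1 : {x : 𝓞 K | (x ∈ J ∧ x ≠ 0) ∧ ∀ v : InfinitePlace K, v (x : K) < boxRadius T w v} =
        Subtype.val '' s := by
      ext x
      constructor
      · rintro ⟨h, h'⟩; exact ⟨⟨x, h⟩, h', rfl⟩
      · rintro ⟨⟨y, h⟩, h', rfl⟩; exact ⟨h, h'⟩
    rw [h1, Subtype.val_injective.encard_image, ← ENNReal.tsum_set_one]
    refine (tsum_subtype s (fun _ ↦ (1 : ℝ≥0∞))).trans (tsum_congr fun x ↦ ?_)
    simp [Set.indicator_apply, s]
  simp_rw [hcount]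
  have : Countable (𝓞 K) := Finsupp.Countable.of_moduleFinite (R := ℤ)
  have : Countable X := Subtype.countable
  rw [lintegral_tsum (fun x ↦ (measurable_one.indicator (hmeas x)).aemeasurable)]
  have h2 : ∀ x : X, ∫⁻ w in D, Set.indicator
      {w : logSpace K | ∀ v : InfinitePlace K, v ((x : 𝓞 K) : K) < boxRadius T w v} 1 w =
      volume ({w : logSpace K | ∀ v : InfinitePlace K,
        v ((x : 𝓞 K) : K) < boxRadius T w v} ∩ D) := fun x ↦ by
    rw [lintegral_indicator_one (hmeas x), Measure.restrict_apply (hmeas x)]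
  simp_rw [h2]
  let P := {I : Ideal (𝓞 K) // (J ∣ I ∧ I ≠ ⊥) ∧ Submodule.IsPrincipal I}
  let f : X → P := fun x ↦ ⟨Ideal.span {(x : 𝓞 K)}, ⟨Ideal.dvd_span_singleton.mpr x.2.1, by
    simpa using x.2.2⟩, ⟨⟨x, rfl⟩⟩⟩
  rw [← (Equiv.sigmaFiberEquiv f).tsum_eq, ENNReal.tsum_sigma', ← ENNReal.tsum_mul_left]
  refine tsum_congr fun I ↦ ?_
  obtain ⟨I, ⟨hJ, h0⟩, hI⟩ := I
  obtain ⟨x₀, rfl⟩ := hI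
  have hx₀ : x₀ ≠ 0 := by
    rintro rfl; exact h0 (by simp)
  rw [Ideal.submodule_span_eq] at hJ
  simp only [Ideal.submodule_span_eq]
  rw [← tsum_fiber_volume hD T hx₀]
  let e : {x : 𝓞 K // Ideal.span {x} = Ideal.span {x₀}} ≃
      {x : X // f x = ⟨Ideal.span {x₀}, ⟨hJ, h0⟩, ⟨⟨x₀, rfl⟩⟩⟩} :=
    { toFun := fun x ↦ ⟨⟨x, by
          rw [← Ideal.dvd_span_singleton, x.2]; exact hJ, fun h ↦ by
          have := x.2
          rw [h] at this
          exact hx₀ (by simpa using this.symm)⟩, Subtype.ext x.2⟩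
      invFun := fun x ↦ ⟨x.1, congrArg Subtype.val x.2⟩
      left_inv := fun x ↦ rfl
      right_inv := fun x ↦ rfl }
  rw [← e.tsum_eq]
  rfl

end RieszMeans

section RieszMeans

open NumberField.InfinitePlace NumberField.Units NumberField.Units.dirichletUnitTheorem
open Module MeasureTheory
open scoped nonZeroDivisors NNReal ENNReal Pointwise Classical

/-- The number of ideals of each norm, as an arithmetic function. -/
noncomputable def idealCount (K : Type*) [Field K] [NumberField K] : ArithmeticFunction ℝ :=
  ⟨fun m ↦ if m = 0 then 0 else ({I : Ideal (𝓞 K) | Ideal.absNorm I = m}.ncard : ℝ), by simp⟩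

/-- The summatory function of an arithmetic function weighted by a kernel. -/
noncomputable def kernelSum (a : ArithmeticFunction ℝ) (φ : ℝ → ℝ) (T : ℝ) : ℝ :=
  ∑ m ∈ Finset.Icc 1 ⌊Real.exp T⌋₊, a m * φ (T - Real.log m)

theorem truncPow_of_nonpos (r : ℕ) {t : ℝ} (ht : t ≤ 0) : truncPow r t = 0 := by
  simp [truncPow, not_lt.mpr ht]

variable {K : Type*} [Field K] [NumberField K]

theorem idealCount_apply {m : ℕ} (hm : m ≠ 0) :
    idealCount K m = ({I : Ideal (𝓞 K) | Ideal.absNorm I = m}.ncard : ℝ) := by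
  simp [idealCount, hm]

theorem absNorm_pos_of_nonZeroDivisors (I : (Ideal (𝓞 K))⁰) :
    0 < Ideal.absNorm (I : Ideal (𝓞 K)) :=
  Nat.pos_of_ne_zero <| by
    rw [Ne, Ideal.absNorm_eq_zero_iff]; exact nonZeroDivisors.coe_ne_zero I

theorem tsum_ideal_eq_kernelSum (φ : ℝ → ℝ) (hφ : ∀ t, 0 ≤ φ t) (hφ0 : ∀ t ≤ 0, φ t = 0) (T : ℝ) :
    ∑' I : (Ideal (𝓞 K))⁰, ENNReal.ofReal (φ (T - Real.log (Ideal.absNorm (I : Ideal (𝓞 K))))) =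
      ENNReal.ofReal (kernelSum (idealCount K) φ T) := by
  rw [← (Equiv.sigmaFiberEquiv
    (fun I : (Ideal (𝓞 K))⁰ ↦ Ideal.absNorm (I : Ideal (𝓞 K)))).tsum_eq, ENNReal.tsum_sigma',
    tsum_eq_sum (s := Finset.Icc 1 ⌊Real.exp T⌋₊)]
  · unfold kernelSum
    rw [ENNReal.ofReal_sum_of_nonneg]
    · refine Finset.sum_congr rfl fun m hm ↦ ?_
      have hm0 : m ≠ 0 := by
        have := (Finset.mem_Icc.mp hm).1; omega
      have h1 : ∀ c : {I : (Ideal (𝓞 K))⁰ // Ideal.absNorm (I : Ideal (𝓞 K)) = m},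
          Ideal.absNorm (((Equiv.sigmaFiberEquiv
            (fun I : (Ideal (𝓞 K))⁰ ↦ Ideal.absNorm (I : Ideal (𝓞 K)))) ⟨m, c⟩ :
              (Ideal (𝓞 K))⁰) : Ideal (𝓞 K)) = m := fun c ↦ c.2
      simp_rw [h1]
      let e : {I : (Ideal (𝓞 K))⁰ // Ideal.absNorm (I : Ideal (𝓞 K)) = m} ≃
          {I : Ideal (𝓞 K) | Ideal.absNorm I = m} :=
        { toFun := fun I ↦ ⟨I.1, I.2⟩
          invFun := fun I ↦ ⟨⟨I.1, mem_nonZeroDivisors_of_ne_zero fun h ↦ hm0 (by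
            rw [← I.2, h]; simp)⟩, I.2⟩
          left_inv := fun _ ↦ rfl
          right_inv := fun _ ↦ rfl }
      have hfin : Finite {I : Ideal (𝓞 K) | Ideal.absNorm I = m} :=
        (Ideal.finite_setOfPred_absNorm_eq m).to_subtype
      have : Finite {I : (Ideal (𝓞 K))⁰ // Ideal.absNorm (I : Ideal (𝓞 K)) = m} :=
        Finite.of_equiv _ e.symm
      rw [ENNReal.tsum_const, ENat.card_eq_coe_natCard, Nat.card_congr e, idealCount_apply hm0,
        ENNReal.ofReal_mul (by positivity), ENNReal.ofReal_natCast]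
      rfl
    · intro m hm
      refine mul_nonneg ?_ (hφ _)
      rw [idealCount_apply (by have := (Finset.mem_Icc.mp hm).1; omega)]
      positivity
  · intro m hm
    rw [ENNReal.tsum_eq_zero]
    rintro ⟨I, rfl⟩
    change ENNReal.ofReal (φ (T - Real.log (Ideal.absNorm (I : Ideal (𝓞 K))))) = 0
    have hI := absNorm_pos_of_nonZeroDivisors I
    rw [hφ0, ENNReal.ofReal_zero]
    rw [Finset.mem_Icc, not_and, not_le, Nat.floor_lt (Real.exp_pos T).le] at hm
    have := hm hI
    rw [sub_nonpos, Real.le_log_iff_exp_le (by exact_mod_cast hI)]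
    exact this.le

theorem tsum_nonZeroDivisors_eq_sum_classGroup (J : ClassGroup (𝓞 K) → (Ideal (𝓞 K))⁰)
    (hJ : ∀ c, ClassGroup.mk0 (J c) = c⁻¹) (g : ℝ → ℝ≥0∞) :
    ∑' I : (Ideal (𝓞 K))⁰, g (Real.log (Ideal.absNorm (I : Ideal (𝓞 K)))) =
      ∑ c : ClassGroup (𝓞 K),
        ∑' I : {I : Ideal (𝓞 K) //
            ((J c : Ideal (𝓞 K)) ∣ I ∧ I ≠ ⊥) ∧ Submodule.IsPrincipal I},
          g (Real.log (Ideal.absNorm (I : Ideal (𝓞 K))) -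
            Real.log (Ideal.absNorm (J c : Ideal (𝓞 K)))) := by
  rw [← (Equiv.sigmaFiberEquiv (fun I : (Ideal (𝓞 K))⁰ ↦ ClassGroup.mk0 I)).tsum_eq,
    ENNReal.tsum_sigma', tsum_fintype]
  refine Finset.sum_congr rfl fun c _ ↦ ?_
  have hJ0 : (J c : Ideal (𝓞 K)) ≠ 0 := nonZeroDivisors.coe_ne_zero _
  let e : {I : (Ideal (𝓞 K))⁰ // ClassGroup.mk0 I = c} ≃ {I : Ideal (𝓞 K) //
      ((J c : Ideal (𝓞 K)) ∣ I ∧ I ≠ ⊥) ∧ Submodule.IsPrincipal I} :=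
    Equiv.ofBijective (fun I ↦ ⟨(J c : Ideal (𝓞 K)) * (I : (Ideal (𝓞 K))⁰),
      ⟨dvd_mul_right _ _, mul_ne_zero hJ0 (nonZeroDivisors.coe_ne_zero _)⟩, by
        have := (ClassGroup.mk0_eq_one_iff (J c * I.1).2).mp (by
          change ClassGroup.mk0 (J c * I.1) = 1
          rw [map_mul, hJ, I.2, inv_mul_cancel])
        exact this⟩) <| by
      constructor
      · rintro ⟨I, hI⟩ ⟨I', hI'⟩ h
        have := mul_left_cancel₀ hJ0 (congrArg Subtype.val h)
        exact Subtype.ext (Subtype.ext this)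
      · rintro ⟨_, ⟨⟨I, rfl⟩, h0⟩, hp⟩
        have hI0 : I ≠ 0 := right_ne_zero_of_mul h0
        let I' : (Ideal (𝓞 K))⁰ := ⟨I, mem_nonZeroDivisors_of_ne_zero hI0⟩
        refine ⟨⟨I', ?_⟩, rfl⟩
        have : ClassGroup.mk0 (J c * I') = 1 := (ClassGroup.mk0_eq_one_iff (J c * I').2).mpr hp
        rw [map_mul, hJ, inv_mul_eq_one] at this
        exact this.symm
  rw [← e.tsum_eq]
  refine tsum_congr fun I ↦ ?_
  change g (Real.log (Ideal.absNorm ((I : (Ideal (𝓞 K))⁰) : Ideal (𝓞 K)))) =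
    g (Real.log (Ideal.absNorm ((J c : Ideal (𝓞 K)) * ((I : (Ideal (𝓞 K))⁰) : Ideal (𝓞 K)))) - _)
  have h1 := absNorm_pos_of_nonZeroDivisors (I : (Ideal (𝓞 K))⁰)
  have h2 := absNorm_pos_of_nonZeroDivisors (J c)
  rw [map_mul, Nat.cast_mul, Real.log_mul (by positivity) (by positivity), add_sub_cancel_left]

theorem exists_abs_kernelSum_idealCount_sub_le (n : ℕ) (hn : n ≠ 0) :
    ∃ C A : ℝ, 0 < C ∧ 0 < A ∧ ∀ (K : Type) [Field K] [NumberField K], finrank ℚ K ≤ n →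
      ∃ M : ℝ, 0 < M ∧ ∀ T : ℝ, |kernelSum (idealCount K) (truncPow (rank K)) T - M * Real.exp T| ≤
        M * (C * absDisc K ^ A) * Real.exp ((1 - 1 / (n : ℝ)) * T) := by
  obtain ⟨C, A, hC, hA, H⟩ := exists_abs_ncard_box_sub_le n hn
  refine ⟨C + 1, A + 1 / 2, by positivity, by positivity, fun K _ _ hK ↦ ?_⟩
  have hJ : ∀ c : ClassGroup (𝓞 K), ∃ J : (Ideal (𝓞 K))⁰, ClassGroup.mk0 J = c⁻¹ := fun c ↦
    ClassGroup.mk0_surjective _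
  choose J hJ using hJ
  set b := boxConst K with hb
  have hb0 : 0 < b := boxConst_pos K
  let B := (Module.Free.chooseBasis ℤ (unitLattice K))
  set F : Set (logSpace K) := ZSpan.fundamentalDomain (B.ofZLatticeBasis ℝ (unitLattice K)) with hF
  have hD : IsAddFundamentalDomain (unitLattice K) F volume :=
    ZLattice.isAddFundamentalDomain B volume
  have hF0 : volume F ≠ 0 := ZSpan.measure_fundamentalDomain_ne_zero _
  have hFt : volume F ≠ ⊤ := (ZSpan.fundamentalDomain_isBounded _).measure_lt_top.ne
  set V := (volume F).toReal with hV
  have hV0 : 0 < V := ENNReal.toReal_pos hF0 hFt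
  have hVe : volume F = ENNReal.ofReal V := (ENNReal.ofReal_toReal hFt).symm
  set S := (volume (logSimplex K 1)).toReal with hS
  have hS0 : 0 < S := ENNReal.toReal_pos volume_logSimplex_one_pos.ne'
    volume_logSimplex_one_lt_top.ne
  have hSe : volume (logSimplex K 1) = ENNReal.ofReal S :=
    (ENNReal.ofReal_toReal volume_logSimplex_one_lt_top.ne).symm
  set τ : ℝ := ((torsionOrder K : ℕ) : ℝ) with hτ
  have hτ0 : 0 < τ := by
    rw [hτ]; exact_mod_cast Nat.pos_of_ne_zero (torsionOrder_ne_zero K)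
  set h : ℝ := ((Fintype.card (ClassGroup (𝓞 K)) : ℕ) : ℝ) with hh
  have hh0 : 0 < h := by rw [hh]; exact_mod_cast Fintype.card_pos
  have hD1 : 1 ≤ absDisc K := one_le_absDisc K
  refine ⟨h * V * b / (τ * S), by positivity, fun T ↦ ?_⟩
  rcases lt_or_ge T 0 with hT | hT
  · have h0 : kernelSum (idealCount K) (truncPow (rank K)) T = 0 := by
      unfold kernelSum
      rw [Nat.floor_eq_zero.mpr (by simpa using hT)]; simp
    rw [h0, zero_sub, abs_neg, abs_of_nonneg (by positivity), mul_assoc (h * V * b / (τ * S))]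
    refine mul_le_mul_of_nonneg_left ?_ (by positivity)
    have h1 : 1 ≤ (C + 1) * absDisc K ^ (A + 1 / 2) := by
      have := Real.one_le_rpow hD1 (by positivity : (0 : ℝ) ≤ A + 1 / 2)
      nlinarith
    have h2 : Real.exp T ≤ Real.exp ((1 - 1 / (n : ℝ)) * T) := by
      rw [Real.exp_le_exp, sub_mul, one_mul, le_sub_self_iff]
      exact mul_nonpos_of_nonneg_of_nonpos (by positivity) hT.le
    calc _ ≤ 1 * Real.exp ((1 - 1 / (n : ℝ)) * T) := by rw [one_mul]; exact h2
      _ ≤ _ := mul_le_mul_of_nonneg_right h1 (Real.exp_pos _).le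
  set a : ℝ := 1 - 1 / (n : ℝ) with ha
  have ha0 : 0 ≤ a := by
    rw [ha, sub_nonneg, div_le_one (by positivity)]
    exact_mod_cast Nat.one_le_iff_ne_zero.mpr hn
  set E := (C + 1) * absDisc K ^ A * Real.exp (a * T) with hE
  have hE0 : 0 < E := by positivity
  have hcount : ∀ (c : ClassGroup (𝓞 K)) (w : logSpace K),
      ∃ k : ℕ, {x : 𝓞 K | (x ∈ (J c : Ideal (𝓞 K)) ∧ x ≠ 0) ∧ ∀ v : InfinitePlace K,
        v (x : K) < boxRadius (T + Real.log (Ideal.absNorm (J c : Ideal (𝓞 K)))) w v}.encard = k ∧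
        |(k : ℝ) - b * Real.exp T| ≤ E := by
    intro c w
    have hJp := absNorm_pos_of_nonZeroDivisors (J c)
    obtain ⟨hfin, hle⟩ := H K hK (J c) (nonZeroDivisors.coe_ne_zero _)
      (boxRadius (T + Real.log (Ideal.absNorm (J c : Ideal (𝓞 K)))) w)
      (fun v ↦ Real.exp_pos _) (Real.exp T) (by simpa using hT) (by
        rw [prod_boxRadius, Real.exp_add, Real.exp_log (by exact_mod_cast hJp)])
    set s := {x : 𝓞 K | x ∈ (J c : Ideal (𝓞 K)) ∧ ∀ v : InfinitePlace K,
        v (x : K) < boxRadius (T + Real.log (Ideal.absNorm (J c : Ideal (𝓞 K)))) w v} with hs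
    have hs' : {x : 𝓞 K | (x ∈ (J c : Ideal (𝓞 K)) ∧ x ≠ 0) ∧ ∀ v : InfinitePlace K,
        v (x : K) < boxRadius (T + Real.log (Ideal.absNorm (J c : Ideal (𝓞 K)))) w v} =
        s \ {0} := by
      ext x
      simp only [hs, Set.mem_ofPred_eq, Set.mem_sdiff, Set.mem_singleton_iff]
      tauto
    have h0s : (0 : 𝓞 K) ∈ s := ⟨zero_mem _, fun v ↦ by
      simpa [boxRadius] using Real.exp_pos _⟩
    have hn1 := Set.ncard_sdiff_singleton_add_one h0s hfin
    refine ⟨(s \ {0}).ncard, ?_, ?_⟩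
    · rw [hs', (hfin.subset Set.sdiff_subset).cast_ncard_eq]
    · have hn2 : ((s \ {0}).ncard : ℝ) = s.ncard - 1 := by
        rw [← hn1]; push_cast; ring
      have h3 : Real.exp T ^ a = Real.exp (a * T) := by
        rw [← Real.exp_mul, mul_comm]
      rw [h3] at hle
      have h4 : 1 ≤ absDisc K ^ A * Real.exp (a * T) :=
        one_le_mul_of_one_le_of_one_le (Real.one_le_rpow hD1 hA.le)
          (Real.one_le_exp (by positivity))
      rw [hn2, abs_le] at *
      rw [hE]
      constructor <;> nlinarith [hle.1, hle.2]
  have htot : ENNReal.ofReal (τ * S * kernelSum (idealCount K) (truncPow (rank K)) T) =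
      ∑ c : ClassGroup (𝓞 K), ∫⁻ w in F, ({x : 𝓞 K | (x ∈ (J c : Ideal (𝓞 K)) ∧ x ≠ 0) ∧
        ∀ v : InfinitePlace K, v (x : K) <
        boxRadius (T + Real.log (Ideal.absNorm (J c : Ideal (𝓞 K)))) w v}.encard : ℝ≥0∞) := by
    simp_rw [lintegral_encard_box hD]
    rw [← Finset.mul_sum, ENNReal.ofReal_mul (by positivity), ← tsum_ideal_eq_kernelSum _
      (truncPow_nonneg _) (fun t ht ↦ truncPow_of_nonpos _ ht),
      tsum_nonZeroDivisors_eq_sum_classGroup J hJ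
        (fun t ↦ ENNReal.ofReal (truncPow (rank K) (T - t))),
      ENNReal.ofReal_mul hτ0.le, hSe, hτ, ENNReal.ofReal_natCast]
    congr 1
    refine Finset.sum_congr rfl fun c _ ↦ tsum_congr fun I ↦ ?_
    congr 2
    ring
  have hk0 : 0 ≤ kernelSum (idealCount K) (truncPow (rank K)) T := by
    refine Finset.sum_nonneg fun m hm ↦ mul_nonneg ?_ (truncPow_nonneg _ _)
    rw [idealCount_apply (by have := (Finset.mem_Icc.mp hm).1; omega)]
    positivity
  have hup : τ * S * kernelSum (idealCount K) (truncPow (rank K)) T ≤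
      h * ((b * Real.exp T + E) * V) := by
    rw [← ENNReal.ofReal_le_ofReal_iff (by positivity), htot]
    calc _ ≤ ∑ c : ClassGroup (𝓞 K), ENNReal.ofReal ((b * Real.exp T + E) * V) := by
          refine Finset.sum_le_sum fun c _ ↦ ?_
          rw [ENNReal.ofReal_mul (by positivity), ← hVe, ← setLIntegral_const]
          refine lintegral_mono fun w ↦ ?_
          obtain ⟨k, hk, hkE⟩ := hcount c w
          rw [hk, ENat.toENNReal_coe, ← ENNReal.ofReal_natCast]
          refine ENNReal.ofReal_le_ofReal ?_
          linarith [(abs_le.mp hkE).2]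
      _ = _ := by
          rw [Finset.sum_const, nsmul_eq_mul, ENNReal.ofReal_mul hh0.le, hh, ENNReal.ofReal_natCast]
          rfl
  have hlow : h * ((b * Real.exp T - E) * V) ≤
      τ * S * kernelSum (idealCount K) (truncPow (rank K)) T := by
    rw [← ENNReal.ofReal_le_ofReal_iff (by positivity), htot]
    calc _ = ∑ c : ClassGroup (𝓞 K), ENNReal.ofReal ((b * Real.exp T - E) * V) := by
          rw [Finset.sum_const, nsmul_eq_mul, ENNReal.ofReal_mul hh0.le, hh, ENNReal.ofReal_natCast]
          rfl
      _ ≤ _ := by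
          refine Finset.sum_le_sum fun c _ ↦ ?_
          rw [ENNReal.ofReal_mul' hV0.le, ← hVe, ← setLIntegral_const]
          refine lintegral_mono fun w ↦ ?_
          obtain ⟨k, hk, hkE⟩ := hcount c w
          rw [hk, ENat.toENNReal_coe, ← ENNReal.ofReal_natCast]
          refine ENNReal.ofReal_le_ofReal ?_
          linarith [(abs_le.mp hkE).1]
  set Φ := kernelSum (idealCount K) (truncPow (rank K)) T with hΦ
  have hbD : 1 ≤ b * absDisc K ^ (1 / 2 : ℝ) := by
    have h5 := inv_le_boxConst (K := K)
    rw [← Real.sqrt_eq_rpow]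
    have h6 : 0 < √(absDisc K) := Real.sqrt_pos.mpr (absDisc_pos K)
    calc (1 : ℝ) = (√(absDisc K))⁻¹ * √(absDisc K) := (inv_mul_cancel₀ h6.ne').symm
      _ ≤ _ := mul_le_mul_of_nonneg_right h5 h6.le
  have hfinal : |Φ - h * V * b / (τ * S) * Real.exp T| ≤ h * V / (τ * S) * E := by
    have h7 : Φ - h * V * b / (τ * S) * Real.exp T =
        (τ * S * Φ - h * V * b * Real.exp T) / (τ * S) := by field_simp
    rw [h7, abs_div, abs_of_pos (by positivity : 0 < τ * S), div_mul_eq_mul_div]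
    refine div_le_div_of_nonneg_right ?_ (by positivity)
    rw [abs_le]
    constructor <;> linarith
  refine hfinal.trans ?_
  have h8 : h * V * b / (τ * S) * ((C + 1) * absDisc K ^ (A + 1 / 2)) * Real.exp (a * T) =
      h * V / (τ * S) * E * (b * absDisc K ^ (1 / 2 : ℝ)) := by
    rw [hE, Real.rpow_add (absDisc_pos K)]; ring
  rw [h8]
  exact le_mul_of_one_le_right (by positivity) hbD

end RieszMeans

section EulerProduct

open scoped ArithmeticFunction Classical

/-- The arithmetic function supported at `q` with value `1`. -/
noncomputable def arithSingle (q : ℕ) : ArithmeticFunction ℝ :=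
  ⟨fun m ↦ if m = q ∧ q ≠ 0 then 1 else 0, by
    rw [if_neg]; rintro ⟨rfl, h⟩; exact h rfl⟩

theorem arithSingle_mul_apply {q : ℕ} (hq : q ≠ 0) (a : ArithmeticFunction ℝ) (m : ℕ) :
    (arithSingle q * a) m = if q ∣ m then a (m / q) else 0 := by
  rw [ArithmeticFunction.mul_apply]
  rcases eq_or_ne m 0 with rfl | hm
  · simp
  split_ifs with h
  · rw [Finset.sum_eq_single (q, m / q)]
    · simp [arithSingle, hq]
    · rintro ⟨x, y⟩ hx hne
      have h1 := (Nat.mem_divisorsAntidiagonal.mp hx).1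
      simp only [arithSingle, ArithmeticFunction.coe_mk]
      rw [if_neg, zero_mul]
      rintro ⟨rfl, -⟩
      apply hne
      rw [← h1]
      simp [Nat.mul_div_cancel_left _ (Nat.pos_of_ne_zero hq)]
    · intro h'
      exact absurd (Nat.mem_divisorsAntidiagonal.mpr ⟨Nat.mul_div_cancel' h, hm⟩) h'
  · refine Finset.sum_eq_zero ?_
    rintro ⟨x, y⟩ hx
    have h1 := (Nat.mem_divisorsAntidiagonal.mp hx).1
    simp only [arithSingle, ArithmeticFunction.coe_mk]
    rw [if_neg, zero_mul]
    rintro ⟨rfl, -⟩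
    exact h (Dvd.intro _ h1)

/-- The ideal of arithmetic functions vanishing up to `y`. -/
def vanishingIdeal (y : ℕ) : Ideal (ArithmeticFunction ℝ) where
  carrier := {f | ∀ m ≤ y, f m = 0}
  add_mem' := fun {f g} hf hg m hm ↦ by simp [hf m hm, hg m hm]
  zero_mem' := fun m _ ↦ by simp
  smul_mem' := fun f g hg m hm ↦ by
    rw [smul_eq_mul, ArithmeticFunction.mul_apply]
    refine Finset.sum_eq_zero fun x hx ↦ ?_
    have h := Nat.mem_divisorsAntidiagonal.mp hx
    rw [hg x.2, mul_zero]
    refine le_trans (Nat.le_of_dvd (Nat.pos_of_ne_zero h.2) (Dvd.intro_left _ h.1)) hm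

theorem mem_vanishingIdeal {y : ℕ} {f : ArithmeticFunction ℝ} :
    f ∈ vanishingIdeal y ↔ ∀ m ≤ y, f m = 0 := Iff.rfl

variable (K : Type*) [Field K] [NumberField K]

/-- The number of ideals of each norm which are divisible by no ideal in a given finite set. -/
noncomputable def idealCountAvoiding (P : Finset (Ideal (𝓞 K))) : ArithmeticFunction ℝ :=
  ⟨fun m ↦ if m = 0 then 0 else
    ({I : Ideal (𝓞 K) | Ideal.absNorm I = m ∧ ∀ p ∈ P, ¬ p ∣ I}.ncard : ℝ), by simp⟩

variable {K}

theorem idealCountAvoiding_empty : idealCountAvoiding K ∅ = idealCount K := by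
  ext m
  simp [idealCountAvoiding, idealCount]

theorem idealCountAvoiding_insert {P : Finset (Ideal (𝓞 K))} {p : Ideal (𝓞 K)} (hp : p ∉ P)
    (hP : ∀ q ∈ insert p P, q.IsPrime ∧ q ≠ ⊥) :
    idealCountAvoiding K (insert p P) =
      idealCountAvoiding K P * (1 - arithSingle (Ideal.absNorm p)) := by
  obtain ⟨hpp, hp0⟩ := hP p (Finset.mem_insert_self _ _)
  have hN : Ideal.absNorm p ≠ 0 := by rwa [Ne, Ideal.absNorm_eq_zero_iff]
  ext m
  rw [mul_sub, mul_one, mul_comm, sub_eq_add_neg, ArithmeticFunction.add_apply,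
    ArithmeticFunction.neg_apply, arithSingle_mul_apply hN]
  rcases eq_or_ne m 0 with rfl | hm
  · simp
  have hfin : {I : Ideal (𝓞 K) | Ideal.absNorm I = m ∧ ∀ p ∈ P, ¬ p ∣ I}.Finite :=
    (Ideal.finite_setOfPred_absNorm_eq m).subset fun I h ↦ h.1
  have hsplit : {I : Ideal (𝓞 K) | Ideal.absNorm I = m ∧ ∀ q ∈ insert p P, ¬ q ∣ I} =
      {I : Ideal (𝓞 K) | Ideal.absNorm I = m ∧ ∀ q ∈ P, ¬ q ∣ I} \
        {I | (Ideal.absNorm I = m ∧ ∀ q ∈ P, ¬ q ∣ I) ∧ p ∣ I} := by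
    ext I
    simp only [Set.mem_ofPred_eq, Set.mem_sdiff, Finset.forall_mem_insert]
    tauto
  have hval : ∀ Q : Finset (Ideal (𝓞 K)), ∀ k : ℕ, k ≠ 0 → idealCountAvoiding K Q k =
      ({I : Ideal (𝓞 K) | Ideal.absNorm I = k ∧ ∀ q ∈ Q, ¬ q ∣ I}.ncard : ℝ) := fun Q k hk ↦ by
    simp [idealCountAvoiding, hk]
  rw [hval _ m hm, hval _ m hm, hsplit, Set.ncard_sdiff (fun I h ↦ h.1)
    (hfin.subset fun I h ↦ h.1), Nat.cast_sub (Set.ncard_le_ncard (fun I h ↦ h.1) hfin),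
    ← sub_eq_add_neg]
  congr 1
  split_ifs with h
  · have hk : m / Ideal.absNorm p ≠ 0 := by
      rw [Nat.div_ne_zero_iff]
      exact ⟨hN, Nat.le_of_dvd (Nat.pos_of_ne_zero hm) h⟩
    rw [hval _ _ hk]
    have himg : {I : Ideal (𝓞 K) | (Ideal.absNorm I = m ∧ ∀ q ∈ P, ¬ q ∣ I) ∧ p ∣ I} =
        (fun J ↦ p * J) '' {I : Ideal (𝓞 K) | Ideal.absNorm I = m / Ideal.absNorm p ∧
          ∀ q ∈ P, ¬ q ∣ I} := by
      ext I
      constructor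
      · rintro ⟨⟨h1, h2⟩, J, rfl⟩
        refine ⟨J, ⟨?_, fun q hq hd ↦ h2 q hq (hd.mul_left p)⟩, rfl⟩
        rw [← h1, map_mul, Nat.mul_div_cancel_left _ (Nat.pos_of_ne_zero hN)]
      · rintro ⟨J, ⟨h1, h2⟩, rfl⟩
        refine ⟨⟨?_, fun q hq hd ↦ ?_⟩, dvd_mul_right _ _⟩
        · rw [map_mul, h1, Nat.mul_div_cancel' h]
        · obtain ⟨hqp, hq0⟩ := hP q (Finset.mem_insert_of_mem hq)
          have hprime := Ideal.prime_of_isPrime hq0 hqp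
          rcases hprime.dvd_or_dvd hd with h3 | h3
          · have h4 := (hprime.dvd_prime_iff_associated (Ideal.prime_of_isPrime hp0 hpp)).mp h3
            rw [associated_iff_eq] at h4
            exact hp (h4 ▸ hq)
          · exact h2 q hq h3
    rw [himg, Set.ncard_image_of_injective _ (mul_right_injective₀ hp0)]
  · rw [Nat.cast_eq_zero, Set.ncard_eq_zero (hfin.subset fun I h ↦ h.1)]
    ext I
    simp only [Set.mem_ofPred_eq, Set.mem_empty_iff_false, iff_false]
    rintro ⟨⟨rfl, -⟩, h1⟩
    exact h (map_dvd Ideal.absNorm h1)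

theorem idealCount_mul_prod {P : Finset (Ideal (𝓞 K))} (hP : ∀ q ∈ P, q.IsPrime ∧ q ≠ ⊥) :
    idealCount K * ∏ p ∈ P, (1 - arithSingle (Ideal.absNorm p)) = idealCountAvoiding K P := by
  induction P using Finset.induction_on with
  | empty => simp [idealCountAvoiding_empty]
  | insert p P hp ih =>
    rw [Finset.prod_insert hp, mul_comm (1 - _), ← mul_assoc,
      ih fun q hq ↦ hP q (Finset.mem_insert_of_mem hq), idealCountAvoiding_insert hp hP]

theorem finite_primes_absNorm_le (y : ℕ) :
    {p : Ideal (𝓞 K) | p.IsPrime ∧ p ≠ ⊥ ∧ Ideal.absNorm p ≤ y}.Finite := by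
  refine (Ideal.finite_setOfPred_absNorm_le y).subset fun I h ↦ h.2.2

variable (K) in
/-- The nonzero prime ideals of norm at most `y`. -/
noncomputable def primesLE (y : ℕ) : Finset (Ideal (𝓞 K)) :=
  (finite_primes_absNorm_le (K := K) y).toFinset

theorem mem_primesLE {y : ℕ} {p : Ideal (𝓞 K)} :
    p ∈ primesLE K y ↔ p.IsPrime ∧ p ≠ ⊥ ∧ Ideal.absNorm p ≤ y := by
  simp [primesLE]

theorem idealCount_mul_prod_primesLE_sub_one_mem (y : ℕ) :
    idealCount K * ∏ p ∈ primesLE K y, (1 - arithSingle (Ideal.absNorm p)) - 1 ∈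
      vanishingIdeal y := by
  rw [idealCount_mul_prod fun q hq ↦ ⟨(mem_primesLE.mp hq).1, (mem_primesLE.mp hq).2.1⟩]
  intro m hm
  rw [sub_eq_add_neg, ArithmeticFunction.add_apply, ArithmeticFunction.neg_apply,
    ← sub_eq_add_neg, sub_eq_zero]
  rcases eq_or_ne m 0 with rfl | hm0
  · simp
  rw [ArithmeticFunction.one_apply]
  have hval : idealCountAvoiding K (primesLE K y) m =
      ({I : Ideal (𝓞 K) | Ideal.absNorm I = m ∧ ∀ q ∈ primesLE K y, ¬ q ∣ I}.ncard : ℝ) := by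
    simp [idealCountAvoiding, hm0]
  rw [hval]
  split_ifs with h
  · subst h
    have : {I : Ideal (𝓞 K) | Ideal.absNorm I = 1 ∧ ∀ q ∈ primesLE K y, ¬ q ∣ I} = {⊤} := by
      ext I
      simp only [Set.mem_ofPred_eq, Ideal.absNorm_eq_one_iff, Set.mem_singleton_iff,
        and_iff_left_iff_imp]
      rintro rfl q hq hd
      exact (mem_primesLE.mp hq).1.ne_top (top_le_iff.mp (Ideal.le_of_dvd hd))
    rw [this, Set.ncard_singleton, Nat.cast_one]
  · rw [Nat.cast_eq_zero]
    convert! Set.ncard_empty (Ideal (𝓞 K))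
    ext I
    simp only [Set.mem_ofPred_eq, Set.mem_empty_iff_false, iff_false]
    rintro ⟨rfl, hI⟩
    have hIt : I ≠ ⊤ := fun h' ↦ h (by rw [h']; exact Ideal.absNorm_top)
    obtain ⟨q, hq, hIq⟩ := Ideal.exists_le_maximal I hIt
    have hd : q ∣ I := Ideal.dvd_iff_le.mpr hIq
    have hI0 : I ≠ ⊥ := by rwa [Ne, Ideal.absNorm_eq_zero_iff] at hm0
    have hq0 : q ≠ ⊥ := fun h' ↦ hI0 (by rw [h'] at hIq; exact le_bot_iff.mp hIq)
    exact hI q (mem_primesLE.mpr ⟨hq.isPrime, hq0,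
      (Nat.le_of_dvd (Nat.pos_of_ne_zero hm0) (map_dvd Ideal.absNorm hd)).trans hm⟩) hd

theorem sub_pow_mem_of_mul_sub_one_mem {R : Type*} [CommRing R] (I : Ideal R) {a b g : R} (d : ℕ)
    (ha : a * g ^ d - 1 ∈ I) (hb : b * g - 1 ∈ I) : a - b ^ d ∈ I := by
  have h : b ^ d * g ^ d - 1 ∈ I := by
    rw [← mul_pow]
    exact I.mem_of_dvd (sub_one_dvd_pow_sub_one (b * g) d) hb
  have := I.sub_mem (I.mul_mem_left (b ^ d) ha) (I.mul_mem_left a h)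
  convert! this using 1
  ring

/-- If the prime ideals of norm at most `y` of two number fields outside exceptional sets are in a
`d`-to-one norm preserving correspondence, then so are the numbers of ideals of given norm. -/
theorem idealCount_sub_pow_mem {E : Type*} [Field E] [NumberField E] (y d : ℕ)
    (PE : Finset (Ideal (𝓞 E))) (PK : Finset (Ideal (𝓞 K)))
    (hPE : PE ⊆ primesLE E y) (hPK : PK ⊆ primesLE K y) (f : Ideal (𝓞 K) → Ideal (𝓞 E))
    (hf : ∀ p ∈ primesLE K y \ PK, f p ∈ primesLE E y \ PE)
    (hfN : ∀ p ∈ primesLE K y \ PK, Ideal.absNorm (f p) = Ideal.absNorm p)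
    (hcard : ∀ q ∈ primesLE E y \ PE, {p ∈ primesLE K y \ PK | f p = q}.card = d) :
    idealCount K * ∏ p ∈ PK, (1 - arithSingle (Ideal.absNorm p)) -
      (idealCount E * ∏ p ∈ PE, (1 - arithSingle (Ideal.absNorm p))) ^ d ∈ vanishingIdeal y := by
  have h1 := idealCount_mul_prod_primesLE_sub_one_mem (K := K) y
  have h2 := idealCount_mul_prod_primesLE_sub_one_mem (K := E) y
  have h3 : ∏ p ∈ primesLE K y \ PK, (1 - arithSingle (Ideal.absNorm p)) =
      (∏ p ∈ primesLE E y \ PE, (1 - arithSingle (Ideal.absNorm p))) ^ d := by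
    rw [← Finset.prod_fiberwise_of_maps_to hf, ← Finset.prod_pow]
    refine Finset.prod_congr rfl fun q hq ↦ ?_
    rw [← hcard q hq, ← Finset.prod_const]
    refine Finset.prod_congr rfl fun p hp ↦ ?_
    rw [Finset.mem_filter] at hp
    rw [← hfN p hp.1, hp.2]
  rw [← Finset.prod_sdiff hPK, h3] at h1
  rw [← Finset.prod_sdiff hPE] at h2
  refine sub_pow_mem_of_mul_sub_one_mem _ d (g := ∏ p ∈ primesLE E y \ PE,
    (1 - arithSingle (Ideal.absNorm p))) ?_ ?_
  · rwa [mul_assoc, mul_comm (∏ p ∈ PK, _)]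
  · rwa [mul_assoc, mul_comm (∏ p ∈ PE, _)]

end EulerProduct

section CausalConvolution

open MeasureTheory

/-- Measurable, locally bounded functions vanishing on the nonpositive half-line. -/
structure IsCausal (f : ℝ → ℝ) : Prop where
  measurable : Measurable f
  eq_zero : ∀ t ≤ 0, f t = 0
  bdd : ∀ T, ∃ B, 0 ≤ B ∧ ∀ t ≤ T, |f t| ≤ B

/-- Convolution of functions on the line. -/
noncomputable def lineConv (f g : ℝ → ℝ) (T : ℝ) : ℝ := ∫ u, f u * g (T - u)

/-- The backward difference of a function. -/
def backDiff (f : ℝ → ℝ) (T : ℝ) : ℝ := f T - f (T - 1)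

variable {f g k F G : ℝ → ℝ}

theorem IsCausal.comp_sub (hf : IsCausal f) {c : ℝ} (hc : 0 ≤ c) :
    IsCausal fun t ↦ f (t - c) where
  measurable := hf.measurable.comp (by fun_prop)
  eq_zero t ht := hf.eq_zero _ (by linarith)
  bdd T := by
    obtain ⟨B, hB, h⟩ := hf.bdd T
    exact ⟨B, hB, fun t ht ↦ h _ (by linarith)⟩

theorem IsCausal.add (hf : IsCausal f) (hg : IsCausal g) : IsCausal fun t ↦ f t + g t where
  measurable := hf.measurable.add hg.measurable
  eq_zero t ht := by rw [hf.eq_zero t ht, hg.eq_zero t ht, add_zero]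
  bdd T := by
    obtain ⟨B, hB, h⟩ := hf.bdd T
    obtain ⟨B', hB', h'⟩ := hg.bdd T
    exact ⟨B + B', by positivity, fun t ht ↦ (abs_add_le _ _).trans (add_le_add (h t ht) (h' t ht))⟩

theorem IsCausal.const_mul (hf : IsCausal f) (c : ℝ) : IsCausal fun t ↦ c * f t where
  measurable := hf.measurable.const_mul c
  eq_zero t ht := by rw [hf.eq_zero t ht, mul_zero]
  bdd T := by
    obtain ⟨B, hB, h⟩ := hf.bdd T
    exact ⟨|c| * B, by positivity, fun t ht ↦ by
      rw [abs_mul]; exact mul_le_mul_of_nonneg_left (h t ht) (abs_nonneg c)⟩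

theorem IsCausal.backDiff (hf : IsCausal f) : IsCausal (backDiff f) := by
  convert! hf.add ((hf.comp_sub zero_le_one).const_mul (-1)) using 2
  unfold _root_.backDiff; ring

theorem IsCausal.mul_eq_zero (hf : IsCausal f) (hg : IsCausal g) {T u : ℝ}
    (hu : u ∉ Set.Ioo 0 T) : f u * g (T - u) = 0 := by
  rw [Set.mem_Ioo, not_and_or, not_lt, not_lt] at hu
  rcases hu with h | h
  · rw [hf.eq_zero u h, zero_mul]
  · rw [hg.eq_zero _ (by linarith), mul_zero]

theorem IsCausal.integrable_mul (hf : IsCausal f) (hg : IsCausal g) (T : ℝ) :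
    Integrable fun u ↦ f u * g (T - u) := by
  obtain ⟨B, hB, h⟩ := hf.bdd T
  obtain ⟨B', hB', h'⟩ := hg.bdd T
  have hs : Function.support (fun u ↦ f u * g (T - u)) ⊆ Set.Ioo 0 T := fun u hu ↦ by
    by_contra h0
    exact hu (hf.mul_eq_zero hg h0)
  rw [← integrableOn_iff_integrable_of_support_subset hs]
  refine Measure.integrableOn_of_bounded (M := B * B') measure_Ioo_lt_top.ne
    ((hf.measurable.mul (hg.measurable.comp (by fun_prop))).aestronglyMeasurable) ?_
  filter_upwards [ae_restrict_mem measurableSet_Ioo] with u hu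
  rw [Real.norm_eq_abs, abs_mul]
  exact mul_le_mul (h u hu.2.le) (h' _ (by linarith [hu.1])) (abs_nonneg _) hB

theorem lineConv_eq_setIntegral (hf : IsCausal f) (hg : IsCausal g) (T : ℝ) :
    lineConv f g T = ∫ u in Set.Ioo 0 T, f u * g (T - u) :=
  (setIntegral_eq_integral_of_forall_compl_eq_zero fun _ hu ↦ hf.mul_eq_zero hg hu).symm

theorem IsCausal.lineConv (hf : IsCausal f) (hg : IsCausal g) : IsCausal (lineConv f g) where
  measurable := by
    have : Measurable fun p : ℝ × ℝ ↦ f p.2 * g (p.1 - p.2) :=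
      (hf.measurable.comp measurable_snd).mul (hg.measurable.comp (by fun_prop))
    exact (this.stronglyMeasurable.integral_prod_right (ν := volume)).measurable
  eq_zero t ht := by
    rw [lineConv_eq_setIntegral hf hg, Set.Ioo_eq_empty (by linarith), setIntegral_empty]
  bdd T := by
    obtain ⟨B, hB, h⟩ := hf.bdd T
    obtain ⟨B', hB', h'⟩ := hg.bdd T
    refine ⟨B * B' * max T 0, by positivity, fun t ht ↦ ?_⟩
    rw [lineConv_eq_setIntegral hf hg, ← Real.norm_eq_abs]
    refine (norm_setIntegral_le_of_norm_le_const (C := B * B') measure_Ioo_lt_top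
      fun u hu ↦ ?_).trans ?_
    · rw [Real.norm_eq_abs, abs_mul]
      exact mul_le_mul (h u (hu.2.le.trans ht)) (h' _ (by linarith [hu.1])) (abs_nonneg _) hB
    · rw [measureReal_def, Real.volume_Ioo, ENNReal.toReal_ofReal', sub_zero]
      refine mul_le_mul_of_nonneg_left (max_le_max ht le_rfl) (by positivity)

theorem lineConv_comm (f g : ℝ → ℝ) : lineConv f g = lineConv g f := by
  ext T
  unfold lineConv
  rw [← integral_sub_left_eq_self (fun u ↦ f u * g (T - u)) volume T]
  refine integral_congr_ae (Filter.Eventually.of_forall fun u ↦ ?_)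
  simp [mul_comm]

theorem lineConv_comp_sub (f g : ℝ → ℝ) (c T : ℝ) :
    lineConv f (fun t ↦ g (t - c)) T = lineConv f g (T - c) := by
  unfold lineConv
  simp_rw [sub_right_comm]

theorem lineConv_add (hf : IsCausal f) (hg : IsCausal g) (hk : IsCausal k) (T : ℝ) :
    lineConv f (fun t ↦ g t + k t) T = lineConv f g T + lineConv f k T := by
  unfold lineConv
  rw [← integral_add (hf.integrable_mul hg T) (hf.integrable_mul hk T)]
  simp_rw [mul_add]

theorem lineConv_const_mul (f g : ℝ → ℝ) (c T : ℝ) :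
    lineConv f (fun t ↦ c * g t) T = c * lineConv f g T := by
  unfold lineConv
  rw [← integral_const_mul]
  simp_rw [mul_left_comm]

theorem lineConv_sum {ι : Type*} (s : Finset ι) (hf : IsCausal f) {g : ι → ℝ → ℝ}
    (hg : ∀ i ∈ s, IsCausal (g i)) (T : ℝ) :
    lineConv f (fun t ↦ ∑ i ∈ s, g i t) T = ∑ i ∈ s, lineConv f (g i) T := by
  unfold lineConv
  rw [← integral_finsetSum _ fun i hi ↦ hf.integrable_mul (hg i hi) T]
  simp_rw [Finset.mul_sum]

theorem lineConv_backDiff (hf : IsCausal f) (hg : IsCausal g) :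
    lineConv f (backDiff g) = backDiff (lineConv f g) := by
  ext T
  have : backDiff g = fun t ↦ g t + (-1) * (fun t ↦ g (t - 1)) t := by
    ext t; simp [backDiff, sub_eq_add_neg]
  rw [this, lineConv_add hf hg ((hg.comp_sub zero_le_one).const_mul _), lineConv_const_mul,
    lineConv_comp_sub, backDiff]
  ring

theorem backDiff_lineConv (hf : IsCausal f) (hg : IsCausal g) :
    backDiff (lineConv f g) = lineConv (backDiff f) g := by
  rw [lineConv_comm f, ← lineConv_backDiff hg hf, lineConv_comm]

theorem IsCausal.iterate_lineConv (hf : IsCausal f) (hg : IsCausal g) (j : ℕ) :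
    IsCausal ((_root_.lineConv f)^[j] g) := by
  induction j with
  | zero => exact hg
  | succ j ih => rw [Function.iterate_succ_apply']; exact hf.lineConv ih

theorem IsCausal.iterate_backDiff (hf : IsCausal f) (j : ℕ) :
    IsCausal (_root_.backDiff^[j] f) := by
  induction j with
  | zero => exact hf
  | succ j ih => rw [Function.iterate_succ_apply']; exact ih.backDiff

theorem iterate_backDiff_lineConv (hf : IsCausal f) (hg : IsCausal g) (j : ℕ) :
    backDiff^[j] (lineConv f g) = lineConv f (backDiff^[j] g) := by
  induction j with
  | zero => rfl
  | succ j ih =>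
    rw [Function.iterate_succ_apply', ih, Function.iterate_succ_apply',
      lineConv_backDiff hf (hg.iterate_backDiff j)]

theorem iterate_backDiff_iterate_lineConv (hf : IsCausal f) (hg : IsCausal g) (i j : ℕ) :
    backDiff^[i] ((lineConv f)^[j] g) = (lineConv f)^[j] (backDiff^[i] g) := by
  induction j with
  | zero => rfl
  | succ j ih =>
    rw [Function.iterate_succ_apply', iterate_backDiff_lineConv hf (hf.iterate_lineConv hg j), ih,
      Function.iterate_succ_apply']

theorem iterate_backDiff_iterate_lineConv_self (hf : IsCausal f) (hg : IsCausal g) (j : ℕ) :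
    backDiff^[j] ((lineConv f)^[j] g) = (lineConv (backDiff f))^[j] g := by
  induction j with
  | zero => rfl
  | succ j ih =>
    have h := hf.iterate_lineConv hg j
    rw [Function.iterate_succ_apply' (lineConv f), Function.iterate_succ_apply',
      iterate_backDiff_lineConv hf h, backDiff_lineConv hf (h.iterate_backDiff j), ih,
      Function.iterate_succ_apply']

theorem IsCausal.intervalIntegrable (hf : IsCausal f) (a b : ℝ) :
    IntervalIntegrable f volume a b := by
  obtain ⟨B, hB, h⟩ := hf.bdd (max a b)
  rw [intervalIntegrable_iff]
  refine Measure.integrableOn_of_bounded (M := B) (by simp) hf.measurable.aestronglyMeasurable ?_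
  filter_upwards [ae_restrict_mem measurableSet_uIoc] with u hu
  rw [Real.norm_eq_abs]
  rw [Set.mem_uIoc] at hu
  refine h u ?_
  rcases hu with hu | hu
  · exact hu.2.trans (le_max_right _ _)
  · exact hu.2.trans (le_max_left _ _)

/-- On the window `(0, τ]`, the function `f` is `c` up to an exponentially small error. -/
def ExpClose (τ η c B : ℝ) (f : ℝ → ℝ) : Prop :=
  ∀ T, 0 < T → T ≤ τ → |f T - c| ≤ B * Real.exp (-(η * T))

variable {τ η c B : ℝ}

theorem ExpClose.mono (h : ExpClose τ η c B f) {B' : ℝ} (hB : B ≤ B') : ExpClose τ η c B' f :=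
  fun T h0 h1 ↦ (h T h0 h1).trans (mul_le_mul_of_nonneg_right hB (Real.exp_pos _).le)

theorem ExpClose.nonneg (h : ExpClose τ η c B f) (hτ : 0 < τ) : 0 ≤ B := by
  have := (abs_nonneg _).trans (h τ hτ le_rfl)
  exact nonneg_of_mul_nonneg_left this (Real.exp_pos _)

theorem ExpClose.backDiff (hf : IsCausal f) (h : ExpClose τ η c B f) (hτ : 0 < τ) (hη : 0 ≤ η)
    (hc : 0 ≤ c) : ExpClose τ η 0 (2 * (c + B) * Real.exp η) (backDiff f) := by
  intro T h0 h1
  have hB := h.nonneg hτ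
  rw [sub_zero, _root_.backDiff]
  have hE : Real.exp (-(η * (T - 1))) = Real.exp η * Real.exp (-(η * T)) := by
    rw [← Real.exp_add]; congr 1; ring
  have h1η : 1 ≤ Real.exp η := Real.one_le_exp hη
  have hp := Real.exp_pos (-(η * T))
  rcases lt_or_ge 1 T with hT | hT
  · have h2 := h T h0 h1
    have h3 := h (T - 1) (by linarith) (by linarith)
    rw [hE] at h3
    have h4 : |f T - f (T - 1)| ≤ |f T - c| + |f (T - 1) - c| := by
      have := abs_sub (f T - c) (f (T - 1) - c)
      simpa using this
    have h5 : B * Real.exp (-(η * T)) ≤ B * (Real.exp η * Real.exp (-(η * T))) :=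
      mul_le_mul_of_nonneg_left (le_mul_of_one_le_left hp.le h1η) hB
    have h6 : 0 ≤ c * (Real.exp η * Real.exp (-(η * T))) := by positivity
    nlinarith
  · rw [hf.eq_zero _ (by linarith : T - 1 ≤ 0), sub_zero]
    have h2 := h T h0 h1
    have h3 : 1 ≤ Real.exp η * Real.exp (-(η * T)) := by
      rw [← hE]; exact Real.one_le_exp (by nlinarith)
    have h4 : |f T| ≤ |f T - c| + c := by
      have := abs_add_le (f T - c) c
      rw [sub_add_cancel, abs_of_nonneg hc] at this
      exact this
    have h5 : B * Real.exp (-(η * T)) ≤ B * (Real.exp η * Real.exp (-(η * T))) :=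
      mul_le_mul_of_nonneg_left (le_mul_of_one_le_left hp.le h1η) hB
    have h6 : c ≤ c * (Real.exp η * Real.exp (-(η * T))) := le_mul_of_one_le_right hc h3
    have h7 : 0 ≤ B * (Real.exp η * Real.exp (-(η * T))) := by positivity
    nlinarith

theorem abs_integral_backDiff_sub_le (hf : IsCausal f) (h : ExpClose τ η c B f) (hτ : 0 < τ)
    (hη : 0 ≤ η) (hc : 0 ≤ c) {T : ℝ} (h1 : T ≤ τ) :
    |(∫ u in (0)..T, backDiff f u) - c| ≤ (c + B) * Real.exp η * Real.exp (-(η * T)) := by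
  have hB := h.nonneg hτ
  have hE : Real.exp (-(η * (T - 1))) = Real.exp η * Real.exp (-(η * T)) := by
    rw [← Real.exp_add]; congr 1; ring
  have e1 : ∫ u in (0)..T, backDiff f u = ∫ u in (T - 1)..T, f u := by
    unfold backDiff
    rw [intervalIntegral.integral_sub (hf.intervalIntegrable _ _)
      ((hf.comp_sub zero_le_one).intervalIntegrable _ _),
      intervalIntegral.integral_comp_sub_right (fun u ↦ f u) 1]
    have e2 : ∫ u in (-1)..0, f u = 0 := by
      rw [intervalIntegral.integral_congr (g := fun _ ↦ 0)]
      · simp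
      · intro u hu
        rw [Set.uIcc_of_le (by norm_num)] at hu
        exact hf.eq_zero u hu.2
    have e3 := intervalIntegral.integral_add_adjacent_intervals
      (hf.intervalIntegrable (-1) 0) (hf.intervalIntegrable 0 T)
    have e4 := intervalIntegral.integral_add_adjacent_intervals
      (hf.intervalIntegrable (-1) (T - 1)) (hf.intervalIntegrable (T - 1) T)
    rw [zero_sub]
    linarith
  have e2 : (∫ u in (T - 1)..T, f u) - c = ∫ u in (T - 1)..T, (f u - c) := by
    rw [intervalIntegral.integral_sub (hf.intervalIntegrable _ _) intervalIntegrable_const]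
    simp
  rw [e1, e2, ← Real.norm_eq_abs]
  refine (intervalIntegral.norm_integral_le_of_norm_le_const
    (C := (c + B) * Real.exp η * Real.exp (-(η * T))) fun u hu ↦ ?_).trans (by simp)
  rw [Set.uIoc_of_le (by linarith)] at hu
  rw [Real.norm_eq_abs, mul_assoc, ← hE, add_mul]
  rcases lt_or_ge 0 u with hu0 | hu0
  · refine (h u hu0 (hu.2.trans h1)).trans ?_
    have : Real.exp (-(η * u)) ≤ Real.exp (-(η * (T - 1))) := by
      rw [Real.exp_le_exp]; nlinarith [hu.1]
    have h2 := mul_le_mul_of_nonneg_left this hB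
    have h3 : 0 ≤ c * Real.exp (-(η * (T - 1))) := by positivity
    linarith
  · rw [hf.eq_zero u hu0, zero_sub, abs_neg, abs_of_nonneg hc]
    have h3 : 1 ≤ Real.exp (-(η * (T - 1))) := Real.one_le_exp (by nlinarith [hu.1])
    have h4 : 0 ≤ B * Real.exp (-(η * (T - 1))) := by positivity
    have h5 := le_mul_of_one_le_right hc h3
    linarith

theorem ExpClose.lineConv {Bk Bκ κ : ℝ} (hk : IsCausal k) (hG : IsCausal G) (hτ : 0 < τ)
    (hkB : ExpClose τ η 0 Bk k)
    (hκ : ∀ T, 0 < T → T ≤ τ → |(∫ u in (0)..T, k u) - κ| ≤ Bκ * Real.exp (-(η * T)))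
    (h : ExpClose τ η c B G) :
    ExpClose τ η (κ * c) (τ * Bk * B + |c| * Bκ) (_root_.lineConv k G) := by
  intro T h0 h1
  have hB := h.nonneg hτ
  have hBk := hkB.nonneg hτ
  have hInt : IntegrableOn k (Set.Ioo 0 T) := by
    have := hk.intervalIntegrable 0 T
    rw [intervalIntegrable_iff_integrableOn_Ioo_of_le h0.le] at this
    exact this
  have hdec : _root_.lineConv k G T - κ * c =
      (∫ u in Set.Ioo 0 T, k u * (G (T - u) - c)) + c * ((∫ u in (0)..T, k u) - κ) := by
    rw [lineConv_eq_setIntegral hk hG, intervalIntegral.integral_of_le h0.le,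
      integral_Ioc_eq_integral_Ioo]
    simp_rw [mul_sub]
    rw [integral_sub ((hk.integrable_mul hG T).integrableOn) (hInt.mul_const c),
      integral_mul_const]
    ring
  rw [hdec]
  refine (abs_add_le _ _).trans ?_
  rw [add_mul, abs_mul]
  refine add_le_add ?_ ?_
  · rw [← Real.norm_eq_abs]
    refine (norm_setIntegral_le_of_norm_le_const (C := Bk * B * Real.exp (-(η * T)))
      measure_Ioo_lt_top fun u hu ↦ ?_).trans ?_
    · rw [Real.norm_eq_abs, abs_mul]
      have h2 := hkB u hu.1 (hu.2.le.trans h1)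
      rw [sub_zero] at h2
      have h3 := h (T - u) (by linarith [hu.2]) (by linarith [hu.1])
      have h4 : Real.exp (-(η * T)) = Real.exp (-(η * u)) * Real.exp (-(η * (T - u))) := by
        rw [← Real.exp_add]; congr 1; ring
      calc _ ≤ (Bk * Real.exp (-(η * u))) * (B * Real.exp (-(η * (T - u)))) :=
            mul_le_mul h2 h3 (abs_nonneg _) (by positivity)
        _ = _ := by rw [h4]; ring
    · rw [measureReal_def, Real.volume_Ioo, sub_zero, ENNReal.toReal_ofReal h0.le]
      calc _ = T * (Bk * B * Real.exp (-(η * T))) := by ring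
        _ ≤ τ * (Bk * B * Real.exp (-(η * T))) := mul_le_mul_of_nonneg_right h1 (by positivity)
        _ = _ := by ring
  · rw [mul_assoc]
    exact mul_le_mul_of_nonneg_left (hκ T h0 h1) (abs_nonneg _)

theorem ExpClose.lineConv_zero {Bk : ℝ} (hk : IsCausal k) (hG : IsCausal G) (hτ : 0 < τ)
    (hkB : ExpClose τ η 0 Bk k) (h : ExpClose τ η 0 B G) :
    ExpClose τ η 0 (τ * Bk * B) (_root_.lineConv k G) := by
  intro T h0 h1
  have hB := h.nonneg hτ
  have hBk := hkB.nonneg hτ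
  rw [sub_zero, lineConv_eq_setIntegral hk hG, ← Real.norm_eq_abs]
  refine (norm_setIntegral_le_of_norm_le_const (C := Bk * B * Real.exp (-(η * T)))
      measure_Ioo_lt_top fun u hu ↦ ?_).trans ?_
  · rw [Real.norm_eq_abs, abs_mul]
    have h2 := hkB u hu.1 (hu.2.le.trans h1)
    have h3 := h (T - u) (by linarith [hu.2]) (by linarith [hu.1])
    rw [sub_zero] at h2 h3
    have h4 : Real.exp (-(η * T)) = Real.exp (-(η * u)) * Real.exp (-(η * (T - u))) := by
      rw [← Real.exp_add]; congr 1; ring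
    calc _ ≤ (Bk * Real.exp (-(η * u))) * (B * Real.exp (-(η * (T - u)))) :=
          mul_le_mul h2 h3 (abs_nonneg _) (by positivity)
      _ = _ := by rw [h4]; ring
  · rw [measureReal_def, Real.volume_Ioo, sub_zero, ENNReal.toReal_ofReal h0.le]
    calc _ = T * (Bk * B * Real.exp (-(η * T))) := by ring
      _ ≤ τ * (Bk * B * Real.exp (-(η * T))) := mul_le_mul_of_nonneg_right h1 (by positivity)
      _ = _ := by ring

/-- A `d`-fold convolution of a function with positive limit grows polynomially of degree `d - 1`,
so it cannot agree with a function having at most a finite limit: quantitative version. -/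
theorem mul_pow_le_of_iterate_lineConv_eq {F' φ ψ : ℝ → ℝ} {M M' B B' Bφ Bψ κ Bκ Q : ℝ} {d : ℕ}
    (hd : 2 ≤ d) (hτ : 0 < τ) (hη : 0 ≤ η) (hF : IsCausal F) (hF' : IsCausal F')
    (hφ : IsCausal φ) (hψ : IsCausal ψ) (hM : 0 ≤ M) (hM' : 0 ≤ M') (hκ0 : 0 ≤ κ)
    (hFM : ExpClose τ η M B F) (hFM' : ExpClose τ η M' B' F') (hφB : ExpClose τ η 0 Bφ φ)
    (hψB : ExpClose τ η 0 Bψ ψ)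
    (hκ : ∀ T, 0 < T → T ≤ τ → |(∫ u in (0)..T, ψ u) - κ| ≤ Bκ * Real.exp (-(η * T)))
    (heq : ∀ T ≤ τ, (lineConv F)^[d] ψ T = (lineConv φ)^[d] F' T)
    (hQ : 2 ≤ Q) (hQτ : τ ≤ Q) (hQM : 2 * (M + B) * Real.exp η ≤ Q)
    (hQM' : 2 * (M' + B') * Real.exp η ≤ Q) (hQη : 2 * Real.exp η ≤ Q) (hQφ : Bφ ≤ Q)
    (hQψ : Bψ ≤ Q) (hQκ : κ ≤ Q) (hQBκ : Bκ ≤ Q) :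
    κ * M ^ d ≤ Q ^ (3 * d + 2) * Real.exp (-(η * τ)) := by
  have hB := hFM.nonneg hτ
  have hB' := hFM'.nonneg hτ
  have h1η : 1 ≤ Real.exp η := Real.one_le_exp hη
  have hMB : M + B ≤ Q := by nlinarith
  obtain ⟨j, rfl⟩ : ∃ j, d = j + 2 := ⟨d - 2, by omega⟩
  have hQ0 : 0 < Q := by linarith
  have hQ1 : 1 ≤ Q := by linarith
  -- the side with one factor having a limit
  have hR1 : ∀ i : ℕ, ExpClose τ η 0 (Q ^ (i + 1)) (backDiff^[i + 1] F') := by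
    intro i
    induction i with
    | zero =>
      rw [Function.iterate_one, zero_add, pow_one]
      exact (hFM'.backDiff hF' hτ hη hM').mono hQM'
    | succ i ih =>
      rw [Function.iterate_succ_apply']
      refine (ih.backDiff (hF'.iterate_backDiff _) hτ hη le_rfl).mono ?_
      rw [zero_add, pow_succ Q (i + 1)]
      nlinarith [pow_pos hQ0 (i + 1)]
  have hR2 : ∀ i : ℕ, ExpClose τ η 0 (Q ^ (2 * i + (j + 1)))
      ((lineConv φ)^[i] (backDiff^[j + 1] F')) := by
    intro i
    induction i with
    | zero => simpa using hR1 j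
    | succ i ih =>
      rw [Function.iterate_succ_apply']
      refine (ExpClose.lineConv_zero hφ (hφ.iterate_lineConv (hF'.iterate_backDiff _) i) hτ hφB
        ih).mono ?_
      rw [show 2 * (i + 1) + (j + 1) = 2 + (2 * i + (j + 1)) by ring, pow_add Q 2, pow_two]
      exact mul_le_mul_of_nonneg_right
        (mul_le_mul hQτ hQφ (hφB.nonneg hτ) hQ0.le) (by positivity)
  -- the side with `d` such factors
  have hL1 : ExpClose τ η (κ * M) (Q ^ 4) (lineConv F ψ) := by
    rw [lineConv_comm]
    refine (ExpClose.lineConv hψ hF hτ hψB hκ hFM).mono ?_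
    rw [abs_of_nonneg hM]
    have h1 : τ * Bψ * B ≤ Q * Q * Q := by
      refine mul_le_mul (mul_le_mul hQτ hQψ (hψB.nonneg hτ) hQ0.le) (by linarith) hB (by positivity)
    have h2 : M * Bκ ≤ M * Q := mul_le_mul_of_nonneg_left hQBκ hM
    have h3 : M * Q ≤ Q * Q := mul_le_mul_of_nonneg_right (by linarith) hQ0.le
    nlinarith [pow_pos hQ0 2, pow_pos hQ0 3]
  have hL2 : ∀ i : ℕ, ExpClose τ η (κ * M ^ (i + 1)) (Q ^ (3 * i + 4))
      ((lineConv (backDiff F))^[i] (lineConv F ψ)) := by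
    intro i
    induction i with
    | zero => simpa using hL1
    | succ i ih =>
      rw [Function.iterate_succ_apply']
      have h1 := ExpClose.lineConv hF.backDiff
        (hF.backDiff.iterate_lineConv (hF.lineConv hψ) i) hτ (hFM.backDiff hF hτ hη hM)
        (fun T _ h1 ↦ abs_integral_backDiff_sub_le hF hFM hτ hη hM h1) ih
      rw [show M * (κ * M ^ (i + 1)) = κ * M ^ (i + 1 + 1) by ring] at h1
      refine h1.mono ?_
      have h2 : τ * (2 * (M + B) * Real.exp η) * Q ^ (3 * i + 4) ≤ Q * Q * Q ^ (3 * i + 4) :=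
        mul_le_mul_of_nonneg_right (mul_le_mul hQτ hQM (by positivity) hQ0.le) (by positivity)
      have h3 : |κ * M ^ (i + 1)| * ((M + B) * Real.exp η) ≤ (Q * Q ^ (i + 1)) * Q := by
        rw [abs_of_nonneg (by positivity)]
        refine mul_le_mul (mul_le_mul hQκ ?_ (by positivity) hQ0.le) (by nlinarith) (by positivity)
          (by positivity)
        exact pow_le_pow_left₀ hM (by linarith) _
      have h4 : Q * Q ^ (i + 1) * Q ≤ Q * Q * Q ^ (3 * i + 4) := by
        have : Q ^ (i + 1) ≤ Q ^ (3 * i + 4) := pow_le_pow_right₀ hQ1 (by omega)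
        nlinarith [mul_pos hQ0 hQ0]
      calc _ ≤ 2 * (Q * Q * Q ^ (3 * i + 4)) := by linarith
        _ ≤ Q * (Q * Q * Q ^ (3 * i + 4)) := mul_le_mul_of_nonneg_right hQ (by positivity)
        _ = _ := by ring
  have hL := hL2 (j + 1) τ hτ le_rfl
  have hR := hR2 (j + 2) τ hτ le_rfl
  rw [← iterate_backDiff_iterate_lineConv hφ hF', sub_zero] at hR
  rw [← iterate_backDiff_iterate_lineConv_self hF (hF.lineConv hψ), ← Function.iterate_succ_apply]
    at hL
  have hag : ∀ i : ℕ, ∀ T ≤ τ, backDiff^[i] ((lineConv F)^[j + 2] ψ) T =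
      backDiff^[i] ((lineConv φ)^[j + 2] F') T := by
    intro i
    induction i with
    | zero => exact heq
    | succ i ih =>
      intro T hT
      rw [Function.iterate_succ_apply' backDiff, Function.iterate_succ_apply' backDiff]
      exact congrArg₂ (· - ·) (ih T hT) (ih (T - 1) (by linarith))
  change |backDiff^[j + 1] ((lineConv F)^[j + 2] ψ) τ - _| ≤ _ at hL
  rw [hag _ τ le_rfl] at hL
  have hp := Real.exp_pos (-(η * τ))
  have h1 : κ * M ^ (j + 1 + 1) ≤
      (Q ^ (3 * (j + 1) + 4) + Q ^ (2 * (j + 2) + (j + 1))) * Real.exp (-(η * τ)) := by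
    rw [add_mul]
    have := (abs_le.mp hL).1
    have := (abs_le.mp hR).2
    linarith
  refine h1.trans (mul_le_mul_of_nonneg_right ?_ hp.le)
  have h2 : Q ^ (2 * (j + 2) + (j + 1)) ≤ Q ^ (3 * (j + 1) + 4) :=
    pow_le_pow_right₀ hQ1 (by omega)
  calc _ ≤ 2 * Q ^ (3 * (j + 1) + 4) := by linarith
    _ ≤ Q * Q ^ (3 * (j + 1) + 4) := mul_le_mul_of_nonneg_right hQ (by positivity)
    _ = _ := by ring

end CausalConvolution

section RieszSums

open MeasureTheory Finset
open scoped ArithmeticFunction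

/-- The sum `∑ a(m) / m * φ (T - log m)` over `m ≤ exp T`. -/
noncomputable def rieszSum (a : ArithmeticFunction ℝ) (φ : ℝ → ℝ) (T : ℝ) : ℝ :=
  ∑ m ∈ Icc 1 ⌊Real.exp T⌋₊, a m / m * φ (T - Real.log m)

variable {a b : ArithmeticFunction ℝ} {φ ψ : ℝ → ℝ}

theorem rieszSum_eq_sum_of_le (hφ : ∀ t ≤ 0, φ t = 0) {T : ℝ} {N : ℕ} (hN : ⌊Real.exp T⌋₊ ≤ N) :
    rieszSum a φ T = ∑ m ∈ Icc 1 N, a m / m * φ (T - Real.log m) := by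
  refine sum_subset (Icc_subset_Icc_right hN) fun m hm hm' ↦ ?_
  rw [mem_Icc] at hm hm'
  have h1 : Real.exp T < m := (Nat.floor_lt (Real.exp_pos T).le).mp (by omega)
  have h2 : T ≤ Real.log m := (Real.le_log_iff_exp_le (by exact_mod_cast hm.1)).mpr h1.le
  rw [hφ _ (by linarith), mul_zero]

theorem rieszSum_congr {y : ℕ} (h : a - b ∈ vanishingIdeal y) {T : ℝ} (hT : Real.exp T ≤ y) :
    rieszSum a φ T = rieszSum b φ T := by
  refine sum_congr rfl fun m hm ↦ ?_
  rw [mem_Icc] at hm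
  have h1 := mem_vanishingIdeal.mp h m (hm.2.trans (Nat.floor_le_of_le hT))
  rw [sub_eq_add_neg, ArithmeticFunction.add_apply, ArithmeticFunction.neg_apply,
    ← sub_eq_add_neg, sub_eq_zero] at h1
  rw [h1]

theorem rieszSum_eq_zero (hφ : ∀ t ≤ 0, φ t = 0) {T : ℝ} (hT : T ≤ 0) : rieszSum a φ T = 0 := by
  refine sum_eq_zero fun m hm ↦ ?_
  have := Real.log_natCast_nonneg m
  rw [hφ _ (by linarith), mul_zero]

theorem rieszSum_one (hφ : ∀ t ≤ 0, φ t = 0) : rieszSum 1 φ = φ := by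
  ext T
  rw [rieszSum_eq_sum_of_le hφ (le_max_left _ 1), sum_eq_single 1]
  · simp
  · intro m _ hm
    simp [ArithmeticFunction.one_apply_ne hm]
  · simp

theorem rieszSum_arithSingle (hφ : ∀ t ≤ 0, φ t = 0) {q : ℕ} (hq : q ≠ 0) (T : ℝ) :
    rieszSum (arithSingle q) φ T = 1 / q * φ (T - Real.log q) := by
  rw [rieszSum_eq_sum_of_le hφ (le_max_left _ q), sum_eq_single q]
  · simp [arithSingle, hq]
  · intro m _ hm
    simp [arithSingle, hm]
  · intro h
    exact absurd (mem_Icc.mpr ⟨Nat.one_le_iff_ne_zero.mpr hq, le_max_right _ _⟩) h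

theorem rieszSum_sub (T : ℝ) : rieszSum (a - b) φ T = rieszSum a φ T - rieszSum b φ T := by
  unfold rieszSum
  rw [← sum_sub_distrib]
  refine sum_congr rfl fun m _ ↦ ?_
  rw [sub_eq_add_neg, ArithmeticFunction.add_apply, ArithmeticFunction.neg_apply]
  ring

theorem rieszSum_mul (hφ : ∀ t ≤ 0, φ t = 0) :
    rieszSum (a * b) φ = rieszSum a (rieszSum b φ) := by
  ext T
  set N := ⌊Real.exp T⌋₊ with hN
  have hR : rieszSum a (rieszSum b φ) T = ∑ m ∈ Icc 1 N, ∑ k ∈ Icc 1 N,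
      a m / m * (b k / k * φ (T - Real.log m - Real.log k)) := by
    unfold rieszSum
    refine sum_congr rfl fun m hm ↦ ?_
    rw [← mul_sum]
    congr 1
    refine rieszSum_eq_sum_of_le hφ (Nat.floor_le_floor (Real.exp_le_exp.mpr ?_))
    linarith [Real.log_natCast_nonneg m]
  rw [hR, ← sum_product']
  unfold rieszSum
  rw [← hN]
  have hL : ∀ j ∈ Icc 1 N, (a * b) j / j * φ (T - Real.log j) =
      ∑ x ∈ Nat.divisorsAntidiagonal j,
        a x.1 / x.1 * (b x.2 / x.2 * φ (T - Real.log x.1 - Real.log x.2)) := by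
    intro j hj
    rw [ArithmeticFunction.mul_apply, sum_div, sum_mul]
    refine sum_congr rfl fun x hx ↦ ?_
    obtain ⟨h1, h2⟩ := Nat.mem_divisorsAntidiagonal.mp hx
    rw [← h1] at h2
    have h3 : (x.1 : ℝ) ≠ 0 := by exact_mod_cast (mul_ne_zero_iff.mp h2).1
    have h4 : (x.2 : ℝ) ≠ 0 := by exact_mod_cast (mul_ne_zero_iff.mp h2).2
    rw [← h1, Nat.cast_mul, Real.log_mul h3 h4, ← sub_sub]
    field_simp
  rw [sum_congr rfl hL]
  have hmaps : ∀ x ∈ (Icc 1 N ×ˢ Icc 1 N).filter (fun x ↦ x.1 * x.2 ≤ N),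
      x.1 * x.2 ∈ Icc 1 N := fun x hx ↦ by
    simp only [mem_filter, mem_product, mem_Icc] at hx ⊢
    exact ⟨Nat.mul_pos hx.1.1.1 hx.1.2.1, hx.2⟩
  rw [← sum_filter_of_ne (p := fun x : ℕ × ℕ ↦ x.1 * x.2 ≤ N),
    ← sum_fiberwise_of_maps_to hmaps]
  · refine sum_congr rfl fun j hj ↦ sum_congr ?_ fun _ _ ↦ rfl
    ext x
    rw [mem_Icc] at hj
    simp only [Nat.mem_divisorsAntidiagonal, mem_filter, mem_product, mem_Icc]
    constructor
    · rintro ⟨h1, h2⟩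
      have h3 := mul_ne_zero_iff.mp (h1 ▸ h2)
      have h4 : x.1 ≤ j := Nat.le_of_dvd (by omega) (Dvd.intro _ h1)
      have h5 : x.2 ≤ j := Nat.le_of_dvd (by omega) (Dvd.intro_left _ h1)
      omega
    · rintro ⟨-, h1⟩
      exact ⟨h1, by omega⟩
  · intro x hx hne
    by_contra hlt
    apply hne
    simp only [mem_product, mem_Icc] at hx
    rw [not_le, hN, Nat.floor_lt (Real.exp_pos T).le, Nat.cast_mul] at hlt
    have h3 : (0 : ℝ) < x.1 := by exact_mod_cast hx.1.1
    have h4 : (0 : ℝ) < x.2 := by exact_mod_cast hx.2.1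
    rw [← Real.lt_log_iff_exp_lt (by positivity), Real.log_mul h3.ne' h4.ne'] at hlt
    rw [hφ _ (by linarith), mul_zero, mul_zero]

theorem isCausal_rieszSum (hφ : IsCausal φ) (a : ArithmeticFunction ℝ) :
    IsCausal (rieszSum a φ) where
  measurable := by
    refine measurable_of_tendsto_metrizable
      (f := fun N T ↦ ∑ m ∈ Icc 1 N, a m / m * φ (T - Real.log m)) (fun N ↦ ?_) ?_
    · exact Finset.measurable_fun_sum _ fun m _ ↦
        (hφ.measurable.comp (measurable_id.sub_const _)).const_mul _
    · rw [tendsto_pi_nhds]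
      intro T
      refine tendsto_const_nhds.congr' ?_
      filter_upwards [Filter.eventually_ge_atTop ⌊Real.exp T⌋₊] with N hN
      exact rieszSum_eq_sum_of_le hφ.eq_zero hN
  eq_zero _ ht := rieszSum_eq_zero hφ.eq_zero ht
  bdd T := by
    obtain ⟨B, hB, h⟩ := hφ.bdd T
    refine ⟨∑ m ∈ Icc 1 ⌊Real.exp T⌋₊, |a m / m| * B, by positivity, fun t ht ↦ ?_⟩
    rw [rieszSum_eq_sum_of_le hφ.eq_zero (Nat.floor_le_floor (Real.exp_le_exp.mpr ht))]
    refine (abs_sum_le_sum_abs _ _).trans (sum_le_sum fun m _ ↦ ?_)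
    rw [abs_mul]
    exact mul_le_mul_of_nonneg_left (h _ (by linarith [Real.log_natCast_nonneg m])) (abs_nonneg _)

theorem lineConv_rieszSum (hφ : IsCausal φ) (hψ : IsCausal ψ) (a : ArithmeticFunction ℝ) :
    lineConv ψ (rieszSum a φ) = rieszSum a (lineConv ψ φ) := by
  ext T
  set N := ⌊Real.exp T⌋₊ with hN
  have h1 : lineConv ψ (rieszSum a φ) T =
      lineConv ψ (fun t ↦ ∑ m ∈ Icc 1 N, a m / m * φ (t - Real.log m)) T := by
    unfold lineConv
    congr 1
    ext u
    rcases le_or_gt u 0 with hu | hu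
    · simp [hψ.eq_zero u hu]
    · congr 1
      exact rieszSum_eq_sum_of_le hφ.eq_zero
        (Nat.floor_le_floor (Real.exp_le_exp.mpr (by linarith)))
  rw [h1, lineConv_sum _ hψ fun m _ ↦
    (hφ.comp_sub (Real.log_natCast_nonneg m)).const_mul (a m / m)]
  refine sum_congr rfl fun m _ ↦ ?_
  rw [lineConv_const_mul, lineConv_comp_sub]

theorem iterate_lineConv_rieszSum (hφ : IsCausal φ) (hψ : IsCausal ψ) (b : ArithmeticFunction ℝ)
    (d : ℕ) : (lineConv φ)^[d] (rieszSum b ψ) = rieszSum b ((lineConv φ)^[d] ψ) := by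
  induction d with
  | zero => rfl
  | succ d ih =>
    rw [Function.iterate_succ_apply', ih, lineConv_rieszSum (hφ.iterate_lineConv hψ d) hφ,
      Function.iterate_succ_apply']

theorem iterate_lineConv_rieszSum_self (hφ : IsCausal φ) (hψ : IsCausal ψ)
    (a : ArithmeticFunction ℝ) (d : ℕ) :
    (lineConv (rieszSum a φ))^[d] ψ = rieszSum (a ^ d) ((lineConv φ)^[d] ψ) := by
  induction d with
  | zero => rw [pow_zero, Function.iterate_zero_apply, Function.iterate_zero_apply, rieszSum_one hψ.eq_zero]
  | succ d ih =>
    have hχ := hφ.iterate_lineConv hψ d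
    rw [Function.iterate_succ_apply', ih, lineConv_rieszSum hχ (isCausal_rieszSum hφ a),
      lineConv_comm, lineConv_rieszSum hφ hχ, lineConv_comm, Function.iterate_succ_apply', pow_succ,
      rieszSum_mul (hφ.lineConv hχ).eq_zero]

/-- Removing one Euler factor. -/
theorem rieszSum_mul_one_sub (hφ : IsCausal φ) {q : ℕ} (hq : q ≠ 0) (T : ℝ) :
    rieszSum (a * (1 - arithSingle q)) φ T =
      rieszSum a φ T - 1 / q * rieszSum a φ (T - Real.log q) := by
  rw [mul_sub, mul_one, rieszSum_sub, mul_comm a, rieszSum_mul hφ.eq_zero,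
    rieszSum_arithSingle (isCausal_rieszSum hφ a).eq_zero hq]

theorem ExpClose.rieszSum_mul_one_sub {τ η M B : ℝ} (hφ : IsCausal φ)
    (h : ExpClose τ η M B (rieszSum a φ)) (hη0 : 0 ≤ η) (hη : η ≤ 1 / 2) (hM : 0 ≤ M)
    (hMB : M ≤ B) {q : ℕ} (hq : 2 ≤ q) :
    ExpClose τ η (M * (1 - 1 / q)) (B * (1 + (q : ℝ) ^ (-(1 / 2) : ℝ)))
      (rieszSum (a * (1 - arithSingle q)) φ) := by
  intro T h0 h1
  have hq0 : (0 : ℝ) < q := by positivity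
  have hB : 0 ≤ B := hM.trans hMB
  rw [_root_.rieszSum_mul_one_sub hφ (by omega)]
  have hE : 1 / (q : ℝ) * Real.exp (-(η * (T - Real.log q))) ≤
      (q : ℝ) ^ (-(1 / 2) : ℝ) * Real.exp (-(η * T)) := by
    have e1 : Real.exp (-(η * (T - Real.log q))) = (q : ℝ) ^ η * Real.exp (-(η * T)) := by
      rw [Real.rpow_def_of_pos hq0, ← Real.exp_add]; congr 1; ring
    rw [e1, ← mul_assoc]
    refine mul_le_mul_of_nonneg_right ?_ (Real.exp_pos _).le
    rw [one_div, ← Real.rpow_neg_one, ← Real.rpow_add hq0]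
    exact Real.rpow_le_rpow_of_exponent_le (by exact_mod_cast (by omega : 1 ≤ q)) (by linarith)
  have h2 := h T h0 h1
  have h3 : |1 / (q : ℝ) * (rieszSum a φ (T - Real.log q) - M)| ≤
      B * ((q : ℝ) ^ (-(1 / 2) : ℝ) * Real.exp (-(η * T))) := by
    rw [abs_mul, abs_of_pos (by positivity : (0 : ℝ) < 1 / q)]
    have hl := Real.log_natCast_nonneg q
    have : |rieszSum a φ (T - Real.log q) - M| ≤ B * Real.exp (-(η * (T - Real.log q))) := by
      rcases lt_or_ge 0 (T - Real.log q) with h4 | h4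
      · exact h _ h4 (by linarith)
      · rw [(isCausal_rieszSum hφ a).eq_zero _ h4, zero_sub, abs_neg, abs_of_nonneg hM]
        exact hMB.trans (le_mul_of_one_le_right hB (Real.one_le_exp (by nlinarith)))
    calc _ ≤ 1 / (q : ℝ) * (B * Real.exp (-(η * (T - Real.log q)))) := by gcongr
      _ = B * (1 / (q : ℝ) * Real.exp (-(η * (T - Real.log q)))) := by ring
      _ ≤ _ := mul_le_mul_of_nonneg_left hE hB
  have e : rieszSum a φ T - 1 / (q : ℝ) * rieszSum a φ (T - Real.log q) - M * (1 - 1 / q) =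
      (rieszSum a φ T - M) - 1 / (q : ℝ) * (rieszSum a φ (T - Real.log q) - M) := by ring
  rw [e]
  refine (abs_sub _ _).trans ((add_le_add h2 h3).trans (le_of_eq ?_))
  ring

theorem ExpClose.rieszSum_mul_prod {ι : Type*} {τ η M B : ℝ} (hφ : IsCausal φ)
    (h : ExpClose τ η M B (rieszSum a φ)) (hη0 : 0 ≤ η) (hη : η ≤ 1 / 2) (hM : 0 ≤ M)
    (hMB : M ≤ B) (s : Finset ι) (q : ι → ℕ) (hq : ∀ i ∈ s, 2 ≤ q i) :
    ExpClose τ η (M * ∏ i ∈ s, (1 - 1 / (q i : ℝ)))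
      (B * ∏ i ∈ s, (1 + (q i : ℝ) ^ (-(1 / 2) : ℝ)))
      (rieszSum (a * ∏ i ∈ s, (1 - arithSingle (q i))) φ) := by
  classical
  induction s using Finset.induction_on with
  | empty => simpa using h
  | insert i s hi ih =>
    have hqs : ∀ j ∈ s, 0 ≤ 1 - 1 / (q j : ℝ) ∧ 1 - 1 / (q j : ℝ) ≤ 1 := fun j hj ↦ by
      have : (2 : ℝ) ≤ q j := by exact_mod_cast hq j (mem_insert_of_mem hj)
      constructor
      · rw [sub_nonneg, div_le_one (by linarith)]; linarith
      · have : 0 ≤ 1 / (q j : ℝ) := by positivity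
        linarith
    have h1 := ExpClose.rieszSum_mul_one_sub hφ (ih fun j hj ↦ hq j (mem_insert_of_mem hj)) hη0 hη
      (mul_nonneg hM (prod_nonneg fun j hj ↦ (hqs j hj).1)) ?_ (hq i (mem_insert_self i s))
    · convert! h1 using 1
      · rw [prod_insert hi]; ring
      · rw [prod_insert hi]; ring
      · rw [prod_insert hi, mul_comm (1 - arithSingle (q i)), ← mul_assoc]
    · refine mul_le_mul hMB ?_ (prod_nonneg fun j hj ↦ (hqs j hj).1) (hM.trans hMB)
      refine prod_le_prod (fun j hj ↦ (hqs j hj).1) fun j hj ↦ (hqs j hj).2.trans ?_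
      have : 0 ≤ (q j : ℝ) ^ (-(1 / 2) : ℝ) := by positivity
      linarith

end RieszSums

section RieszKernel

open MeasureTheory Module
open scoped ArithmeticFunction Nat

/-- The kernel `t ^ r * exp (-t)` on the positive half-line. -/
noncomputable def rieszKernel (r : ℕ) (t : ℝ) : ℝ := truncPow r t * Real.exp (-t)

theorem rieszKernel_nonneg (r : ℕ) (t : ℝ) : 0 ≤ rieszKernel r t :=
  mul_nonneg (truncPow_nonneg r t) (Real.exp_pos _).le

theorem rieszKernel_of_nonpos (r : ℕ) {t : ℝ} (ht : t ≤ 0) : rieszKernel r t = 0 := by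
  rw [rieszKernel, truncPow_of_nonpos r ht, zero_mul]

theorem rieszKernel_of_pos (r : ℕ) {t : ℝ} (ht : 0 < t) :
    rieszKernel r t = t ^ r * Real.exp (-t) := by
  rw [rieszKernel, truncPow, if_pos ht]

theorem rieszKernel_le (r : ℕ) (t : ℝ) : rieszKernel r t ≤ r ! := by
  rcases le_or_gt t 0 with ht | ht
  · rw [rieszKernel_of_nonpos r ht]; positivity
  · have h := Real.pow_div_factorial_le_exp _ ht.le r
    rw [div_le_iff₀ (by positivity)] at h
    rw [rieszKernel_of_pos r ht, Real.exp_neg, ← div_eq_mul_inv, div_le_iff₀ (Real.exp_pos _)]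
    linarith

theorem rieszKernel_le_exp (r : ℕ) (t : ℝ) :
    rieszKernel r t ≤ 2 ^ r * r ! * Real.exp (-(1 / 2 * t)) := by
  rcases le_or_gt t 0 with ht | ht
  · rw [rieszKernel_of_nonpos r ht]; positivity
  · have h := Real.pow_div_factorial_le_exp _ (by positivity : 0 ≤ t / 2) r
    rw [div_le_iff₀ (by positivity), div_pow, div_le_iff₀ (by positivity)] at h
    have e : Real.exp (-t) = Real.exp (-(t / 2)) * Real.exp (-(1 / 2 * t)) := by
      rw [← Real.exp_add]; ring_nf
    have e2 : Real.exp (t / 2) * Real.exp (-(t / 2)) = 1 := by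
      rw [← Real.exp_add]; simp
    rw [rieszKernel_of_pos r ht, e, ← mul_assoc]
    refine mul_le_mul_of_nonneg_right ?_ (Real.exp_pos _).le
    calc _ ≤ (Real.exp (t / 2) * r ! * 2 ^ r) * Real.exp (-(t / 2)) := by gcongr
      _ = 2 ^ r * r ! * (Real.exp (t / 2) * Real.exp (-(t / 2))) := by ring
      _ = _ := by rw [e2, mul_one]

theorem isCausal_rieszKernel (r : ℕ) : IsCausal (rieszKernel r) where
  measurable := by
    unfold rieszKernel truncPow
    exact (Measurable.ite measurableSet_Ioi (by fun_prop) (by fun_prop)).mul (by fun_prop)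
  eq_zero _ ht := rieszKernel_of_nonpos r ht
  bdd _ := ⟨r !, by positivity, fun t _ ↦ by
    rw [abs_of_nonneg (rieszKernel_nonneg r t)]; exact rieszKernel_le r t⟩

theorem expClose_rieszKernel (r : ℕ) {τ η : ℝ} (hη : η ≤ 1 / 2) :
    ExpClose τ η 0 (2 ^ r * r !) (rieszKernel r) := by
  intro T h0 _
  rw [sub_zero, abs_of_nonneg (rieszKernel_nonneg r T)]
  refine (rieszKernel_le_exp r T).trans (mul_le_mul_of_nonneg_left ?_ (by positivity))
  rw [Real.exp_le_exp]
  nlinarith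

theorem abs_integral_rieszKernel_sub_le (r : ℕ) {η T : ℝ} (hη : η ≤ 1 / 2) (hT : 0 < T) :
    |(∫ u in (0)..T, rieszKernel r u) - r !| ≤ 2 ^ (r + 1) * r ! * Real.exp (-(η * T)) := by
  have hG : (r ! : ℝ) = ∫ u in Set.Ioi 0, rieszKernel r u := by
    rw [← Real.Gamma_nat_eq_factorial, Real.Gamma_eq_integral (by positivity)]
    refine setIntegral_congr_fun measurableSet_Ioi fun u hu ↦ ?_
    simp only [add_sub_cancel_right, Real.rpow_natCast]
    rw [rieszKernel_of_pos r hu, mul_comm]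
  have hInt : IntegrableOn (rieszKernel r) (Set.Ioi 0) := by
    refine (Real.GammaIntegral_convergent (by positivity : (0 : ℝ) < r + 1)).congr_fun
      (fun u hu ↦ ?_) measurableSet_Ioi
    simp only [add_sub_cancel_right, Real.rpow_natCast]
    rw [rieszKernel_of_pos r hu, mul_comm]
  have hInt2 := hInt.mono_set (Set.Ioi_subset_Ioi hT.le)
  have hsplit := intervalIntegral.integral_interval_add_Ioi hInt hInt2
  have h1 : (∫ u in (0)..T, rieszKernel r u) - r ! = - ∫ u in Set.Ioi T, rieszKernel r u := by
    rw [hG]; linarith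
  rw [h1, abs_neg, abs_of_nonneg (setIntegral_nonneg measurableSet_Ioi
    fun u _ ↦ rieszKernel_nonneg r u)]
  have h2 : ∫ u in Set.Ioi T, rieszKernel r u ≤
      ∫ u in Set.Ioi T, 2 ^ r * r ! * Real.exp ((-(1 / 2)) * u) := by
    refine setIntegral_mono_on hInt2
      ((integrableOn_exp_mul_Ioi (by norm_num) T).const_mul _) measurableSet_Ioi fun u _ ↦ ?_
    rw [neg_mul]
    exact rieszKernel_le_exp r u
  refine h2.trans ?_
  rw [integral_const_mul, integral_exp_mul_Ioi (by norm_num)]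
  have h3 : Real.exp (-(1 / 2) * T) ≤ Real.exp (-(η * T)) := by
    rw [Real.exp_le_exp]; nlinarith
  calc _ = 2 ^ (r + 1) * r ! * Real.exp (-(1 / 2) * T) := by ring
    _ ≤ _ := mul_le_mul_of_nonneg_left h3 (by positivity)

theorem rieszSum_rieszKernel (a : ArithmeticFunction ℝ) (r : ℕ) (T : ℝ) :
    rieszSum a (rieszKernel r) T = Real.exp (-T) * kernelSum a (truncPow r) T := by
  unfold rieszSum kernelSum
  rw [Finset.mul_sum]
  refine Finset.sum_congr rfl fun m hm ↦ ?_
  have hm0 : (0 : ℝ) < m := by exact_mod_cast (Finset.mem_Icc.mp hm).1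
  rw [rieszKernel, neg_sub, Real.exp_sub, Real.exp_log hm0, Real.exp_neg]
  field_simp

theorem rank_le_finrank (K : Type*) [Field K] [NumberField K] : Units.rank K ≤ finrank ℚ K := by
  rw [Units.rank, ← InfinitePlace.sum_mult_eq (K := K)]
  refine (Nat.sub_le _ _).trans ?_
  rw [← Finset.card_univ, Finset.card_eq_sum_ones]
  exact Finset.sum_le_sum fun w _ ↦ InfinitePlace.mult_pos

theorem idealCount_nonneg (K : Type*) [Field K] [NumberField K] (m : ℕ) : 0 ≤ idealCount K m := by
  simp only [idealCount, ArithmeticFunction.coe_mk]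
  split_ifs <;> positivity

theorem idealCount_one (K : Type*) [Field K] [NumberField K] : idealCount K 1 = 1 := by
  simp [idealCount_apply]

/-- The Riesz means of the ideal counting function, with bounds for the main term and the error
which are polynomial in the discriminant. -/
theorem exists_expClose_rieszSum (n : ℕ) (hn : 2 ≤ n) :
    ∃ (k : ℕ) (X₀ : ℝ), ∀ (K : Type) [Field K] [NumberField K], finrank ℚ K ≤ n →
      ∀ X : ℝ, X₀ ≤ X → absDisc K ≤ X → ∃ M B : ℝ, 0 < M ∧ M ≤ B ∧ 1 ≤ M * X ^ k ∧ B ≤ X ^ k ∧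
        ∀ τ, ExpClose τ (1 / (n : ℝ)) M B
          (rieszSum (idealCount K) (rieszKernel (Units.rank K))) := by
  obtain ⟨C, A, hC, hA, H⟩ := exists_abs_kernelSum_idealCount_sub_le n (by omega)
  obtain ⟨C₁, hC₁, H₁⟩ := exists_ncard_absNorm_eq_le_rpow n 1 one_pos
  set a := ⌈A⌉₊ with ha
  refine ⟨1 + (a + 1) + (1 + n * (a + 2) + n * (a + 2)),
    2 + 2 * (1 + C) + 2 * C₁ * n ! + Real.exp 1, fun K _ _ hK X hX hD ↦ ?_⟩
  have hn0 : (0 : ℝ) < n := by positivity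
  have hf1 : (1 : ℝ) ≤ n ! := by exact_mod_cast Nat.one_le_iff_ne_zero.mpr (Nat.factorial_ne_zero n)
  have he := Real.exp_pos 1
  have hCn : 0 < 2 * C₁ * n ! := by positivity
  have hX1 : 1 ≤ X := by linarith
  have hX0 : 0 < X := by linarith
  obtain ⟨M, hM, hMT⟩ := H K hK
  set E := C * absDisc K ^ A with hE
  have hD1 := one_le_absDisc K
  have hE0 : 0 < E := by have := absDisc_pos K; positivity
  set r := Units.rank K with hr
  have hrn : r ≤ n := (rank_le_finrank K).trans hK
  have hDX : absDisc K ^ A ≤ X ^ a := by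
    calc absDisc K ^ A ≤ absDisc K ^ (a : ℝ) :=
          Real.rpow_le_rpow_of_exponent_le hD1 (Nat.le_ceil A)
      _ ≤ X ^ (a : ℝ) := Real.rpow_le_rpow (by linarith) hD (by positivity)
      _ = X ^ a := Real.rpow_natCast X a
  have hDA : 1 ≤ absDisc K ^ A := Real.one_le_rpow hD1 hA.le
  have hEX : 1 + E ≤ X ^ (a + 1) := by
    calc 1 + E ≤ (1 + C) * absDisc K ^ A := by rw [hE]; nlinarith
      _ ≤ X * X ^ a := mul_le_mul (by linarith) hDX (by positivity) hX0.le
      _ = _ := by ring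
  set F := rieszSum (idealCount K) (rieszKernel r) with hF
  have hclose : ∀ T : ℝ, |F T - M| ≤ M * E * Real.exp (-(1 / n * T)) := by
    intro T
    have h1 := hMT T
    have h2 : F T - M =
        Real.exp (-T) * (kernelSum (idealCount K) (truncPow r) T - M * Real.exp T) := by
      rw [hF, rieszSum_rieszKernel, mul_sub, mul_left_comm, ← Real.exp_add]; simp
    rw [h2, abs_mul, abs_of_pos (Real.exp_pos _)]
    refine (mul_le_mul_of_nonneg_left h1 (Real.exp_pos _).le).trans (le_of_eq ?_)
    rw [mul_left_comm, ← Real.exp_add]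
    ring_nf
  have hlow : 1 ≤ M * (X * X ^ (a + 1)) := by
    have h1 : Real.exp (-1) ≤ F 1 := by
      have h2 := Finset.single_le_sum
        (f := fun m : ℕ ↦ idealCount K m / m * rieszKernel r (1 - Real.log m))
        (s := Finset.Icc 1 ⌊Real.exp 1⌋₊) (fun m _ ↦ mul_nonneg
        (div_nonneg (idealCount_nonneg K m) (by positivity)) (rieszKernel_nonneg _ _)) (a := 1)
        (Finset.mem_Icc.mpr ⟨le_rfl, Nat.le_floor (by simp)⟩)
      have h3 : Real.exp (-1) = idealCount K 1 / (1 : ℕ) *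
          rieszKernel r (1 - Real.log (1 : ℕ)) := by
        simp [idealCount_one, rieszKernel_of_pos]
      rw [h3]
      exact h2
    have h2 := (abs_le.mp (hclose 1)).2
    have h3 : Real.exp (-(1 / n * 1)) ≤ 1 := Real.exp_le_one_iff.mpr (by
      rw [mul_one]; exact neg_nonpos.mpr (by positivity))
    have h4 : Real.exp (-1) ≤ M * (1 + E) := by
      have := mul_le_mul_of_nonneg_left h3 (by positivity : 0 ≤ M * E)
      linarith
    calc 1 = Real.exp 1 * Real.exp (-1) := by rw [← Real.exp_add]; simp
      _ ≤ Real.exp 1 * (M * (1 + E)) := mul_le_mul_of_nonneg_left h4 he.le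
      _ ≤ X * (M * X ^ (a + 1)) := by
        refine mul_le_mul (by linarith) (mul_le_mul_of_nonneg_left hEX hM.le) (by positivity) hX0.le
      _ = _ := by ring
  have hup : M ≤ X * X ^ (n * (a + 2)) * X ^ (n * (a + 2)) := by
    set T := n * Real.log (2 * (1 + E)) with hT
    have h1 := (abs_le.mp (hclose T)).1
    have h2 : Real.exp (-(1 / n * T)) = (2 * (1 + E))⁻¹ := by
      rw [hT, Real.exp_neg, one_div, inv_mul_cancel_left₀ hn0.ne', Real.exp_log (by positivity)]
    have h3 : M / 2 ≤ F T := by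
      rw [h2] at h1
      have : M * E * (2 * (1 + E))⁻¹ ≤ M / 2 := by
        rw [← div_eq_mul_inv, div_le_div_iff₀ (by positivity) two_pos]
        nlinarith
      linarith
    have h4 : Real.exp T ≤ X ^ (n * (a + 2)) := by
      rw [hT, mul_comm, Real.exp_mul, Real.exp_log (by positivity), Real.rpow_natCast, mul_comm n,
        pow_mul]
      refine pow_le_pow_left₀ (by positivity) ?_ n
      calc 2 * (1 + E) ≤ X * X ^ (a + 1) := mul_le_mul (by linarith) hEX (by positivity) hX0.le
        _ = _ := by ring
    have h5 : F T ≤ (∑ m ∈ Finset.Icc 1 ⌊Real.exp T⌋₊, C₁ * n !) := by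
      refine Finset.sum_le_sum fun m hm ↦ ?_
      have hm1 := (Finset.mem_Icc.mp hm).1
      have hm0 : (0 : ℝ) < m := by exact_mod_cast hm1
      refine mul_le_mul ?_ ((rieszKernel_le _ _).trans (by exact_mod_cast Nat.factorial_le hrn))
        (rieszKernel_nonneg _ _) hC₁.le
      rw [div_le_iff₀ hm0, idealCount_apply (by omega)]
      simpa using H₁ K hK m (by omega)
    rw [Finset.sum_const, Nat.card_Icc, add_tsub_cancel_right, nsmul_eq_mul] at h5
    have h6 : (⌊Real.exp T⌋₊ : ℝ) ≤ X ^ (n * (a + 2)) :=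
      (Nat.floor_le (Real.exp_pos _).le).trans h4
    have h7 : 1 ≤ X ^ (n * (a + 2)) := one_le_pow₀ hX1
    have hXC : C₁ * n ! * 2 ≤ X := by linarith
    calc M ≤ 2 * F T := by linarith
      _ ≤ 2 * (⌊Real.exp T⌋₊ * (C₁ * n !)) := by linarith
      _ = (C₁ * n ! * 2) * ⌊Real.exp T⌋₊ := by ring
      _ ≤ X * X ^ (n * (a + 2)) := mul_le_mul hXC h6 (by positivity) hX0.le
      _ ≤ _ := le_mul_of_one_le_right (by positivity) h7
  refine ⟨M, M * (1 + E), hM, by nlinarith, ?_, ?_, fun τ T _ _ ↦ ?_⟩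
  · refine hlow.trans (mul_le_mul_of_nonneg_left ?_ hM.le)
    rw [← pow_succ']
    exact pow_le_pow_right₀ hX1 (by omega)
  · calc M * (1 + E) ≤ (X * X ^ (n * (a + 2)) * X ^ (n * (a + 2))) * X ^ (a + 1) :=
          mul_le_mul hup hEX (by positivity) (by positivity)
      _ = X ^ ((a + 1) + (1 + n * (a + 2) + n * (a + 2))) := by ring
      _ ≤ _ := pow_le_pow_right₀ hX1 (by omega)
  · refine (hclose T).trans (mul_le_mul_of_nonneg_right ?_ (Real.exp_pos _).le)
    nlinarith

end RieszKernel

section SquarefreeCount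

open Finset Module

/-- The subsets of `S` with product at most `y`. -/
def subsetsProdLE (S : Finset ℕ) (y : ℕ) : Finset (Finset ℕ) :=
  S.powerset.filter fun T ↦ ∏ p ∈ T, p ≤ y

theorem mem_subsetsProdLE {S T : Finset ℕ} {y : ℕ} :
    T ∈ subsetsProdLE S y ↔ T ⊆ S ∧ ∏ p ∈ T, p ≤ y := by
  simp [subsetsProdLE]

theorem empty_mem_subsetsProdLE (S : Finset ℕ) {y : ℕ} (hy : 1 ≤ y) : ∅ ∈ subsetsProdLE S y := by
  simpa [mem_subsetsProdLE] using hy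

/-- A set of integers in `[2, y]` with product exceeding `y` has a subset whose product lies between
`√y` and `y`. -/
theorem exists_subset_prod_mem {T : Finset ℕ} {y : ℕ} (hT : ∀ p ∈ T, 2 ≤ p ∧ p ≤ y)
    (hy : 1 ≤ y) (h : y < ∏ p ∈ T, p) :
    ∃ A ∈ subsetsProdLE T y, y < (∏ p ∈ A, p) ^ 2 := by
  obtain ⟨A, hA, hmax⟩ := exists_max_image (subsetsProdLE T y) (fun A ↦ ∏ p ∈ A, p)
    ⟨∅, empty_mem_subsetsProdLE T hy⟩
  refine ⟨A, hA, ?_⟩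
  obtain ⟨hAT, hAy⟩ := mem_subsetsProdLE.mp hA
  have hne : A ≠ T := by rintro rfl; omega
  obtain ⟨p, hpT, hpA⟩ := exists_of_ssubset (hAT.ssubset_of_ne hne)
  have hA0 : 0 < ∏ q ∈ A, q := prod_pos fun q hq ↦ by have := hT q (hAT hq); omega
  have hp := hT p hpT
  have h1 : p ≤ ∏ q ∈ A, q := by
    have := hmax {p} (mem_subsetsProdLE.mpr ⟨singleton_subset_iff.mpr hpT, by simpa using hp.2⟩)
    simpa using this
  have h2 : y < p * ∏ q ∈ A, q := by
    by_contra hle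
    rw [not_lt, ← prod_insert (f := fun q ↦ q) hpA] at hle
    have := hmax _ (mem_subsetsProdLE.mpr ⟨insert_subset hpT hAT, hle⟩)
    rw [prod_insert hpA] at this
    nlinarith
  nlinarith

theorem prod_one_add_le_of_card_le {S : Finset ℕ} {y : ℕ} (hS : ∀ p ∈ S, 2 ≤ p ∧ p ≤ y)
    (hy : 1 ≤ y) (hcard : 2 * ((subsetsProdLE S y).card : ℝ) ≤ (y : ℝ) ^ (1 / 4 : ℝ)) :
    ∏ p ∈ S, (1 + (p : ℝ) ^ (-(1 / 2) : ℝ)) ≤ 2 * (subsetsProdLE S y).card := by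
  classical
  set W := ∏ p ∈ S, (1 + (p : ℝ) ^ (-(1 / 2) : ℝ)) with hW
  set N := (subsetsProdLE S y).card with hN
  have hw0 : ∀ T : Finset ℕ, 0 ≤ ∏ p ∈ T, (p : ℝ) ^ (-(1 / 2) : ℝ) := fun T ↦ by positivity
  have hWsum : W = ∑ T ∈ S.powerset, ∏ p ∈ T, (p : ℝ) ^ (-(1 / 2) : ℝ) := prod_one_add _
  have hW0 : 0 ≤ W := by rw [hWsum]; exact sum_nonneg fun T _ ↦ hw0 T
  have hy0 : (0 : ℝ) < y := by exact_mod_cast hy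
  have hwT : ∀ T : Finset ℕ, ∏ p ∈ T, (p : ℝ) ^ (-(1 / 2) : ℝ) =
      ((∏ p ∈ T, p : ℕ) : ℝ) ^ (-(1 / 2) : ℝ) := fun T ↦ by
    rw [Nat.cast_prod, Real.finsetProd_rpow _ _ fun i _ ↦ by positivity]
  have hsmall : ∑ T ∈ subsetsProdLE S y, ∏ p ∈ T, (p : ℝ) ^ (-(1 / 2) : ℝ) ≤ N := by
    refine (sum_le_card_nsmul _ _ 1 fun T hT ↦ prod_le_one (fun p _ ↦ by positivity)
      fun p hp ↦ ?_).trans (by simp [hN])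
    have := hS p ((mem_subsetsProdLE.mp hT).1 hp)
    exact Real.rpow_le_one_of_one_le_of_nonpos (by exact_mod_cast (by omega : 1 ≤ p))
      (by norm_num)
  have hbig : ∑ T ∈ S.powerset.filter (fun T ↦ ¬ ∏ p ∈ T, p ≤ y),
      ∏ p ∈ T, (p : ℝ) ^ (-(1 / 2) : ℝ) ≤ N * ((y : ℝ) ^ (-(1 / 4) : ℝ) * W) := by
    have hchoose : ∀ T ∈ S.powerset.filter (fun T ↦ ¬ ∏ p ∈ T, p ≤ y),
        ∃ A ∈ subsetsProdLE S y, A ⊆ T ∧ y < (∏ p ∈ A, p) ^ 2 := fun T hT ↦ by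
      rw [mem_filter, mem_powerset, not_le] at hT
      obtain ⟨A, hA, h⟩ := exists_subset_prod_mem (fun p hp ↦ hS p (hT.1 hp)) hy hT.2
      rw [mem_subsetsProdLE] at hA
      exact ⟨A, mem_subsetsProdLE.mpr ⟨hA.1.trans hT.1, hA.2⟩, hA.1, h⟩
    choose! g hg hgT hgy using hchoose
    rw [← sum_fiberwise_of_maps_to hg]
    refine (sum_le_card_nsmul _ _ ((y : ℝ) ^ (-(1 / 4) : ℝ) * W) fun A hA ↦ ?_).trans (by simp [hN])
    rcases (filter (fun T ↦ g T = A) (S.powerset.filter (fun T ↦ ¬ ∏ p ∈ T, p ≤ y))).eq_empty_or_nonempty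
      with h0 | ⟨T₀, hT₀⟩
    · rw [h0, sum_empty]; positivity
    have hyA : y < (∏ p ∈ A, p) ^ 2 := by
      rw [mem_filter] at hT₀
      have := hgy T₀ hT₀.1
      rwa [hT₀.2] at this
    have hwA : ∏ p ∈ A, (p : ℝ) ^ (-(1 / 2) : ℝ) ≤ (y : ℝ) ^ (-(1 / 4) : ℝ) := by
      rw [hwT]
      have h1 : (y : ℝ) ^ (1 / 2 : ℝ) ≤ ((∏ p ∈ A, p : ℕ) : ℝ) := by
        have h2 : (y : ℝ) ≤ ((∏ p ∈ A, p : ℕ) : ℝ) ^ 2 := by exact_mod_cast hyA.le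
        rw [← Real.sqrt_eq_rpow]
        exact Real.sqrt_le_left (by positivity) |>.mpr h2
      calc ((∏ p ∈ A, p : ℕ) : ℝ) ^ (-(1 / 2) : ℝ) ≤ ((y : ℝ) ^ (1 / 2 : ℝ)) ^ (-(1 / 2) : ℝ) :=
            Real.rpow_le_rpow_of_nonpos (by positivity) h1 (by norm_num)
        _ = _ := by rw [← Real.rpow_mul hy0.le]; norm_num
    have hsub : ∀ T ∈ filter (fun T ↦ g T = A) (S.powerset.filter (fun T ↦ ¬ ∏ p ∈ T, p ≤ y)),
        A ⊆ T ∧ T ⊆ S := fun T hT ↦ by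
      simp only [mem_filter, mem_powerset] at hT
      have := hgT T (by simpa using hT.1)
      rw [hT.2] at this
      exact ⟨this, hT.1.1⟩
    calc _ = ∑ T ∈ filter (fun T ↦ g T = A) (S.powerset.filter (fun T ↦ ¬ ∏ p ∈ T, p ≤ y)),
          (∏ p ∈ A, (p : ℝ) ^ (-(1 / 2) : ℝ)) * ∏ p ∈ T \ A, (p : ℝ) ^ (-(1 / 2) : ℝ) := by
          refine sum_congr rfl fun T hT ↦ ?_
          rw [mul_comm, prod_sdiff (hsub T hT).1]
      _ = (∏ p ∈ A, (p : ℝ) ^ (-(1 / 2) : ℝ)) * ∑ T ∈ (filter (fun T ↦ g T = A)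
          (S.powerset.filter (fun T ↦ ¬ ∏ p ∈ T, p ≤ y))).image (· \ A),
            ∏ p ∈ T, (p : ℝ) ^ (-(1 / 2) : ℝ) := by
          rw [mul_sum, sum_image]
          · intro T hT T' hT' h
            have h' : T \ A = T' \ A := h
            rw [← sdiff_union_of_subset (hsub T hT).1, h', sdiff_union_of_subset (hsub T' hT').1]
      _ ≤ (y : ℝ) ^ (-(1 / 4) : ℝ) * W := by
          refine mul_le_mul hwA ?_ (sum_nonneg fun T _ ↦ hw0 T) (by positivity)
          rw [hWsum]
          refine sum_le_sum_of_subset_of_nonneg (fun T hT ↦ ?_) fun T _ _ ↦ hw0 T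
          obtain ⟨T', hT', rfl⟩ := mem_image.mp hT
          exact mem_powerset.mpr (sdiff_subset.trans (hsub T' hT').2)
  have hsplit : W = (∑ T ∈ subsetsProdLE S y, ∏ p ∈ T, (p : ℝ) ^ (-(1 / 2) : ℝ)) +
      ∑ T ∈ S.powerset.filter (fun T ↦ ¬ ∏ p ∈ T, p ≤ y), ∏ p ∈ T, (p : ℝ) ^ (-(1 / 2) : ℝ) := by
    rw [hWsum]
    exact (sum_filter_add_sum_filter_not _ _ _).symm
  have hhalf : N * (y : ℝ) ^ (-(1 / 4) : ℝ) ≤ 1 / 2 := by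
    rw [Real.rpow_neg hy0.le, ← div_eq_mul_inv, div_le_iff₀ (by positivity)]
    linarith
  have := mul_le_mul_of_nonneg_right hhalf hW0
  linarith

variable {K : Type} [Field K] [NumberField K]

theorem ncard_primes_dvd_le (s : Finset (Ideal (𝓞 K))) {p : ℕ} (hp : p.Prime)
    (hs : ∀ P ∈ s, P.IsPrime ∧ P ≠ ⊥ ∧ (p : 𝓞 K) ∈ P) :
    (∀ P ∈ s, p ≤ Ideal.absNorm P) ∧ s.card ≤ finrank ℚ K := by
  have hnorm : Ideal.absNorm (Ideal.span {(p : 𝓞 K)}) = p ^ finrank ℚ K := by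
    rw [Ideal.absNorm_span_singleton, ← RingOfIntegers.rank K, ← map_natCast (algebraMap ℤ (𝓞 K)),
      Algebra.norm_algebraMap, Int.natAbs_pow, Int.natAbs_natCast]
  have hle : ∀ P ∈ s, p ≤ Ideal.absNorm P := fun P hP ↦ by
    obtain ⟨h1, h2, h3⟩ := hs P hP
    have hd : Ideal.absNorm P ∣ p ^ finrank ℚ K := by
      rw [← hnorm]
      exact map_dvd _ (Ideal.dvd_span_singleton.mpr h3)
    obtain ⟨j, -, hj⟩ := (Nat.dvd_prime_pow hp).mp hd
    have h4 := two_le_absNorm_of_isPrime P h1 h2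
    have hj0 : j ≠ 0 := by rintro rfl; rw [pow_zero] at hj; omega
    rw [hj]
    exact Nat.le_self_pow hj0 p
  refine ⟨hle, ?_⟩
  have hdvd : ∏ P ∈ s, P ∣ Ideal.span {(p : 𝓞 K)} :=
    Finset.prod_primes_dvd _ (fun P hP ↦ Ideal.prime_of_isPrime (hs P hP).2.1 (hs P hP).1)
      fun P hP ↦ Ideal.dvd_span_singleton.mpr (hs P hP).2.2
  have h1 := map_dvd (Ideal.absNorm (S := 𝓞 K)) hdvd
  rw [map_prod, hnorm] at h1
  have h2 := Nat.le_of_dvd (pow_pos hp.pos _) h1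
  have h3 := (pow_card_le_prod s (fun P ↦ Ideal.absNorm P) p hle).trans h2
  exact (Nat.pow_le_pow_iff_right hp.one_lt).mp h3

open scoped Classical in
/-- The prime ideals of norm at most `y` above a prime number in `S`. -/
noncomputable def primesLEOver (K : Type) [Field K] [NumberField K] (S : Finset ℕ) (y : ℕ) :
    Finset (Ideal (𝓞 K)) :=
  (primesLE K y).filter fun P ↦ ∃ p ∈ S, (p : 𝓞 K) ∈ P

theorem mem_primesLEOver {S : Finset ℕ} {y : ℕ} {P : Ideal (𝓞 K)} :
    P ∈ primesLEOver K S y ↔ P ∈ primesLE K y ∧ ∃ p ∈ S, (p : 𝓞 K) ∈ P := by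
  simp [primesLEOver]

theorem primesLEOver_subset (S : Finset ℕ) (y : ℕ) : primesLEOver K S y ⊆ primesLE K y :=
  fun _ hP ↦ (mem_primesLEOver.mp hP).1

theorem prod_primesLEOver_le {n : ℕ} (hK : finrank ℚ K ≤ n) {S : Finset ℕ}
    (hS : ∀ p ∈ S, p.Prime) (y : ℕ) :
    ∏ P ∈ primesLEOver K S y, (1 + (Ideal.absNorm P : ℝ) ^ (-(1 / 2) : ℝ)) ≤
      (∏ p ∈ S, (1 + (p : ℝ) ^ (-(1 / 2) : ℝ))) ^ n := by
  classical
  have hex : ∀ P ∈ primesLEOver K S y, ∃ p ∈ S, (p : 𝓞 K) ∈ P := fun P hP ↦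
    (mem_primesLEOver.mp hP).2
  choose! g hgS hgP using hex
  have hprime : ∀ P ∈ primesLEOver K S y, P.IsPrime ∧ P ≠ ⊥ := fun P hP ↦
    ⟨(mem_primesLE.mp (mem_primesLEOver.mp hP).1).1,
      (mem_primesLE.mp (mem_primesLEOver.mp hP).1).2.1⟩
  rw [← prod_fiberwise_of_maps_to hgS, ← prod_pow]
  refine prod_le_prod (fun p _ ↦ by positivity) fun p hp ↦ ?_
  have h := ncard_primes_dvd_le ((primesLEOver K S y).filter fun P ↦ g P = p) (hS p hp)
    fun P hP ↦ by
      rw [mem_filter] at hP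
      exact ⟨(hprime P hP.1).1, (hprime P hP.1).2, hP.2 ▸ hgP P hP.1⟩
  have hp0 : (0 : ℝ) < p := by exact_mod_cast (hS p hp).pos
  have h1 : (1 : ℝ) ≤ 1 + (p : ℝ) ^ (-(1 / 2) : ℝ) := le_add_of_nonneg_right (by positivity)
  calc _ ≤ ∏ P ∈ (primesLEOver K S y).filter fun P ↦ g P = p,
        (1 + (p : ℝ) ^ (-(1 / 2) : ℝ)) := by
        refine prod_le_prod (fun P _ ↦ by positivity) fun P hP ↦ ?_
        have h2 : (p : ℝ) ≤ Ideal.absNorm P := by exact_mod_cast h.1 P hP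
        linarith [Real.rpow_le_rpow_of_nonpos hp0 h2 (by norm_num : -(1 / 2 : ℝ) ≤ 0)]
    _ ≤ _ := by
        rw [prod_const]
        exact pow_le_pow_right₀ h1 (h.2.trans hK)

theorem one_le_one_sub_inv_mul_sq {q : ℕ} (hq : 2 ≤ q) :
    1 ≤ (1 - 1 / (q : ℝ)) * (1 + (q : ℝ) ^ (-(1 / 2) : ℝ)) ^ 2 := by
  have hq0 : (0 : ℝ) < q := by positivity
  set x := (q : ℝ) ^ (-(1 / 2) : ℝ) with hx
  have hx0 : 0 ≤ x := by positivity
  have hx2 : x ^ 2 = 1 / q := by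
    rw [hx, ← Real.rpow_natCast, ← Real.rpow_mul hq0.le,
      show -(1 / 2 : ℝ) * ((2 : ℕ) : ℝ) = -1 by norm_num, Real.rpow_neg_one, one_div]
  have hle : x ^ 2 ≤ 1 / 2 := by
    rw [hx2]
    exact one_div_le_one_div_of_le two_pos (by exact_mod_cast hq)
  rw [← hx2]
  have hx1 : x ≤ 1 := by nlinarith
  nlinarith [mul_nonneg hx0 hx0, mul_nonneg hx0 (by linarith : 0 ≤ 1 / 2 - x ^ 2)]

theorem one_le_prod_mul_pow {n : ℕ} (hK : finrank ℚ K ≤ n) {S : Finset ℕ}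
    (hS : ∀ p ∈ S, p.Prime) (y : ℕ) :
    1 ≤ (∏ P ∈ primesLEOver K S y, (1 - 1 / (Ideal.absNorm P : ℝ))) *
      (∏ p ∈ S, (1 + (p : ℝ) ^ (-(1 / 2) : ℝ))) ^ (2 * n) := by
  have h2 : ∀ P ∈ primesLEOver K S y, 2 ≤ Ideal.absNorm P := fun P hP ↦ by
    have := mem_primesLE.mp (mem_primesLEOver.mp hP).1
    exact two_le_absNorm_of_isPrime P this.1 this.2.1
  have h1 : 1 ≤ (∏ P ∈ primesLEOver K S y, (1 - 1 / (Ideal.absNorm P : ℝ))) *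
      (∏ P ∈ primesLEOver K S y, (1 + (Ideal.absNorm P : ℝ) ^ (-(1 / 2) : ℝ))) ^ 2 := by
    rw [← prod_pow, ← prod_mul_distrib]
    exact one_le_prod fun P hP ↦ one_le_one_sub_inv_mul_sq (h2 P hP)
  refine h1.trans (mul_le_mul_of_nonneg_left ?_ (prod_nonneg fun P hP ↦ ?_))
  · rw [mul_comm 2 n, pow_mul]
    exact pow_le_pow_left₀ (prod_nonneg fun P _ ↦ by positivity) (prod_primesLEOver_le hK hS y) 2
  · have : (2 : ℝ) ≤ Ideal.absNorm P := by exact_mod_cast h2 P hP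
    rw [sub_nonneg, div_le_one (by linarith)]
    linarith

end SquarefreeCount

section
open Finset Module Nat

set_option maxHeartbeats 1000000 in
/-- If, outside the primes above a set `S` of primes, the prime ideals of norm at most `y` of two
number fields are in a `d`-to-one norm preserving correspondence with `d ≥ 2`, and `y` exceeds a
large power of the discriminants, then `S` has many subsets with product at most `y`. -/
theorem exists_rpow_le_card_subsetsProdLE (n : ℕ) (hn : 2 ≤ n) :
    ∃ c : ℝ, 0 < c ∧ ∃ Y₀ : ℝ, ∀ (E K : Type) [Field E] [NumberField E] [Field K] [NumberField K],
      finrank ℚ E ≤ n → finrank ℚ K ≤ n → ∀ (y d : ℕ), 2 ≤ d → d ≤ n → Y₀ ≤ y →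
      absDisc E ≤ (y : ℝ) ^ c → absDisc K ≤ (y : ℝ) ^ c → ∀ S : Finset ℕ,
      (∀ p ∈ S, p.Prime ∧ p ≤ y) → ∀ f : Ideal (𝓞 K) → Ideal (𝓞 E),
      (∀ P ∈ primesLE K y \ primesLEOver K S y, f P ∈ primesLE E y \ primesLEOver E S y) →
      (∀ P ∈ primesLE K y \ primesLEOver K S y, Ideal.absNorm (f P) = Ideal.absNorm P) →
      (∀ Q ∈ primesLE E y \ primesLEOver E S y,
        {P ∈ primesLE K y \ primesLEOver K S y | f P = Q}.card = d) →
      (y : ℝ) ^ c ≤ (subsetsProdLE S y).card := by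
  classical
  obtain ⟨k, X₀, hk⟩ := exists_expClose_rieszSum n hn
  set e : ℕ := (k + 4 * n) * n + (k + 2 * n + 1) * (3 * n + 2) with he
  set c : ℝ := 1 / (n * (e + 1)) with hc
  have hn2 : (2 : ℝ) ≤ n := by exact_mod_cast hn
  have hc0 : 0 < c := by positivity
  have he8 : 8 ≤ e := by rw [he]; nlinarith
  have hc8 : c ≤ 1 / 8 := by
    have : (8 : ℝ) ≤ e := by exact_mod_cast he8
    exact one_div_le_one_div_of_le (by norm_num) (by nlinarith)
  have hce : c * e < 1 / n := by
    rw [hc, one_div_mul_eq_div, div_lt_div_iff₀ (by positivity) (by positivity)]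
    nlinarith
  set X₁ : ℝ := max (max X₀ 8) (max (1 / c) (2 ^ (n + 1) * n !)) with hX₁
  refine ⟨c, hc0, X₁ ^ (1 / c), ?_⟩
  intro E K _ _ _ _ hE hK y d hd hdn hy hDE hDK S hS f hf hfN hcard
  have hX₁0 : 0 ≤ X₁ := le_max_of_le_left (le_max_of_le_right (by norm_num))
  set X : ℝ := (y : ℝ) ^ c with hX
  have hXX : X₁ ≤ X := by
    have := Real.rpow_le_rpow (by positivity) hy hc0.le
    rwa [← Real.rpow_mul hX₁0, one_div_mul_cancel hc0.ne', Real.rpow_one] at this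
  have hX0 : X₀ ≤ X := (le_max_of_le_left (le_max_left _ _)).trans hXX
  have hX8 : 8 ≤ X := (le_max_of_le_left (le_max_right _ _)).trans hXX
  have hXc : 1 / c ≤ X := (le_max_of_le_right (le_max_left _ _)).trans hXX
  have hXn : 2 ^ (n + 1) * n ! ≤ X := (le_max_of_le_right (le_max_right _ _)).trans hXX
  have hX1 : 1 ≤ X := by linarith
  have hy0 : y ≠ 0 := by
    rintro rfl
    rw [hX, Nat.cast_zero, Real.zero_rpow hc0.ne'] at hX8
    norm_num at hX8
  have hy0' : (0 : ℝ) < y := by positivity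
  have hlog : Real.log X = c * Real.log y := Real.log_rpow hy0' c
  have hy1 : (1 : ℝ) < y := by
    by_contra hle
    have : X ≤ 1 := Real.rpow_le_one hy0'.le (not_lt.mp hle) hc0.le
    linarith
  by_contra! hlt
  set W := ∏ p ∈ S, (1 + (p : ℝ) ^ (-(1 / 2) : ℝ)) with hW
  have hW0 : 0 ≤ W := prod_nonneg fun p _ ↦ by positivity
  have hWX : W ≤ X ^ 2 := by
    refine (prod_one_add_le_of_card_le (fun p hp ↦ ⟨(hS p hp).1.two_le, (hS p hp).2⟩)
      (Nat.one_le_iff_ne_zero.mpr hy0) ?_).trans (by nlinarith)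
    calc 2 * ((subsetsProdLE S y).card : ℝ) ≤ X ^ 2 := by nlinarith
      _ = (y : ℝ) ^ (c * 2) := by rw [hX, ← Real.rpow_natCast, ← Real.rpow_mul hy0'.le]; norm_num
      _ ≤ _ := Real.rpow_le_rpow_of_exponent_le hy1.le (by linarith)
  have hSp : ∀ p ∈ S, p.Prime := fun p hp ↦ (hS p hp).1
  have hexp : Real.exp (1 / (n : ℝ)) ≤ 2 := by
    have h1 : 1 / (n : ℝ) ≤ 1 / 2 := one_div_le_one_div_of_le two_pos hn2
    have h2 := Real.exp_bound_div_one_sub_of_interval (by positivity : 0 ≤ 1 / (n : ℝ))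
      (by linarith)
    refine h2.trans ?_
    rw [div_le_iff₀ (by linarith)]
    linarith
  have key : ∀ (F : Type) [Field F] [NumberField F], finrank ℚ F ≤ n → absDisc F ≤ X →
      ∃ M B : ℝ, 0 < M ∧ 1 ≤ M * X ^ (k + 4 * n) ∧
        2 * (M + B) * Real.exp (1 / (n : ℝ)) ≤ X ^ (k + 2 * n + 1) ∧
        ExpClose (Real.log y) (1 / (n : ℝ)) M B (rieszSum (idealCount F *
          ∏ P ∈ primesLEOver F S y, (1 - arithSingle (Ideal.absNorm P)))
            (rieszKernel (Units.rank F))) := by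
    intro F _ _ hF hDF
    obtain ⟨M, B, hM, hMB, hMX, hBX, h⟩ := hk F hF X hX0 hDF
    have h2 : ∀ P ∈ primesLEOver F S y, 2 ≤ Ideal.absNorm P := fun P hP ↦ by
      have := mem_primesLE.mp (mem_primesLEOver.mp hP).1
      exact two_le_absNorm_of_isPrime P this.1 this.2.1
    set V := ∏ P ∈ primesLEOver F S y, (1 - 1 / (Ideal.absNorm P : ℝ)) with hV
    have h2' : ∀ P ∈ primesLEOver F S y, 0 < 1 - 1 / (Ideal.absNorm P : ℝ) := fun P hP ↦ by
      have : (2 : ℝ) ≤ Ideal.absNorm P := by exact_mod_cast h2 P hP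
      rw [sub_pos, div_lt_one (by linarith)]
      linarith
    have hV0 : 0 < V := prod_pos h2'
    have hV1 : V ≤ 1 := prod_le_one (fun P hP ↦ (h2' P hP).le) fun P _ ↦ by
      simp
    have hB0 : 0 < B := hM.trans_le hMB
    refine ⟨M * V, B * ∏ P ∈ primesLEOver F S y, (1 + (Ideal.absNorm P : ℝ) ^ (-(1 / 2) : ℝ)),
      by positivity, ?_, ?_, (h (Real.log y)).rieszSum_mul_prod (isCausal_rieszKernel _)
        (by positivity) (one_div_le_one_div_of_le two_pos hn2) hM.le hMB _ _ h2⟩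
    · have h3 : 1 ≤ V * X ^ (4 * n) :=
        (one_le_prod_mul_pow hF hSp y).trans (mul_le_mul_of_nonneg_left (by
          calc W ^ (2 * n) ≤ (X ^ 2) ^ (2 * n) := pow_le_pow_left₀ hW0 hWX _
            _ = X ^ (4 * n) := by rw [← pow_mul]; congr 1; ring) hV0.le)
      calc (1 : ℝ) ≤ (M * X ^ k) * (V * X ^ (4 * n)) := one_le_mul_of_one_le_of_one_le hMX h3
        _ = _ := by ring
    · have h4 : B * ∏ P ∈ primesLEOver F S y, (1 + (Ideal.absNorm P : ℝ) ^ (-(1 / 2) : ℝ)) ≤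
          X ^ (k + 2 * n) := by
        rw [pow_add, pow_mul]
        refine mul_le_mul hBX ((prod_primesLEOver_le hF hSp y).trans ?_)
          (prod_nonneg fun P _ ↦ by positivity) (by positivity)
        exact pow_le_pow_left₀ hW0 hWX _
      have h5 : M * V ≤ X ^ (k + 2 * n) :=
        (mul_le_of_le_one_right hM.le hV1).trans ((hMB.trans hBX).trans
          (pow_le_pow_right₀ hX1 (by omega)))
      have h0 : 0 ≤ X ^ (k + 2 * n) := by positivity
      calc _ ≤ 2 * (X ^ (k + 2 * n) + X ^ (k + 2 * n)) * 2 :=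
            mul_le_mul (by linarith) hexp (by positivity) (by positivity)
        _ = 8 * X ^ (k + 2 * n) := by ring
        _ ≤ X ^ (k + 2 * n + 1) := by rw [_root_.pow_succ']; exact mul_le_mul_of_nonneg_right hX8 h0
  obtain ⟨M, B, hM, hM1, hMB, hFM⟩ := key E hE hDE
  obtain ⟨M', B', hM', -, hMB', hFM'⟩ := key K hK hDK
  set a := idealCount E * ∏ P ∈ primesLEOver E S y, (1 - arithSingle (Ideal.absNorm P)) with ha
  set b := idealCount K * ∏ P ∈ primesLEOver K S y, (1 - arithSingle (Ideal.absNorm P)) with hb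
  have hη : 1 / (n : ℝ) ≤ 1 / 2 := one_div_le_one_div_of_le two_pos hn2
  have hQ : X ≤ X ^ (k + 2 * n + 1) := le_self_pow₀ hX1 (by omega)
  have hfac : ∀ (F : Type) [Field F] [NumberField F], finrank ℚ F ≤ n →
      (2 : ℝ) ^ (Units.rank F + 1) * (Units.rank F) ! ≤ X := fun F _ _ hF ↦ by
    refine le_trans ?_ hXn
    have h1 := (rank_le_finrank F).trans hF
    have h2 : (((Units.rank F) ! : ℕ) : ℝ) ≤ (n ! : ℕ) := by
      exact_mod_cast Nat.factorial_le h1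
    exact mul_le_mul (pow_le_pow_right₀ one_le_two (by omega)) h2 (by positivity) (by positivity)
  have hfac' : ∀ r : ℕ, (2 : ℝ) ^ r * r ! ≤ 2 ^ (r + 1) * r ! := fun r ↦ by
    rw [pow_succ]
    have : (0 : ℝ) ≤ 2 ^ r * r ! := by positivity
    nlinarith
  have hfac'' : ∀ r : ℕ, (r ! : ℝ) ≤ 2 ^ (r + 1) * r ! := fun r ↦ by
    exact le_mul_of_one_le_left (by positivity) (one_le_pow₀ one_le_two)
  have hmain := mul_pow_le_of_iterate_lineConv_eq (F := rieszSum a (rieszKernel (Units.rank E)))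
    (F' := rieszSum b (rieszKernel (Units.rank K))) (Q := X ^ (k + 2 * n + 1)) hd
    (Real.log_pos hy1) (by positivity) (isCausal_rieszSum (isCausal_rieszKernel _) a)
    (isCausal_rieszSum (isCausal_rieszKernel _) b) (isCausal_rieszKernel (Units.rank E))
    (isCausal_rieszKernel (Units.rank K)) hM.le hM'.le (Nat.cast_nonneg (Units.rank K) !) hFM hFM'
    (expClose_rieszKernel _ hη) (expClose_rieszKernel _ hη)
    (fun T hT _ ↦ abs_integral_rieszKernel_sub_le _ hη hT) (fun T hT ↦ ?_) (by linarith) ?_ hMB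
    hMB' ?_ (((hfac' _).trans (hfac E hE)).trans hQ) (((hfac' _).trans (hfac K hK)).trans hQ)
    (((hfac'' _).trans (hfac K hK)).trans hQ) ((hfac K hK).trans hQ)
  · set Q := X ^ (k + 2 * n + 1) with hQdef
    have hMd : 1 ≤ M ^ d * X ^ ((k + 4 * n) * d) := by
      rw [pow_mul, ← mul_pow]
      exact one_le_pow₀ hM1
    have hr1 : (1 : ℝ) ≤ ((Units.rank K) ! : ℕ) := by exact_mod_cast Nat.factorial_pos _
    have h1 : M ^ d ≤ Q ^ (3 * d + 2) * Real.exp (-(1 / (n : ℝ) * Real.log y)) :=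
      (le_mul_of_one_le_left (by positivity) hr1).trans hmain
    have h2 : 1 ≤ X ^ e * Real.exp (-(1 / (n : ℝ) * Real.log y)) := by
      calc 1 ≤ M ^ d * X ^ ((k + 4 * n) * d) := hMd
        _ ≤ (Q ^ (3 * d + 2) * Real.exp (-(1 / (n : ℝ) * Real.log y))) * X ^ ((k + 4 * n) * d) :=
          mul_le_mul_of_nonneg_right h1 (by positivity)
        _ = X ^ ((k + 4 * n) * d + (k + 2 * n + 1) * (3 * d + 2)) *
            Real.exp (-(1 / (n : ℝ) * Real.log y)) := by rw [hQdef]; ring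
        _ ≤ _ := by
          refine mul_le_mul_of_nonneg_right (pow_le_pow_right₀ hX1 ?_) (Real.exp_pos _).le
          rw [he]
          gcongr
    have hXe : X ^ e = Real.exp (c * e * Real.log y) := by
      rw [hX, ← Real.rpow_natCast, ← Real.rpow_mul hy0'.le, Real.rpow_def_of_pos hy0', mul_comm]
    rw [hXe, ← Real.exp_add, Real.one_le_exp_iff] at h2
    linarith [mul_lt_mul_of_pos_right hce (Real.log_pos hy1)]
  · rw [iterate_lineConv_rieszSum_self (isCausal_rieszKernel _) (isCausal_rieszKernel _),
      iterate_lineConv_rieszSum (isCausal_rieszKernel _) (isCausal_rieszKernel _)]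
    refine (rieszSum_congr (idealCount_sub_pow_mem y d _ _ (primesLEOver_subset S y)
      (primesLEOver_subset S y) f hf hfN hcard) ?_).symm
    rwa [← Real.le_log_iff_exp_le hy0']
  · refine le_trans ?_ ((by nlinarith : (1 / c) * X ≤ X ^ 2).trans
      (pow_le_pow_right₀ hX1 (by omega)))
    have : Real.log X ≤ X := (Real.log_le_sub_one_of_pos (by linarith)).trans (by linarith)
    rw [hlog] at this
    rw [one_div_mul_eq_div, le_div_iff₀ hc0]
    linarith
  · linarith

end

section SubsetCount

open Finset

theorem subsetsProdLE_union_card_le {S T : Finset ℕ} {y : ℕ} (hT : ∀ p ∈ S ∪ T, 1 ≤ p) :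
    (subsetsProdLE (S ∪ T) y).card ≤ (subsetsProdLE S y).card * (subsetsProdLE T y).card := by
  classical
  rw [← card_product]
  refine card_le_card_of_injOn (fun A ↦ (A ∩ S, A ∩ T)) (fun A hA ↦ ?_) fun A hA B hB h ↦ ?_
  · obtain ⟨hAS, hAy⟩ := mem_subsetsProdLE.mp hA
    have hle : ∀ B ⊆ A, ∏ p ∈ B, p ≤ y := fun B hB ↦
      (prod_le_prod_of_subset_of_one_le' hB fun p hp _ ↦ hT p (hAS hp)).trans hAy
    rw [mem_coe, mem_product, mem_subsetsProdLE, mem_subsetsProdLE]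
    exact ⟨⟨inter_subset_right, hle _ inter_subset_left⟩,
      ⟨inter_subset_right, hle _ inter_subset_left⟩⟩
  · have hA' := (mem_subsetsProdLE.mp hA).1
    have hB' := (mem_subsetsProdLE.mp hB).1
    simp only [Prod.mk.injEq] at h
    rw [← inter_eq_left.mpr hA', ← inter_eq_left.mpr hB', inter_union_distrib_left,
      inter_union_distrib_left, h.1, h.2]

theorem card_subsetsProdLE_le_prod {S : Finset ℕ} {y : ℕ} (hS : ∀ p ∈ S, 1 ≤ p) {ε : ℝ}
    (hε : 0 ≤ ε) :
    ((subsetsProdLE S y).card : ℝ) ≤ (y : ℝ) ^ ε * ∏ p ∈ S, (1 + (p : ℝ) ^ (-ε)) := by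
  classical
  rw [prod_one_add, mul_sum]
  calc ((subsetsProdLE S y).card : ℝ) = ∑ T ∈ subsetsProdLE S y, 1 := by simp
    _ ≤ ∑ T ∈ subsetsProdLE S y, (y : ℝ) ^ ε * ∏ p ∈ T, (p : ℝ) ^ (-ε) := by
      refine sum_le_sum fun T hT ↦ ?_
      obtain ⟨hTS, hTy⟩ := mem_subsetsProdLE.mp hT
      have h0 : (0 : ℝ) < ((∏ p ∈ T, p : ℕ) : ℝ) := by
        exact_mod_cast prod_pos fun p hp ↦ hS p (hTS hp)
      rw [Real.finsetProd_rpow _ _ fun i _ ↦ by positivity, ← Nat.cast_prod, Real.rpow_neg h0.le,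
        ← div_eq_mul_inv, one_le_div (by positivity)]
      exact Real.rpow_le_rpow h0.le (by exact_mod_cast hTy) hε
    _ ≤ _ := sum_le_sum_of_subset_of_nonneg (filter_subset _ _) fun T _ _ ↦ by positivity

/-- The number of subsets with product at most `y` of a set of integers greater than one whose
product is at most `D`. -/
theorem exists_card_subsetsProdLE_le_rpow (ε : ℝ) (hε : 0 < ε) :
    ∃ C : ℝ, 0 < C ∧ ∀ (S : Finset ℕ) (D : ℝ) (y : ℕ), (∀ p ∈ S, 2 ≤ p) →
      ((∏ p ∈ S, p : ℕ) : ℝ) ≤ D → ((subsetsProdLE S y).card : ℝ) ≤ C * (y : ℝ) ^ ε * D ^ ε := by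
  classical
  have h2 : 0 < (2 : ℝ) ^ ε - 1 := sub_pos.mpr (Real.one_lt_rpow one_lt_two hε)
  obtain ⟨N, hN⟩ : ∃ N : ℕ, ∀ p : ℕ, N ≤ p → (p : ℝ) ^ (-ε) ≤ 2 ^ ε - 1 :=
    Filter.eventually_atTop.mp
      (((tendsto_rpow_neg_atTop hε).comp tendsto_natCast_atTop_atTop).eventually_le_const h2)
  refine ⟨2 ^ N, by positivity, fun S D y hS hD ↦ ?_⟩
  refine (card_subsetsProdLE_le_prod (fun p hp ↦ by have := hS p hp; omega) hε.le).trans ?_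
  rw [mul_comm (2 ^ N) ((y : ℝ) ^ ε), mul_assoc]
  refine mul_le_mul_of_nonneg_left ?_ (by positivity)
  have hcard : (2 : ℝ) ^ S.card ≤ D :=
    le_trans (by exact_mod_cast pow_card_le_prod S (fun p ↦ p) 2 hS) hD
  have hD0 : 0 ≤ D := le_trans (by positivity) hcard
  rw [← prod_filter_mul_prod_filter_not S (· < N)]
  refine mul_le_mul ?_ ?_ (prod_nonneg fun p _ ↦ by positivity) (by positivity)
  · calc ∏ p ∈ S with p < N, (1 + (p : ℝ) ^ (-ε)) ≤ ∏ p ∈ S with p < N, (2 : ℝ) := by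
          refine prod_le_prod (fun p _ ↦ by positivity) fun p hp ↦ ?_
          have : (1 : ℝ) ≤ p := by
            exact_mod_cast one_le_two.trans (hS p (filter_subset _ _ hp))
          linarith [Real.rpow_le_one_of_one_le_of_nonpos this (neg_nonpos.mpr hε.le)]
      _ ≤ 2 ^ N := by
          rw [prod_const]
          refine pow_le_pow_right₀ one_le_two ?_
          refine (card_le_card fun p hp ↦ ?_).trans_eq (card_range N)
          exact mem_range.mpr (mem_filter.mp hp).2
  · calc ∏ p ∈ S with ¬ p < N, (1 + (p : ℝ) ^ (-ε)) ≤ ∏ p ∈ S with ¬ p < N, (2 : ℝ) ^ ε := by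
          refine prod_le_prod (fun p _ ↦ by positivity) fun p hp ↦ ?_
          linarith [hN p (not_lt.mp (mem_filter.mp hp).2)]
      _ ≤ ((2 : ℝ) ^ ε) ^ S.card := by
          rw [prod_const]
          exact pow_le_pow_right₀ (by linarith) (card_filter_le _ _)
      _ = ((2 : ℝ) ^ S.card) ^ ε := by
          rw [← Real.rpow_natCast, ← Real.rpow_natCast, ← Real.rpow_mul zero_le_two,
            ← Real.rpow_mul zero_le_two, mul_comm]
      _ ≤ D ^ ε := Real.rpow_le_rpow (by positivity) hcard hε.le

end SubsetCount

section Groups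

open Subgroup

variable {Γ : Type*} [Group Γ] [Finite Γ]

/-- If `M` is a minimal normal subgroup contained in some cyclic subgroup, and some coset of `M`
consists of elements generating subgroups meeting `M` trivially, then there are subgroups
`M ≤ B < A` such that each cyclic subgroup containing `M` meets `A` inside `B`. -/
theorem exists_lt_of_le_zpowers {M : Subgroup Γ} [M.Normal] (hM : M ≠ ⊥)
    (hmin : ∀ N : Subgroup Γ, N.Normal → N ≤ M → N = ⊥ ∨ N = M) {g : Γ}
    (hg : ∀ m ∈ M, zpowers (g * m) ⊓ M = ⊥) {h₀ : Γ} (hh₀ : M ≤ zpowers h₀) :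
    ∃ A B : Subgroup Γ, M ≤ B ∧ B < A ∧ ∀ h, M ≤ zpowers h → A ⊓ zpowers h ≤ B := by
  by_cases hc : M ≤ center Γ
  · have hnt : Nat.card M ≠ 1 := fun h ↦ hM (card_eq_one.mp h)
    obtain ⟨q, hq, hqM⟩ := Nat.exists_prime_and_dvd hnt
    have := Fact.mk hq
    obtain ⟨⟨m, hm⟩, hmq⟩ := exists_prime_orderOf_dvd_card' q hqM
    rw [orderOf_mk] at hmq
    have hmM : zpowers m = M := by
      refine (hmin (zpowers m) ⟨fun x hx y ↦ ?_⟩ (zpowers_le.mpr hm)).resolve_left fun h ↦ ?_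
      · have := mem_center_iff.mp (hc ((zpowers_le.mpr hm) hx)) y
        rwa [this, mul_inv_cancel_right]
      · rw [zpowers_eq_bot] at h
        rw [h, orderOf_one] at hmq
        exact hq.one_lt.ne hmq
    have hcomm : ∀ a ∈ M, ∀ b, Commute a b := fun a ha b ↦ (mem_center_iff.mp (hc ha) b).symm
    have hqr : q ∣ orderOf g := by
      rw [← hmq, orderOf_dvd_iff_pow_eq_one]
      have h1 : (g * m) ^ orderOf g = m ^ orderOf g := by
        rw [(hcomm m hm g).symm.mul_pow, pow_orderOf_eq_one, one_mul]
      have h2 : m ^ orderOf g ∈ zpowers (g * m) ⊓ M :=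
        ⟨h1 ▸ pow_mem (mem_zpowers _) _, pow_mem hm _⟩
      rwa [hg m hm, mem_bot] at h2
    have hr : orderOf g ≠ 0 := (orderOf_pos g).ne'
    set x := g ^ (orderOf g / q) with hx
    have hxq : orderOf x = q := by
      rw [hx, orderOf_pow_of_dvd (Nat.div_pos (Nat.le_of_dvd (orderOf_pos g) hqr) hq.pos).ne'
        (Nat.div_dvd_of_dvd hqr), Nat.div_div_self hqr hr]
    have hxM : x ∉ M := fun h ↦ by
      have h2 : x ∈ zpowers (g * 1) ⊓ M := ⟨by rw [mul_one]; exact pow_mem (mem_zpowers g) _, h⟩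
      rw [hg 1 (one_mem M), mem_bot] at h2
      rw [h2, orderOf_one] at hxq
      exact hq.one_lt.ne hxq
    refine ⟨M ⊔ zpowers x, M, le_rfl, lt_of_le_of_ne le_sup_left fun h ↦ hxM ?_, ?_⟩
    · rw [h]
      exact mem_sup_right (mem_zpowers x)
    rintro h hh z ⟨hzA, hzh⟩
    have hzq : z ^ q = 1 := by
      obtain ⟨a, ha, b, hb, rfl⟩ := mem_sup_of_normal_left.mp hzA
      rw [(hcomm a ha b).mul_pow]
      obtain ⟨j, rfl⟩ := mem_zpowers_iff.mp hb
      rw [← hmM] at ha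
      obtain ⟨i, rfl⟩ := mem_zpowers_iff.mp ha
      rw [← zpow_natCast, ← zpow_natCast, ← zpow_mul, ← zpow_mul, mul_comm i, mul_comm j, zpow_mul,
        zpow_mul, zpow_natCast, zpow_natCast, ← hmq, pow_orderOf_eq_one, one_zpow, hmq, ← hxq,
        pow_orderOf_eq_one, one_zpow, one_mul]
    classical
    have := Fintype.ofFinite (zpowers h)
    have hle := IsCyclic.card_pow_eq_one_le (α := zpowers h) hq.pos
    have hsub : Finset.univ.filter (fun w : zpowers h ↦ (w : Γ) ∈ M) ⊆
        Finset.univ.filter (fun w : zpowers h ↦ w ^ q = 1) := fun w hw ↦ by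
      simp only [Finset.mem_filter, Finset.mem_univ, true_and] at hw ⊢
      rw [← hmM] at hw
      obtain ⟨i, hi⟩ := mem_zpowers_iff.mp hw
      rw [Subtype.ext_iff, coe_pow, ← hi, ← zpow_natCast, ← zpow_mul, mul_comm, zpow_mul,
        zpow_natCast, ← hmq, pow_orderOf_eq_one, one_zpow, coe_one]
    have hcardM : (Finset.univ.filter (fun w : zpowers h ↦ (w : Γ) ∈ M)).card = q := by
      rw [← hmq, ← Nat.card_zpowers, hmM, ← Fintype.card_subtype, ← Nat.card_eq_fintype_card]
      exact Nat.card_congr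
        ⟨fun w ↦ ⟨w.1.1, w.2⟩, fun w ↦ ⟨⟨w.1, hh w.2⟩, w.2⟩, fun _ ↦ rfl, fun _ ↦ rfl⟩
    have heq := Finset.eq_of_subset_of_card_le hsub (hle.trans_eq hcardM.symm)
    have hz : (⟨z, hzh⟩ : zpowers h) ∈ Finset.univ.filter (fun w : zpowers h ↦ w ^ q = 1) := by
      simpa [Subtype.ext_iff] using hzq
    rw [← heq] at hz
    simpa using hz
  · refine ⟨⊤, centralizer (M : Set Γ), fun m hm ↦ ?_, lt_top_iff_ne_top.mpr fun h ↦ hc ?_,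
      fun h hh x hx ↦ ?_⟩
    · rw [mem_centralizer_iff]
      intro x hx
      obtain ⟨i, rfl⟩ := mem_zpowers_iff.mp (hh₀ hm)
      obtain ⟨j, rfl⟩ := mem_zpowers_iff.mp (hh₀ hx)
      exact zpow_mul_comm _ _ _
    · intro m hm
      rw [mem_center_iff]
      intro x
      have : x ∈ centralizer (M : Set Γ) := h ▸ mem_top x
      exact (mem_centralizer_iff.mp this m hm).symm
    · rw [mem_centralizer_iff]
      intro m hm
      obtain ⟨i, rfl⟩ := mem_zpowers_iff.mp hx.2
      obtain ⟨j, rfl⟩ := mem_zpowers_iff.mp (hh hm)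
      exact zpow_mul_comm _ _ _

end Groups

section Decomposition

open Ideal Module
open scoped Pointwise

theorem perfectField_residueField {K : Type} [Field K] [NumberField K] {p : Ideal (𝓞 K)}
    [p.IsPrime] (hp : p ≠ ⊥) : PerfectField p.ResidueField := by
  have : Finite (𝓞 K ⧸ p) := p.finiteQuotientOfFreeOfNeBot hp
  infer_instance

theorem exists_stabilizer_eq_zpowers {L : Type} [Field L] [NumberField L] [IsGalois ℚ L] {p : ℕ}
    (hp : p.Prime) (hpd : ¬ (p : ℤ) ∣ discr L) (P : Ideal (𝓞 L)) [P.IsPrime]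
    (hpP : (p : 𝓞 L) ∈ P) :
    ∃ h : L ≃ₐ[ℚ] L, MulAction.stabilizer (L ≃ₐ[ℚ] L) P = Subgroup.zpowers h := by
  have hP0 : P ≠ ⊥ := by
    rintro rfl
    exact hp.ne_zero (by simpa using hpP)
  have hu := (not_dvd_discr_iff_forall_mem L (𝓞 L) (Nat.prime_iff_prime_int.mp hp)).mp hpd P ‹_›
    (by exact_mod_cast hpP)
  have : Finite (𝓞 L ⧸ P) := P.finiteQuotientOfFreeOfNeBot hP0
  have : Finite (ℤ ⧸ P.under ℤ) := by
    refine Finite.of_injective (algebraMap (ℤ ⧸ P.under ℤ) (𝓞 L ⧸ P)) ?_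
    exact FaithfulSMul.algebraMap_injective _ _
  have : PerfectField (P.under ℤ).ResidueField := inferInstance
  have hc := card_inertia_eq_ramificationIdxIn (G := L ≃ₐ[ℚ] L) (P.under ℤ) P
  rw [ramificationIdxIn_eq_ramificationIdx (P.under ℤ) P (L ≃ₐ[ℚ] L),
    ramificationIdx_eq_one_of_isUnramifiedAt] at hc
  have hinj : Function.Injective (Ideal.Quotient.stabilizerHom P (P.under ℤ) (L ≃ₐ[ℚ] L)) := by
    rw [← MonoidHom.ker_eq_bot_iff,
      ← Subgroup.map_eq_bot_iff_of_injective _ (Subgroup.subtype_injective _),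
      Ideal.Quotient.map_ker_stabilizer_subtype]
    exact Subgroup.eq_bot_of_card_eq _ hc
  have : IsCyclic ((𝓞 L ⧸ P) ≃ₐ[ℤ ⧸ P.under ℤ] (𝓞 L ⧸ P)) := by
    have : P.IsMaximal := ‹P.IsPrime›.isMaximal hP0
    have : (P.under ℤ).IsMaximal := inferInstance
    let := Ideal.Quotient.field P
    let := Ideal.Quotient.field (P.under ℤ)
    infer_instance
  have : IsCyclic (MulAction.stabilizer (L ≃ₐ[ℚ] L) P) := isCyclic_of_injective _ hinj
  obtain ⟨h, hh⟩ := IsCyclic.exists_zpow_surjective (G := MulAction.stabilizer (L ≃ₐ[ℚ] L) P)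
  refine ⟨h, le_antisymm (fun x hx ↦ ?_) ?_⟩
  · obtain ⟨k, hk⟩ := hh ⟨x, hx⟩
    exact ⟨k, by simpa using congrArg Subtype.val hk⟩
  · rw [Subgroup.zpowers_le]
    exact h.2

theorem ramificationIdx_mul_inertiaDeg_eq_one {E K L : Type} [Field E] [NumberField E] [Field K]
    [NumberField K] [Field L] [NumberField L] [Algebra E K] [Algebra K L] [Algebra E L]
    [IsScalarTower E K L] {A B : Type} [Group A] [Group B] [Finite A] [Finite B]
    [MulSemiringAction A L] [MulSemiringAction B L] [IsGaloisGroup A E L] [IsGaloisGroup B K L]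
    {P : Ideal (𝓞 L)} [P.IsPrime] (hP : P ≠ ⊥)
    (h : Nat.card (MulAction.stabilizer A P) = Nat.card (MulAction.stabilizer B P)) :
    (P.under (𝓞 K)).ramificationIdx (𝓞 E) * (P.under (𝓞 K)).inertiaDeg (𝓞 E) = 1 := by
  have h1 : P.under (𝓞 K) ≠ ⊥ := under_ne_bot _ hP
  have h2 : P.under (𝓞 E) ≠ ⊥ := under_ne_bot _ hP
  have := perfectField_residueField h1
  have := perfectField_residueField h2
  rw [card_stabilizer_eq (P.under (𝓞 E)), card_stabilizer_eq (P.under (𝓞 K)),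
    ramificationIdxIn_eq_ramificationIdx _ P A, ramificationIdxIn_eq_ramificationIdx _ P B,
    inertiaDegIn_eq_inertiaDeg _ P A, inertiaDegIn_eq_inertiaDeg _ P B,
    ramificationIdx_tower (P.under (𝓞 K)) P, inertiaDeg_tower (P.under (𝓞 K)) P] at h
  have h3 := P.ramificationIdx_pos (𝓞 K)
  have h4 := P.inertiaDeg_pos (𝓞 K)
  refine Nat.eq_of_mul_eq_mul_right (Nat.mul_pos h3 h4) ?_
  linarith

theorem exists_liesOver_under_eq {K L : Type} [Field K] [NumberField K] [Field L] [NumberField L]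
    [Algebra K L] (P : Ideal (𝓞 K)) [P.IsPrime] :
    ∃ Q : Ideal (𝓞 L), Q.IsPrime ∧ Q.under (𝓞 K) = P := by
  rcases eq_or_ne P ⊥ with rfl | hP
  · exact ⟨⊥, isPrime_bot, by simp [Ideal.under, Ideal.comap_bot_of_injective _
      (FaithfulSMul.algebraMap_injective (𝓞 K) (𝓞 L))]⟩
  have := ‹P.IsPrime›.isMaximal hP
  obtain ⟨Q, hQ, hQP⟩ := exists_maximal_ideal_liesOver_of_isIntegral (S := 𝓞 L) P
  exact ⟨Q, hQ.isPrime, hQP.over.symm⟩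

theorem absNorm_eq_of_inertiaDeg_eq_one {E K : Type} [Field E] [NumberField E] [Field K]
    [NumberField K] [Algebra E K] {P : Ideal (𝓞 K)} [P.IsPrime]
    (h : P.inertiaDeg (𝓞 E) = 1) : absNorm P = absNorm (P.under (𝓞 E)) := by
  have h1 := (P.under (𝓞 E)).absNorm_pow_inertiaDeg P
  rw [h, pow_one] at h1
  exact h1.symm

theorem card_primesOver_eq_finrank {E K : Type} [Field E] [NumberField E] [Field K]
    [NumberField K] [Algebra E K] {Q : Ideal (𝓞 E)} [Q.IsPrime] (hQ : Q ≠ ⊥)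
    (h : ∀ P : Ideal (𝓞 K), P.IsPrime → P.under (𝓞 E) = Q →
      P.ramificationIdx (𝓞 E) * P.inertiaDeg (𝓞 E) = 1) :
    {P : Ideal (𝓞 K) | P.IsPrime ∧ P.under (𝓞 E) = Q}.ncard = finrank E K := by
  have := ‹Q.IsPrime›.isMaximal hQ
  let : Fintype (Q.primesOver (𝓞 K)) := (IsDedekindDomain.primesOver_finite Q (𝓞 K)).fintype
  have h1 := sum_ramification_inertia_eq_finrank Q (𝓞 K)
  rw [Finset.sum_congr rfl fun P _ ↦ h P.1 P.2.1 P.2.2.over.symm] at h1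
  have h2 : finrank (𝓞 E) (𝓞 K) = finrank E K := (IsFractionRing.finrank_eq (𝓞 E) E (𝓞 K) K).symm
  rw [Finset.sum_const, smul_eq_mul, mul_one, Finset.card_univ, h2, Set.fintypeCard_eq_ncard] at h1
  rw [← h1]
  congr 1
  ext P
  exact ⟨fun h ↦ ⟨h.1, ⟨h.2.symm⟩⟩, fun h ↦ ⟨h.1, h.2.over.symm⟩⟩
end Decomposition

section GoodPrimes

open Ideal Module
open scoped Pointwise

theorem card_stabilizer_subgroup {L : Type} [Field L] [NumberField L] (A : Subgroup (L ≃ₐ[ℚ] L))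
    (P : Ideal (𝓞 L)) :
    Nat.card (MulAction.stabilizer A P) =
      Nat.card ↥(A ⊓ MulAction.stabilizer (L ≃ₐ[ℚ] L) P : Subgroup (L ≃ₐ[ℚ] L)) :=
  Nat.card_congr
    { toFun := fun a ↦ ⟨a.1.1, a.1.2, a.2⟩
      invFun := fun a ↦ ⟨⟨a.1, a.2.1⟩, a.2.2⟩
      left_inv := fun _ ↦ rfl
      right_inv := fun _ ↦ rfl }

/-- The primes up to `y` above which some prime ideal is moved by `M`. -/
noncomputable def movedPrimes {L : Type} [Field L] [NumberField L] (M : Subgroup (L ≃ₐ[ℚ] L))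
    (y : ℕ) : Finset ℕ :=
  open Classical in (Finset.range (y + 1)).filter fun p ↦ p.Prime ∧
    ∃ P : Ideal (𝓞 L), P.IsPrime ∧ (p : 𝓞 L) ∈ P ∧ ¬ M ≤ MulAction.stabilizer (L ≃ₐ[ℚ] L) P

theorem mem_movedPrimes {L : Type} [Field L] [NumberField L] {M : Subgroup (L ≃ₐ[ℚ] L)}
    {y p : ℕ} : p ∈ movedPrimes M y ↔ p ≤ y ∧ p.Prime ∧
    ∃ P : Ideal (𝓞 L), P.IsPrime ∧ (p : 𝓞 L) ∈ P ∧
      ¬ M ≤ MulAction.stabilizer (L ≃ₐ[ℚ] L) P := by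
  simp [movedPrimes]

/-- The primes up to `y` that divide the discriminant. -/
noncomputable def discrPrimes (L : Type) [Field L] [NumberField L] (y : ℕ) : Finset ℕ :=
  (Finset.range (y + 1)).filter fun p ↦ p.Prime ∧ (p : ℤ) ∣ discr L

theorem mem_discrPrimes {L : Type} [Field L] [NumberField L] {y p : ℕ} :
    p ∈ discrPrimes L y ↔ p ≤ y ∧ p.Prime ∧ (p : ℤ) ∣ discr L := by
  simp [discrPrimes]

theorem exists_prime_mem {K : Type} [Field K] [NumberField K] {P : Ideal (𝓞 K)} (hP : P.IsPrime)
    (hP0 : P ≠ ⊥) : ∃ p : ℕ, p.Prime ∧ (p : 𝓞 K) ∈ P ∧ p ≤ absNorm P := by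
  have h0 : absNorm P ≠ 0 := fun h ↦ hP0 (absNorm_eq_zero_iff.mp h)
  have h1 : absNorm P ≠ 1 := fun h ↦ hP.ne_top (absNorm_eq_one_iff.mp h)
  have h2 : ((absNorm P : ℕ) : 𝓞 K) ∈ P := absNorm_mem P
  have h3 : (((absNorm P).primeFactorsList : Multiset ℕ).map (fun p : ℕ ↦ (p : 𝓞 K))).prod ∈ P := by
    rw [← Nat.prod_primeFactorsList h0] at h2
    simpa [Nat.cast_list_prod] using h2
  obtain ⟨x, hx, hxP⟩ := (hP.multiset_prod_mem_iff_exists_mem _).mp h3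
  obtain ⟨p, hp, rfl⟩ := Multiset.mem_map.mp hx
  rw [Multiset.mem_coe] at hp
  exact ⟨p, Nat.prime_of_mem_primeFactorsList hp, hxP, Nat.le_of_mem_primeFactorsList hp⟩

theorem absDisc_le_of_algebra {K L : Type} [Field K] [NumberField K] [Field L] [NumberField L]
    [Algebra K L] : absDisc K ≤ absDisc L := by
  have h := Int.le_of_dvd (abs_pos.mpr (discr_ne_zero L)) ((abs_dvd_abs _ _).mpr
    (discr_dvd_discr K L))
  rw [absDisc, absDisc]
  exact_mod_cast h

theorem mem_primesLE_sdiff {K : Type} [Field K] [NumberField K] [DecidableEq (Ideal (𝓞 K))]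
    {S : Finset ℕ} {y : ℕ} {P : Ideal (𝓞 K)} :
    P ∈ primesLE K y \ primesLEOver K S y ↔
      P.IsPrime ∧ P ≠ ⊥ ∧ absNorm P ≤ y ∧ ∀ p ∈ S, (p : 𝓞 K) ∉ P := by
  rw [Finset.mem_sdiff, mem_primesLEOver, mem_primesLE]
  grind

theorem exists_prime_notMem_of_mem_sdiff {K : Type} [Field K] [NumberField K]
    [DecidableEq (Ideal (𝓞 K))] {S : Finset ℕ} {y : ℕ} {P : Ideal (𝓞 K)}
    (hP : P ∈ primesLE K y \ primesLEOver K S y) :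
    ∃ p : ℕ, p.Prime ∧ p ≤ y ∧ p ∉ S ∧ (p : 𝓞 K) ∈ P := by
  obtain ⟨h1, h2, h3, h4⟩ := mem_primesLE_sdiff.mp hP
  obtain ⟨p, hp, hpP, hpn⟩ := exists_prime_mem h1 h2
  exact ⟨p, hp, hpn.trans h3, fun h ↦ h4 p h hpP, hpP⟩

theorem exists_rpow_le_card_movedPrimes_union (n : ℕ) (hn : 2 ≤ n) : ∃ c : ℝ, 0 < c ∧ ∃ Y₀ : ℝ,
    ∀ (L : Type) [Field L] [NumberField L] [IsGalois ℚ L], finrank ℚ L ≤ n →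
    ∀ M : Subgroup (L ≃ₐ[ℚ] L), M.Normal → M ≠ ⊥ →
    (∀ N : Subgroup (L ≃ₐ[ℚ] L), N.Normal → N ≤ M → N = ⊥ ∨ N = M) →
    (∃ g, ∀ m ∈ M, Subgroup.zpowers (g * m) ⊓ M = ⊥) →
    ∀ y : ℕ, Y₀ ≤ y → absDisc (IntermediateField.fixedField M) ≤ (y : ℝ) ^ c →
    (y : ℝ) ^ c ≤ (subsetsProdLE (movedPrimes M y ∪ discrPrimes L y) y).card := by
  classical
  obtain ⟨c, hc, Y₀, H⟩ := exists_rpow_le_card_subsetsProdLE n hn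
  refine ⟨c, hc, max 1 Y₀, fun L _ _ _ hL M hMn hM hmin ⟨g, hg⟩ y hy hD ↦ ?_⟩
  have hy1 : (1 : ℝ) ≤ y := (le_max_left _ _).trans hy
  have hy0 : Y₀ ≤ y := (le_max_right _ _).trans hy
  set S := movedPrimes M y ∪ discrPrimes L y with hS
  have hSp : ∀ p ∈ S, p.Prime ∧ p ≤ y := by
    intro p hp
    rcases Finset.mem_union.mp hp with hp | hp
    · exact ⟨(mem_movedPrimes.mp hp).2.1, (mem_movedPrimes.mp hp).1⟩
    · exact ⟨(mem_discrPrimes.mp hp).2.1, (mem_discrPrimes.mp hp).1⟩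
  have hstab : ∀ p : ℕ, p.Prime → p ≤ y → p ∉ S → ∀ P : Ideal (𝓞 L), P.IsPrime → (p : 𝓞 L) ∈ P →
      ∃ h : L ≃ₐ[ℚ] L, MulAction.stabilizer (L ≃ₐ[ℚ] L) P = Subgroup.zpowers h ∧
        M ≤ Subgroup.zpowers h := by
    intro p hp hpy hpS P hP hpP
    rw [hS, Finset.mem_union, not_or, mem_movedPrimes, mem_discrPrimes] at hpS
    obtain ⟨h, hh⟩ := exists_stabilizer_eq_zpowers hp (fun h ↦ hpS.2 ⟨hpy, hp, h⟩) P hpP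
    refine ⟨h, hh, ?_⟩
    by_contra hcon
    exact hpS.1 ⟨hpy, hp, P, hP, hpP, by rwa [hh]⟩
  by_cases hcyc : ∃ h₀, M ≤ Subgroup.zpowers h₀
  · obtain ⟨h₀, hh₀⟩ := hcyc
    obtain ⟨A, B, hMB, hBA, hAB⟩ := exists_lt_of_le_zpowers hM hmin hg hh₀
    let E := IntermediateField.fixedField A
    let K := IntermediateField.fixedField B
    have hEK : E ≤ K := IntermediateField.fixedField_antitone hBA.le
    have hKF : K ≤ IntermediateField.fixedField M := IntermediateField.fixedField_antitone hMB
    let : Algebra E K := (IntermediateField.inclusion hEK).toRingHom.toAlgebra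
    have : IsScalarTower E K L := IsScalarTower.of_algebraMap_eq fun x ↦ rfl
    have hA : IsGaloisGroup A E L := IsGaloisGroup.subgroup _ ℚ L A
    have hB : IsGaloisGroup B K L := IsGaloisGroup.subgroup _ ℚ L B
    have hdvd : ∀ P : Ideal (𝓞 K), P.IsPrime → P ≠ ⊥ → ∀ p : ℕ, p.Prime → p ≤ y → p ∉ S →
        (p : 𝓞 K) ∈ P → P.ramificationIdx (𝓞 E) * P.inertiaDeg (𝓞 E) = 1 := by
      intro P hP hP0 p hp hpy hpS hpP
      obtain ⟨Q, hQ, rfl⟩ := exists_liesOver_under_eq (L := L) P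
      have hpQ : (p : 𝓞 L) ∈ Q := by simpa using hpP
      obtain ⟨h, hh, hMh⟩ := hstab p hp hpy hpS Q hQ hpQ
      refine ramificationIdx_mul_inertiaDeg_eq_one (A := A) (B := B) ?_ ?_
      · rintro rfl
        exact hp.ne_zero (by simpa using hpQ)
      · refine (card_stabilizer_subgroup A Q).trans
          (Eq.trans ?_ (card_stabilizer_subgroup B Q).symm)
        rw [hh]
        congr 2
        exact le_antisymm (le_inf (hAB h hMh) inf_le_right) (inf_le_inf_right _ hBA.le)
    have hfin : finrank E K * Nat.card B = Nat.card A := by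
      rw [IsGaloisGroup.card_eq_finrank A E L, IsGaloisGroup.card_eq_finrank B K L]
      exact finrank_mul_finrank E K L
    have hd2 : 2 ≤ finrank E K := by
      have h1 : Nat.card B < Nat.card A := Set.ncard_lt_ncard (s := (B : Set (L ≃ₐ[ℚ] L))) hBA
      by_contra! hcon
      have : finrank E K = 1 := by have := finrank_pos (R := E) (M := K); omega
      rw [this] at hfin
      omega
    have hEn : finrank ℚ E ≤ n := (Submodule.finrank_le E.toSubmodule).trans hL
    have hKn : finrank ℚ K ≤ n := (Submodule.finrank_le K.toSubmodule).trans hL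
    have hdn : finrank E K ≤ n := by
      refine le_trans ?_ hKn
      rw [← finrank_mul_finrank ℚ E K]
      exact Nat.le_mul_of_pos_left _ finrank_pos
    have hunder : ∀ P : Ideal (𝓞 K), P.IsPrime → P ≠ ⊥ → ∀ p : ℕ, p.Prime → p ≤ y → p ∉ S →
        (p : 𝓞 K) ∈ P → absNorm (P.under (𝓞 E)) = absNorm P := by
      intro P hP hP0 p hp hpy hpS hpP
      exact (absNorm_eq_of_inertiaDeg_eq_one
        (Nat.eq_one_of_mul_eq_one_left (hdvd P hP hP0 p hp hpy hpS hpP))).symm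
    let : Algebra K (IntermediateField.fixedField M) :=
      (IntermediateField.inclusion hKF).toRingHom.toAlgebra
    have hKD : absDisc K ≤ (y : ℝ) ^ c := absDisc_le_of_algebra.trans hD
    refine H E K hEn hKn y (finrank E K) hd2 hdn hy0
      ((absDisc_le_of_algebra (L := K)).trans hKD) hKD S hSp (fun P ↦ P.under (𝓞 E)) ?_ ?_ ?_
    · intro P hP
      obtain ⟨p, hp, hpy, hpS, hpP⟩ := exists_prime_notMem_of_mem_sdiff hP
      obtain ⟨h1, h2, h3, h4⟩ := mem_primesLE_sdiff.mp hP
      refine mem_primesLE_sdiff.mpr ⟨inferInstance, under_ne_bot _ h2, ?_, fun q hq hqP ↦ ?_⟩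
      · rwa [hunder P h1 h2 p hp hpy hpS hpP]
      · exact h4 q hq (by simpa using hqP)
    · intro P hP
      obtain ⟨p, hp, hpy, hpS, hpP⟩ := exists_prime_notMem_of_mem_sdiff hP
      obtain ⟨h1, h2, h3, h4⟩ := mem_primesLE_sdiff.mp hP
      exact hunder P h1 h2 p hp hpy hpS hpP
    · intro Q hQ
      obtain ⟨p, hp, hpy, hpS, hpQ⟩ := exists_prime_notMem_of_mem_sdiff hQ
      obtain ⟨h1, h2, h3, h4⟩ := mem_primesLE_sdiff.mp hQ
      have hP : ∀ P : Ideal (𝓞 K), P.IsPrime → P.under (𝓞 E) = Q →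
          P ≠ ⊥ ∧ (p : 𝓞 K) ∈ P := by
        rintro P hP rfl
        have hpP : (p : 𝓞 K) ∈ P := by simpa using hpQ
        refine ⟨?_, hpP⟩
        rintro rfl
        exact hp.ne_zero (by simpa using hpP)
      rw [← card_primesOver_eq_finrank h2 fun P h5 h6 ↦
        hdvd P h5 (hP P h5 h6).1 p hp hpy hpS (hP P h5 h6).2, ← Set.ncard_coe_finset]
      congr 1
      ext P
      simp only [Finset.coe_filter, Set.mem_ofPred_eq, mem_primesLE_sdiff]
      refine ⟨fun h ↦ ⟨h.1.1, h.2⟩, fun ⟨h5, h6⟩ ↦ ⟨⟨h5, (hP P h5 h6).1, ?_, fun q hq hqP ↦ ?_⟩, h6⟩⟩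
      · rwa [← hunder P h5 (hP P h5 h6).1 p hp hpy hpS (hP P h5 h6).2, h6]
      · refine h4 q hq ?_
        rw [← h6]
        simpa using hqP
  · have hall : ∀ p : ℕ, p.Prime → p ≤ y → p ∈ S := by
      intro p hp hpy
      by_contra hpS
      have : (Ideal.span {(p : ℤ)}).IsMaximal :=
        PrincipalIdealRing.isMaximal_of_irreducible (Nat.prime_iff_prime_int.mp hp).irreducible
      obtain ⟨P, hP, hPp⟩ := exists_maximal_ideal_liesOver_of_isIntegral (S := 𝓞 L)
        (Ideal.span {(p : ℤ)})
      have hpP : (p : 𝓞 L) ∈ P := by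
        have : (p : ℤ) ∈ P.under ℤ := by
          rw [← hPp.over]
          exact mem_span_singleton_self _
        simpa using this
      obtain ⟨h, -, hMh⟩ := hstab p hp hpy hpS P hP.isPrime hpP
      exact hcyc ⟨h, hMh⟩
    have hempty : primesLE ℚ y \ primesLEOver ℚ S y = ∅ := by
      refine Finset.eq_empty_of_forall_notMem fun P hP ↦ ?_
      obtain ⟨p, hp, hpy, hpS, -⟩ := exists_prime_notMem_of_mem_sdiff hP
      exact hpS (hall p hp hpy)
    have hQ : absDisc ℚ ≤ (y : ℝ) ^ c := by
      rw [absDisc, Rat.numberField_discr]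
      simpa using Real.one_le_rpow hy1 hc.le
    exact H ℚ ℚ (by simp; omega) (by simp; omega) y 2 le_rfl hn hy0 hQ hQ S hSp id
      (by simp [hempty]) (by simp [hempty]) (by simp [hempty])
theorem prod_discrPrimes_le (L : Type) [Field L] [NumberField L] (y : ℕ) :
    ((∏ p ∈ discrPrimes L y, p : ℕ) : ℝ) ≤ absDisc L := by
  have h : ∏ p ∈ discrPrimes L y, p ∣ (discr L).natAbs := by
    refine Finset.prod_primes_dvd _ (fun p hp ↦ (mem_discrPrimes.mp hp).2.1.prime) fun p hp ↦ ?_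
    exact Int.natCast_dvd.mp (mem_discrPrimes.mp hp).2.2
  have h1 := Nat.le_of_dvd (Int.natAbs_pos.mpr (discr_ne_zero L)) h
  rw [absDisc, ← Int.cast_abs, ← Nat.cast_natAbs]
  exact_mod_cast h1

theorem exists_rpow_le_card_movedPrimes (n : ℕ) (hn : 2 ≤ n) : ∃ c : ℝ, 0 < c ∧
    ∀ B : ℝ, 0 < B → ∃ Y₀ : ℝ,
    ∀ (L : Type) [Field L] [NumberField L] [IsGalois ℚ L], finrank ℚ L ≤ n →
    ∀ M : Subgroup (L ≃ₐ[ℚ] L), M.Normal → M ≠ ⊥ →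
    (∀ N : Subgroup (L ≃ₐ[ℚ] L), N.Normal → N ≤ M → N = ⊥ ∨ N = M) →
    (∃ g, ∀ m ∈ M, Subgroup.zpowers (g * m) ⊓ M = ⊥) →
    ∀ y : ℕ, Y₀ ≤ y → absDisc (IntermediateField.fixedField M) ≤ (y : ℝ) ^ c →
    absDisc L ≤ (y : ℝ) ^ B →
    (y : ℝ) ^ (c / 2) ≤ (subsetsProdLE (movedPrimes M y) y).card := by
  obtain ⟨c, hc, Y₀, H⟩ := exists_rpow_le_card_movedPrimes_union n hn
  refine ⟨c, hc, fun B hB ↦ ?_⟩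
  obtain ⟨C, hC, hC'⟩ := exists_card_subsetsProdLE_le_rpow (c / (4 * (1 + B))) (by positivity)
  refine ⟨max (max 1 Y₀) (C ^ (4 / c)), fun L _ _ _ hL M hMn hM hmin hg y hy hD hDL ↦ ?_⟩
  have hy1 : (1 : ℝ) ≤ y := (le_max_left _ _).trans ((le_max_left _ _).trans hy)
  have hy0 : Y₀ ≤ y := (le_max_right _ _).trans ((le_max_left _ _).trans hy)
  have hyC : C ≤ (y : ℝ) ^ (c / 4) := by
    have := Real.rpow_le_rpow (by positivity) ((le_max_right _ _).trans hy) (z := c / 4)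
      (by positivity)
    rwa [← Real.rpow_mul hC.le, div_mul_div_cancel₀ (by positivity), div_self (by positivity),
      Real.rpow_one] at this
  have hypos : (0 : ℝ) < y := by linarith
  have h1 := H L hL M hMn hM hmin hg y hy0 hD
  have h2 : ((subsetsProdLE (movedPrimes M y ∪ discrPrimes L y) y).card : ℝ) ≤
      (subsetsProdLE (movedPrimes M y) y).card * (subsetsProdLE (discrPrimes L y) y).card := by
    exact_mod_cast subsetsProdLE_union_card_le fun p hp ↦ by
      rcases Finset.mem_union.mp hp with hp | hp
      · exact (mem_movedPrimes.mp hp).2.1.one_le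
      · exact (mem_discrPrimes.mp hp).2.1.one_le
  have h3 := hC' (discrPrimes L y) (absDisc L) y (fun p hp ↦ (mem_discrPrimes.mp hp).2.1.two_le)
    (prod_discrPrimes_le L y)
  have h4 : C * (y : ℝ) ^ (c / (4 * (1 + B))) * absDisc L ^ (c / (4 * (1 + B))) ≤
      (y : ℝ) ^ (c / 2) := by
    calc _ ≤ (y : ℝ) ^ (c / 4) * (y : ℝ) ^ (c / (4 * (1 + B))) *
          ((y : ℝ) ^ B) ^ (c / (4 * (1 + B))) := by
          have := (absDisc_pos L).le
          gcongr
      _ = (y : ℝ) ^ (c / 2) := by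
          rw [← Real.rpow_mul hypos.le, ← Real.rpow_add hypos, ← Real.rpow_add hypos]
          congr 1
          field_simp
          ring
  have h5 : (y : ℝ) ^ c = (y : ℝ) ^ (c / 2) * (y : ℝ) ^ (c / 2) := by
    rw [← Real.rpow_add hypos, add_halves]
  refine le_of_mul_le_mul_right (a := (y : ℝ) ^ (c / 2)) ?_ (by positivity)
  rw [← h5]
  refine h1.trans (h2.trans ?_)
  gcongr
  exact h3.trans h4

end GoodPrimes

section DiscriminantBound

open Module IntermediateField

theorem abs_trace_pow_le {L : Type} [Field L] [NumberField L] {θ : L} {H : ℝ}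
    (hθ : ∀ w : InfinitePlace L, w θ ≤ H) (k : ℕ) :
    |((Algebra.trace ℚ L (θ ^ k) : ℚ) : ℝ)| ≤ finrank ℚ L * H ^ k := by
  have h := trace_eq_sum_embeddings (K := ℚ) (L := L) ℂ (x := θ ^ k)
  have h1 : |((Algebra.trace ℚ L (θ ^ k) : ℚ) : ℝ)| = ‖algebraMap ℚ ℂ (Algebra.trace ℚ L (θ ^ k))‖ := by
    simp
  rw [h1, h]
  refine (norm_sum_le_of_le (f := fun σ : L →ₐ[ℚ] ℂ ↦ σ (θ ^ k)) (n := fun _ ↦ H ^ k) _ fun σ _ ↦ ?_).trans_eq ?_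
  · rw [map_pow, norm_pow]
    exact pow_le_pow_left₀ (norm_nonneg _) (hθ (InfinitePlace.mk σ.toRingHom)) k
  · rw [Finset.sum_const, Finset.card_univ, AlgHom.card, nsmul_eq_mul]

theorem absDisc_le_of_adjoin_eq_top {L : Type} [Field L] [NumberField L] {θ : 𝓞 L}
    (h : adjoin ℚ {(θ : L)} = ⊤) {H : ℝ} (hH : 1 ≤ H) (hθ : ∀ w : InfinitePlace L, w (θ : L) ≤ H) :
    absDisc L ≤ (finrank ℚ L).factorial *
      (finrank ℚ L * H ^ (2 * finrank ℚ L)) ^ finrank ℚ L := by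
  classical
  have hInt : IsIntegral ℚ (θ : L) := Algebra.IsIntegral.isIntegral _
  let pb : PowerBasis ℚ L := (adjoin.powerBasis hInt).map ((equivOfEq h).trans topEquiv)
  have hgen : pb.gen = θ := by simp [pb]
  have hdim : pb.dim = finrank ℚ L := pb.finrank.symm
  let b := integralBasis L
  have hcard : Fintype.card (Free.ChooseBasisIndex ℤ (𝓞 L)) = finrank ℚ L := by
    rw [finrank_eq_card_basis b]
  let e : Free.ChooseBasisIndex ℤ (𝓞 L) ≃ Fin pb.dim := Fintype.equivFinOfCardEq (hcard.trans hdim.symm)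
  let v : Free.ChooseBasisIndex ℤ (𝓞 L) → L := fun i ↦ ((θ ^ (e i : ℕ) : 𝓞 L) : L)
  have hv : v = pb.basis.reindex e.symm := by
    funext i
    simp [v, hgen]
  let Q : Matrix (Free.ChooseBasisIndex ℤ (𝓞 L)) (Free.ChooseBasisIndex ℤ (𝓞 L)) ℤ :=
    (RingOfIntegers.basis L).toMatrix fun i ↦ θ ^ (e i : ℕ)
  have hQ : b.toMatrix v = (Int.castRingHom ℚ).mapMatrix Q := by
    ext i j
    simp only [Basis.toMatrix_apply, v, Q, RingHom.mapMatrix_apply, Matrix.map_apply]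
    exact integralBasis_repr_apply L _ _
  have hd : Algebra.discr ℚ v = (Q.det : ℚ) ^ 2 * discr L := by
    have h1 := Algebra.discr_of_matrix_vecMul (A := ℚ) b (b.toMatrix v)
    rw [Basis.toMatrix_map_vecMul] at h1
    rw [h1, hQ, ← RingHom.map_det, coe_discr]
    rfl
  have hne : Algebra.discr ℚ v ≠ 0 := by
    rw [hv]
    exact Algebra.discr_not_zero_of_basis ℚ _
  have hQ1 : 1 ≤ |(Q.det : ℚ)| := by
    have : Q.det ≠ 0 := by
      rintro h0
      rw [hd, h0] at hne
      simp at hne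
    rw [← Int.cast_abs]
    exact_mod_cast Int.one_le_abs this
  have hle : absDisc L ≤ |((Algebra.discr ℚ v : ℚ) : ℝ)| := by
    rw [hd, absDisc]
    rw [Rat.cast_mul, Rat.cast_pow, Rat.cast_intCast, Rat.cast_intCast, abs_mul, abs_pow]
    have : (1 : ℝ) ≤ |(Q.det : ℝ)| := by exact_mod_cast hQ1
    exact le_mul_of_one_le_left (abs_nonneg _) (one_le_pow₀ this)
  refine hle.trans ?_
  have hdet := Matrix.det_le (A := (algebraMap ℚ ℝ).mapMatrix (Algebra.traceMatrix ℚ v))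
    (abv := AbsoluteValue.abs) (x := finrank ℚ L * H ^ (2 * finrank ℚ L)) fun i j ↦ ?_
  · rw [← RingHom.map_det, hcard, nsmul_eq_mul] at hdet
    exact hdet
  · have hij : (e i : ℕ) + e j ≤ 2 * finrank ℚ L := by
      have := (e i).2
      have := (e j).2
      omega
    have h1 : algebraMap ℚ ℝ (Algebra.traceMatrix ℚ v i j) =
        ((Algebra.trace ℚ L ((θ : L) ^ ((e i : ℕ) + e j)) : ℚ) : ℝ) := by
      simp [Algebra.traceMatrix_apply, Algebra.traceForm_apply, v, pow_add]
    rw [RingHom.mapMatrix_apply, Matrix.map_apply, h1]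
    refine (abs_trace_pow_le hθ _).trans ?_
    gcongr
theorem exists_nat_forall_eval_ne {L G : Type} [Field L] [CharZero L] [Fintype G] (Θ : Polynomial L)
    (τ : G → L →+* L) (h : ∀ g, ∃ j, τ g (Θ.coeff j) ≠ Θ.coeff j) :
    ∃ t : ℕ, t ≤ Fintype.card G * Θ.natDegree ∧ ∀ g, τ g (Θ.eval (t : L)) ≠ Θ.eval (t : L) := by
  classical
  have hne : ∀ g, Θ.map (τ g) - Θ ≠ 0 := by
    intro g h0
    obtain ⟨j, hj⟩ := h g
    refine hj (sub_eq_zero.mp ?_)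
    rw [← Polynomial.coeff_map, ← Polynomial.coeff_sub, h0, Polynomial.coeff_zero]
  have hdeg : (∏ g, (Θ.map (τ g) - Θ)).natDegree ≤ Fintype.card G * Θ.natDegree := by
    refine (Polynomial.natDegree_prod_le _ _).trans ?_
    rw [← Finset.card_univ, ← smul_eq_mul]
    refine Finset.sum_le_card_nsmul _ _ _ fun g _ ↦ ?_
    exact (Polynomial.natDegree_sub_le _ _).trans (max_le Polynomial.natDegree_map_le le_rfl)
  obtain ⟨x, hx, hx0⟩ : ∃ x ∈ (Finset.range (Fintype.card G * Θ.natDegree + 1)).image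
      (Nat.cast : ℕ → L), (∏ g, (Θ.map (τ g) - Θ)).eval x ≠ 0 := by
    by_contra! hcon
    refine Finset.prod_ne_zero_iff.mpr (fun g _ ↦ hne g)
      (Polynomial.eq_zero_of_natDegree_lt_card_of_eval_eq_zero' _ _ hcon ?_)
    rw [Finset.card_image_of_injective _ Nat.cast_injective, Finset.card_range]
    omega
  obtain ⟨t, ht, rfl⟩ := Finset.mem_image.mp hx
  refine ⟨t, Nat.lt_succ_iff.mp (Finset.mem_range.mp ht), fun g hg ↦ hx0 ?_⟩
  rw [Polynomial.eval_prod]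
  refine Finset.prod_eq_zero (Finset.mem_univ g) ?_
  rw [Polynomial.eval_sub, sub_eq_zero, ← hg, Polynomial.eval_natCast_map]

theorem exists_adjoin_eq_top_of_notMem_fixedField {L : Type} [Field L] [NumberField L] [IsGalois ℚ L]
    {M : Subgroup (L ≃ₐ[ℚ] L)} (hM : M.Normal)
    (hmin : ∀ N : Subgroup (L ≃ₐ[ℚ] L), N.Normal → N ≤ M → N = ⊥ ∨ N = M) {x : 𝓞 L}
    (hx : (x : L) ∉ fixedField M) {H : ℝ} (hH : 1 ≤ H) (hxH : ∀ w : InfinitePlace L, w (x : L) ≤ H) :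
    ∃ θ : 𝓞 L, adjoin ℚ {(θ : L)} = ⊤ ∧ ∀ w : InfinitePlace L, w (θ : L) ≤
      (finrank ℚ L + 1) * (2 ^ (finrank ℚ L + 2) * absDisc (fixedField M) * H *
        ((finrank ℚ L : ℝ) ^ 2 + 1) ^ (finrank ℚ L)) := by
  classical
  obtain ⟨a, ha, haw⟩ := exists_primitive_element_le (fixedField M)
  set n := finrank ℚ L with hn
  have hcard : Fintype.card (L ≃ₐ[ℚ] L) = n := by
    rw [← Nat.card_eq_fintype_card, IsGalois.card_aut_eq_finrank]
  let s : Option (L ≃ₐ[ℚ] L) → 𝓞 L := fun o ↦ o.elim (algebraMap _ _ a) fun σ ↦ σ • x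
  let e : Option (L ≃ₐ[ℚ] L) ≃ Fin (n + 1) := Fintype.equivFinOfCardEq (by simp [hcard])
  have hsx : ∀ σ : L ≃ₐ[ℚ] L, (s (some σ) : L) = σ x := fun σ ↦ rfl
  have hsa : (s none : L) = (a : fixedField M) := rfl
  let Θ : Polynomial L := ∑ o, Polynomial.C (s o : L) * Polynomial.X ^ (e o : ℕ)
  have hcoeff : ∀ o, Θ.coeff (e o) = s o := by
    intro o
    rw [Polynomial.finsetSum_coeff, Finset.sum_eq_single o]
    · simp
    · intro o' _ ho'
      rw [Polynomial.coeff_C_mul_X_pow, if_neg]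
      exact fun h ↦ ho' (e.injective (Fin.ext h.symm))
    · simp
  have hmoved : ∀ τ : L ≃ₐ[ℚ] L, τ ≠ 1 → ∃ o, τ (s o) ≠ s o := by
    intro τ hτ
    by_contra! hcon
    have hfix : ∀ τ : L ≃ₐ[ℚ] L, τ (a : fixedField M) = (a : fixedField M) → τ ∈ M := by
      intro τ h
      rw [← fixingSubgroup_fixedField M]
      refine (mem_fixingSubgroup_iff _ _).mpr fun y hy ↦ ?_
      have hEq : ((τ : L →ₐ[ℚ] L).comp (fixedField M).val) = (fixedField M).val := by
        refine AlgHom.ext_of_adjoin_eq_top (s := {(a : fixedField M)}) ?_ fun z hz ↦ ?_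
        · rw [← adjoin_simple_toSubalgebra_of_isAlgebraic (Algebra.IsAlgebraic.isAlgebraic _)]
          have h := congrArg toSubalgebra ha
          rw [top_toSubalgebra] at h
          convert! h
        · rw [Set.mem_singleton_iff.mp hz]
          exact h
      exact DFunLike.congr_fun hEq ⟨y, hy⟩
    let N : Subgroup (L ≃ₐ[ℚ] L) :=
      { carrier := {τ | τ ∈ M ∧ ∀ σ : L ≃ₐ[ℚ] L, τ (σ x) = σ x}
        one_mem' := ⟨M.one_mem, fun σ ↦ rfl⟩
        mul_mem' := fun {τ υ} h1 h2 ↦ ⟨M.mul_mem h1.1 h2.1, fun σ ↦ by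
          rw [AlgEquiv.mul_apply, h2.2, h1.2]⟩
        inv_mem' := fun {τ} h ↦ ⟨M.inv_mem h.1, fun σ ↦ by
          nth_rewrite 1 [← h.2 σ]
          rw [← AlgEquiv.mul_apply, inv_mul_cancel, AlgEquiv.one_apply]⟩ }
    have hN : N.Normal := ⟨fun τ h g ↦ ⟨hM.conj_mem _ h.1 g, fun σ ↦ by
      have := h.2 (g⁻¹ * σ)
      rw [AlgEquiv.mul_apply, AlgEquiv.mul_apply, ← AlgEquiv.mul_apply g⁻¹, this,
        ← AlgEquiv.mul_apply, mul_inv_cancel_left]⟩⟩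
    rcases hmin N hN fun τ h ↦ h.1 with h | h
    · have : τ ∈ N := ⟨hfix τ (hcon none), fun σ ↦ hcon (some σ)⟩
      rw [h, Subgroup.mem_bot] at this
      exact hτ this
    · refine hx ((mem_fixedField_iff _ _).mpr fun τ hτM ↦ ?_)
      have : τ ∈ N := h ▸ hτM
      exact this.2 1
  have hdeg : Θ.natDegree ≤ n := by
    refine Polynomial.natDegree_sum_le_of_forall_le _ _ fun o _ ↦ ?_
    exact (Polynomial.natDegree_C_mul_X_pow_le _ _).trans (Nat.lt_succ_iff.mp (e o).2)
  obtain ⟨t, ht, hτ⟩ := exists_nat_forall_eval_ne (G := {τ : L ≃ₐ[ℚ] L // τ ≠ 1}) Θ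
    (fun τ ↦ (τ.1 : L →+* L)) fun τ ↦ by
      obtain ⟨o, ho⟩ := hmoved τ.1 τ.2
      refine ⟨e o, ?_⟩
      rw [hcoeff]
      exact ho
  have ht' : t ≤ n ^ 2 := by
    refine ht.trans ?_
    rw [sq]
    refine Nat.mul_le_mul ?_ hdeg
    rw [← hcard]
    exact Fintype.card_subtype_le _
  let θ : 𝓞 L := ∑ o, s o * (t : 𝓞 L) ^ (e o : ℕ)
  have hθ : (θ : L) = Θ.eval (t : L) := by
    simp [θ, Θ, Polynomial.eval_finsetSum]
  refine ⟨θ, ?_, fun w ↦ ?_⟩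
  · rw [← IsGalois.fixedField_fixingSubgroup (adjoin ℚ {(θ : L)})]
    have : (adjoin ℚ {(θ : L)}).fixingSubgroup = ⊥ := by
      refine (Subgroup.eq_bot_iff_forall _).mpr fun τ hτ' ↦ ?_
      by_contra hne
      refine hτ ⟨τ, hne⟩ ?_
      rw [← hθ]
      exact (mem_fixingSubgroup_iff _ _).mp hτ' _ (mem_adjoin_simple_self ℚ (θ : L))
    rw [this, fixedField_bot]
  · have hD := one_le_absDisc (fixedField M)
    have hs : ∀ o, w (s o : L) ≤ 2 ^ (n + 2) * absDisc (fixedField M) * H := by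
      rintro (_ | σ)
      · rw [hsa]
        have h1 := haw (w.comap (algebraMap (fixedField M) L))
        rw [InfinitePlace.comap_apply] at h1
        refine h1.trans ?_
        have h2 : finrank ℚ (fixedField M) ≤ n := Submodule.finrank_le (fixedField M).toSubmodule
        calc _ ≤ 2 ^ (n + 2) * absDisc (fixedField M) := by gcongr; norm_num
          _ ≤ _ := le_mul_of_one_le_right (by positivity) hH
      · rw [hsx]
        have h1 := hxH (w.comap (σ : L →+* L))
        rw [InfinitePlace.comap_apply] at h1
        refine h1.trans (le_mul_of_one_le_left (by positivity) ?_)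
        exact one_le_mul_of_one_le_of_one_le (one_le_pow₀ (by norm_num)) hD
    have hw : w (θ : L) ≤ ∑ o, w ((s o : L) * (t : L) ^ (e o : ℕ)) := by
      have : (θ : L) = ∑ o, (s o : L) * (t : L) ^ (e o : ℕ) := by simp [θ]
      rw [this]
      exact AbsoluteValue.sum_le w.1 _ _
    refine hw.trans ((Finset.sum_le_card_nsmul _ _
      (2 ^ (n + 2) * absDisc (fixedField M) * H * ((n : ℝ) ^ 2 + 1) ^ n) fun o _ ↦ ?_).trans_eq ?_)
    · rw [map_mul, map_pow]
      have h1 : w (t : L) ≤ (n : ℝ) ^ 2 + 1 := by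
        have : w (t : L) = t := by simp
        rw [this]
        have : (t : ℝ) ≤ (n : ℝ) ^ 2 := by exact_mod_cast ht'
        linarith
      have h2 : w (t : L) ^ (e o : ℕ) ≤ ((n : ℝ) ^ 2 + 1) ^ n := by
        refine (pow_le_pow_left₀ (by positivity) h1 _).trans ?_
        exact pow_le_pow_right₀ (by nlinarith [sq_nonneg (n : ℝ)]) (Nat.lt_succ_iff.mp (e o).2)
      exact mul_le_mul (hs o) h2 (by positivity) (by positivity)
    · simp [hcard]
theorem exists_absDisc_le_of_notMem_fixedField (n : ℕ) : ∃ C : ℝ, 0 < C ∧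
    ∀ (L : Type) [Field L] [NumberField L] [IsGalois ℚ L], finrank ℚ L = n →
      ∀ M : Subgroup (L ≃ₐ[ℚ] L), M.Normal →
      (∀ N : Subgroup (L ≃ₐ[ℚ] L), N.Normal → N ≤ M → N = ⊥ ∨ N = M) →
      ∀ x : 𝓞 L, (x : L) ∉ fixedField M → ∀ H : ℝ, 1 ≤ H →
      (∀ w : InfinitePlace L, w (x : L) ≤ H) →
      absDisc L ≤ C * (absDisc (fixedField M) * H) ^ (2 * n ^ 2) := by
  let κ : ℝ := (n + 1) * (2 ^ (n + 2) * ((n : ℝ) ^ 2 + 1) ^ n)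
  have hκ : 1 ≤ κ := by
    have h1 : (1 : ℝ) ≤ 2 ^ (n + 2) := one_le_pow₀ (by norm_num)
    have h2 : (1 : ℝ) ≤ ((n : ℝ) ^ 2 + 1) ^ n := one_le_pow₀ (by nlinarith [sq_nonneg (n : ℝ)])
    have h3 : (1 : ℝ) ≤ n + 1 := by linarith [n.cast_nonneg (α := ℝ)]
    exact one_le_mul_of_one_le_of_one_le h3 (one_le_mul_of_one_le_of_one_le h1 h2)
  refine ⟨n.factorial * n ^ n * κ ^ (2 * n ^ 2) + 1, by positivity, ?_⟩
  intro L _ _ _ hL M hM hmin x hx H hH hxH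
  obtain ⟨θ, hθ, hθw⟩ := exists_adjoin_eq_top_of_notMem_fixedField hM hmin hx hH hxH
  have hD := one_le_absDisc (fixedField M)
  have hDH : 1 ≤ absDisc (fixedField M) * H := one_le_mul_of_one_le_of_one_le hD hH
  have hκH : 1 ≤ κ * (absDisc (fixedField M) * H) := one_le_mul_of_one_le_of_one_le hκ hDH
  have h := absDisc_le_of_adjoin_eq_top hθ hκH fun w ↦ (hθw w).trans_eq <| by
    rw [hL]
    ring
  rw [hL] at h
  refine h.trans ?_
  rw [mul_pow, ← pow_mul, mul_pow]
  calc _ = n.factorial * n ^ n * κ ^ (2 * n ^ 2) * (absDisc (fixedField M) * H) ^ (2 * n ^ 2) := by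
        rw [show 2 * n * n = 2 * n ^ 2 by ring]
        ring
    _ ≤ _ := by
        gcongr
        linarith

end DiscriminantBound

section TorsionClasses

open Module

theorem le_exp_one_mul_of_floor_neg_log_eq {s t : ℝ} (hs : 0 < s) (hs1 : s ≤ 1) (ht : 0 < t)
    (h : ⌊-Real.log s⌋₊ = ⌊-Real.log t⌋₊) : s ≤ Real.exp 1 * t := by
  have h1 := Nat.lt_floor_add_one (-Real.log t)
  have h3 : Real.log s ≤ 1 + Real.log t := by
    have h4 : (⌊-Real.log s⌋₊ : ℝ) ≤ -Real.log s :=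
      Nat.floor_le (by linarith [Real.log_nonpos hs.le hs1])
    rw [h] at h4
    linarith
  rw [← Real.exp_log hs, ← Real.exp_log ht, ← Real.exp_add]
  exact Real.exp_le_exp.mpr h3

theorem floor_neg_log_lt {K : Type*} [Field K] [NumberField K] {s : InfinitePlace K → ℝ}
    (h0 : ∀ w, 0 < s w) (h1 : ∀ w, s w ≤ 1) {X : ℝ} (hX : 1 ≤ X)
    (h : X⁻¹ ≤ ∏ w, s w ^ w.mult) (w : InfinitePlace K) :
    ⌊-Real.log (s w)⌋₊ < ⌊Real.log X⌋₊ + 1 := by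
  classical
  refine Nat.lt_succ_of_le (Nat.floor_le_floor ?_)
  have h2 : X⁻¹ ≤ s w := by
    refine h.trans ?_
    rw [← Finset.mul_prod_erase _ _ (Finset.mem_univ w)]
    refine (mul_le_of_le_one_right (pow_nonneg (h0 w).le _) ?_).trans ?_
    · exact Finset.prod_le_one (fun v _ ↦ pow_nonneg (h0 v).le _)
        fun v _ ↦ pow_le_one₀ (h0 v).le (h1 v)
    · exact pow_le_of_le_one (h0 w).le (h1 w) w.mult_ne_zero
  have h3 := Real.log_le_log (by positivity) h2
  rw [Real.log_inv] at h3
  linarith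

theorem exists_floor_log_pow_le_rpow (n : ℕ) (ε : ℝ) (hε : 0 < ε) :
    ∃ C : ℝ, 0 < C ∧ ∀ X : ℝ, 1 ≤ X → ∀ m ≤ n,
      (((⌊Real.log X⌋₊ + 1 : ℕ) : ℝ)) ^ m ≤ C * X ^ ε := by
  have hn : (0 : ℝ) < n + 1 := by positivity
  refine ⟨((ε / (n + 1))⁻¹ + 1) ^ (n + 1), by positivity, fun X hX m hm ↦ ?_⟩
  have h1 : Real.log X ≤ X ^ (ε / (n + 1)) / (ε / (n + 1)) :=
    Real.log_le_rpow_div (by linarith) (by positivity)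
  have h2 : (1 : ℝ) ≤ X ^ (ε / (n + 1)) := Real.one_le_rpow hX (by positivity)
  have h3 : (((⌊Real.log X⌋₊ + 1 : ℕ) : ℝ)) ≤ ((ε / (n + 1))⁻¹ + 1) * X ^ (ε / (n + 1)) := by
    have := Nat.floor_le (Real.log_nonneg hX)
    rw [div_eq_mul_inv _ (ε / (n + 1))] at h1
    push_cast
    linarith
  have h4 : (1 : ℝ) ≤ ((⌊Real.log X⌋₊ + 1 : ℕ) : ℝ) := by
    push_cast
    linarith [(⌊Real.log X⌋₊).cast_nonneg (α := ℝ)]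
  calc _ ≤ (((⌊Real.log X⌋₊ + 1 : ℕ) : ℝ)) ^ (n + 1) := pow_le_pow_right₀ h4 (by omega)
    _ ≤ (((ε / (n + 1))⁻¹ + 1) * X ^ (ε / (n + 1))) ^ (n + 1) := by gcongr
    _ = _ := by
      rw [mul_pow, ← Real.rpow_mul_natCast (by linarith)]
      push_cast
      rw [div_mul_cancel₀ _ hn.ne']

theorem card_infinitePlace_le_finrank (K : Type*) [Field K] [NumberField K] :
    Fintype.card (InfinitePlace K) ≤ finrank ℚ K := by
  rw [← InfinitePlace.card_add_two_mul_card_eq_rank, InfinitePlace.card_eq_nrRealPlaces_add_nrComplexPlaces]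
  omega

theorem exists_ncard_absNorm_le_rpow (n : ℕ) (ε : ℝ) (hε : 0 < ε) :
    ∃ C : ℝ, 0 < C ∧ ∀ (K : Type) [Field K] [NumberField K], finrank ℚ K ≤ n → ∀ X : ℝ, 1 ≤ X →
      {I : Ideal (𝓞 K) | I ≠ ⊥ ∧ (Ideal.absNorm I : ℝ) ≤ X}.Finite ∧
      ({I : Ideal (𝓞 K) | I ≠ ⊥ ∧ (Ideal.absNorm I : ℝ) ≤ X}.ncard : ℝ) ≤ C * X ^ (1 + ε) := by
  obtain ⟨C, hC, h⟩ := exists_ncard_absNorm_eq_le_rpow n ε hε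
  refine ⟨C, hC, fun K _ _ hK X hX ↦ ⟨?_, ?_⟩⟩
  · refine (Ideal.finite_setOfPred_absNorm_le ⌊X⌋₊).subset fun I hI ↦ ?_
    exact Nat.le_floor hI.2
  · have hsub : {I : Ideal (𝓞 K) | I ≠ ⊥ ∧ (Ideal.absNorm I : ℝ) ≤ X} ⊆
        ⋃ m ∈ Finset.Icc 1 ⌊X⌋₊, {I : Ideal (𝓞 K) | Ideal.absNorm I = m} := by
      intro I hI
      simp only [Set.mem_iUnion, Finset.mem_Icc]
      exact ⟨Ideal.absNorm I, ⟨Nat.one_le_iff_ne_zero.mpr (Ideal.absNorm_eq_zero_iff.not.mpr hI.1),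
        Nat.le_floor hI.2⟩, rfl⟩
    have hfin : (⋃ m ∈ Finset.Icc 1 ⌊X⌋₊, {I : Ideal (𝓞 K) | Ideal.absNorm I = m}).Finite :=
      Set.Finite.biUnion (Finset.finite_toSet _) fun m _ ↦ Ideal.finite_setOfPred_absNorm_eq m
    calc _ ≤ ((∑ m ∈ Finset.Icc 1 ⌊X⌋₊, {I : Ideal (𝓞 K) | Ideal.absNorm I = m}.ncard : ℕ) : ℝ) := by
          exact_mod_cast (Set.ncard_le_ncard hsub hfin).trans (Finset.set_ncard_biUnion_le _ _)
      _ ≤ ∑ m ∈ Finset.Icc 1 ⌊X⌋₊, C * X ^ ε := by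
          push_cast
          refine Finset.sum_le_sum fun m hm ↦ ?_
          obtain ⟨hm1, hm2⟩ := Finset.mem_Icc.mp hm
          refine (h K hK m (by omega)).trans ?_
          have : (m : ℝ) ≤ X := (Nat.le_floor_iff (by linarith)).mp hm2
          gcongr
      _ = ⌊X⌋₊ * (C * X ^ ε) := by simp
      _ ≤ X * (C * X ^ ε) := by
          have := Nat.floor_le (show 0 ≤ X by linarith)
          gcongr
      _ = _ := by
          rw [Real.rpow_add (by linarith), Real.rpow_one]
          ring

theorem exists_ncard_integers_le (n : ℕ) (H : ℝ) :
    ∃ B : ℕ, ∀ (K : Type) [Field K] [NumberField K], finrank ℚ K ≤ n →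
      {x : 𝓞 K | ∀ w : InfinitePlace K, w (x : K) ≤ H}.Finite ∧
      {x : 𝓞 K | ∀ w : InfinitePlace K, w (x : K) ≤ H}.ncard ≤ B := by
  classical
  let b : ℝ := max H 1 ^ n * 2 ^ n
  let S : Finset (Fin (n + 1) → ℤ) := Fintype.piFinset fun _ ↦ Finset.Icc (-⌈b⌉) ⌈b⌉
  let P : Finset (Polynomial ℤ) := S.image fun f ↦ ∑ i : Fin (n + 1), Polynomial.C (f i) * Polynomial.X ^ (i : ℕ)
  refine ⟨n * P.card, fun K _ _ hK ↦ ?_⟩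
  have hmem : ∀ x : 𝓞 K, (∀ w : InfinitePlace K, w (x : K) ≤ H) →
      minpoly ℤ x ∈ P ∧ (minpoly ℤ x).natDegree ≤ n := by
    intro x hx
    have hInt : IsIntegral ℤ x := Algebra.IsIntegral.isIntegral x
    have hQ : minpoly ℚ (x : K) = (minpoly ℤ x).map (algebraMap ℤ ℚ) := by
      rw [minpoly.isIntegrallyClosed_eq_field_fractions' ℚ x.isIntegral_coe,
        ← RingOfIntegers.minpoly_coe]
    have hd : (minpoly ℤ x).natDegree ≤ n := by
      rw [← (minpoly.monic hInt).natDegree_map (algebraMap ℤ ℚ), ← hQ]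
      exact (minpoly.natDegree_le _).trans hK
    refine ⟨Finset.mem_image.mpr ⟨fun i ↦ (minpoly ℤ x).coeff i, ?_, ?_⟩, hd⟩
    · refine Fintype.mem_piFinset.mpr fun i ↦ ?_
      have h := Embeddings.coeff_bdd_of_norm_le (A := ℂ) (x := (x : K)) (B := H)
        (fun φ ↦ by simpa using hx (InfinitePlace.mk φ)) i
      rw [hQ, Polynomial.coeff_map] at h
      have h2 : |((minpoly ℤ x).coeff i : ℝ)| ≤ b := by
        have h3 : ‖algebraMap ℤ ℚ ((minpoly ℤ x).coeff i)‖ = |((minpoly ℤ x).coeff i : ℝ)| := by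
          simp [← Rat.norm_cast_real]
        rw [← h3]
        refine h.trans ?_
        refine mul_le_mul (pow_le_pow_right₀ (le_max_right _ _) hK) ?_ (by positivity) (by positivity)
        have h4 : (finrank ℚ K).choose (finrank ℚ K / 2) ≤ 2 ^ n :=
          (Nat.choose_le_two_pow _ _).trans (Nat.pow_le_pow_right (by norm_num) hK)
        exact_mod_cast h4
      rw [abs_le] at h2
      rw [Finset.mem_Icc]
      constructor
      · have : (-⌈b⌉ : ℝ) ≤ (minpoly ℤ x).coeff i := by linarith [Int.le_ceil b]
        exact_mod_cast this
      · have : ((minpoly ℤ x).coeff i : ℝ) ≤ ⌈b⌉ := by linarith [Int.le_ceil b]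
        exact_mod_cast this
    · rw [Fin.sum_univ_eq_sum_range (fun i ↦ Polynomial.C ((minpoly ℤ x).coeff i) * Polynomial.X ^ i)]
      exact (Polynomial.as_sum_range_C_mul_X_pow' _ (by omega)).symm
  have hfin : {x : 𝓞 K | ∀ w : InfinitePlace K, w (x : K) ≤ H}.Finite := by
    refine Set.Finite.of_finite_fibers (f := minpoly ℤ) ?_ ?_
    · refine P.finite_toSet.subset ?_
      rintro _ ⟨x, hx, rfl⟩
      exact (hmem x hx).1
    · rintro _ ⟨x, hx, rfl⟩
      have hne : (minpoly ℤ x).map (algebraMap ℤ (𝓞 K)) ≠ 0 :=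
        ((minpoly.monic (Algebra.IsIntegral.isIntegral x)).map _).ne_zero
      refine (((minpoly ℤ x).map (algebraMap ℤ (𝓞 K))).roots.toFinset.finite_toSet).subset ?_
      rintro y ⟨-, hy⟩
      have hy' : minpoly ℤ y = minpoly ℤ x := hy
      rw [Finset.mem_coe, Multiset.mem_toFinset, Polynomial.mem_roots hne, Polynomial.IsRoot,
        ← hy', Polynomial.eval_map_algebraMap, minpoly.aeval]
  refine ⟨hfin, ?_⟩
  rw [Set.ncard_eq_toFinset_card _ hfin]
  refine Finset.card_le_mul_card_image_of_maps_to (f := minpoly ℤ)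
    (fun x hx ↦ (hmem x (hfin.mem_toFinset.mp hx)).1) n fun f _ ↦ ?_
  rcases Finset.eq_empty_or_nonempty {a ∈ hfin.toFinset | minpoly ℤ a = f} with h | ⟨x, hx⟩
  · rw [h]
    simp
  · obtain ⟨hx', rfl⟩ := Finset.mem_filter.mp hx
    have hm := (minpoly.monic (Algebra.IsIntegral.isIntegral (R := ℤ) x)).map (algebraMap ℤ (𝓞 K))
    calc _ ≤ ((minpoly ℤ x).map (algebraMap ℤ (𝓞 K))).roots.toFinset.card := by
          refine Finset.card_le_card fun y hy ↦ ?_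
          rw [Multiset.mem_toFinset, Polynomial.mem_roots hm.ne_zero, Polynomial.IsRoot,
            ← (Finset.mem_filter.mp hy).2, Polynomial.eval_map_algebraMap, minpoly.aeval]
      _ ≤ ((minpoly ℤ x).map (algebraMap ℤ (𝓞 K))).natDegree :=
          (Multiset.toFinset_card_le _).trans (Polynomial.card_roots' _)
      _ ≤ n := Polynomial.natDegree_map_le.trans (hmem x (hfin.mem_toFinset.mp hx')).2

theorem exists_ideal_pow_eq_span {K : Type*} [Field K] [NumberField K] {ℓ : ℕ}
    {c : ClassGroup (𝓞 K)} (hc : c ^ ℓ = 1) :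
    ∃ (J : nonZeroDivisors (Ideal (𝓞 K))) (γ : 𝓞 K),
      ClassGroup.mk0 J = c ∧ (J : Ideal (𝓞 K)) ^ ℓ = Ideal.span {γ} := by
  obtain ⟨J, rfl⟩ := ClassGroup.mk0_surjective c
  rw [← map_pow, ClassGroup.mk0_eq_one_iff (J ^ ℓ).2] at hc
  obtain ⟨γ, hγ⟩ := hc
  exact ⟨J, γ, rfl, hγ⟩

theorem exists_radii {K : Type*} [Field K] [NumberField K] {ℓ : ℕ} (hℓ : ℓ ≠ 0)
    {J : Ideal (𝓞 K)} (hJ : J ≠ ⊥) {γ : 𝓞 K} (h : J ^ ℓ = Ideal.span {γ}) :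
    ∃ R : InfinitePlace K → ℝ, (∀ w, 0 < R w) ∧ (∀ w, R w ^ ℓ = w (γ : K)) ∧
      ∏ w, R w ^ w.mult = Ideal.absNorm J := by
  have hγ : γ ≠ 0 := by
    rintro rfl
    rw [Ideal.span_singleton_eq_bot.mpr rfl] at h
    exact hJ (pow_eq_zero_iff hℓ |>.mp h)
  have hpos : ∀ w : InfinitePlace K, 0 < w (γ : K) := fun w ↦
    w.pos_iff.mpr (by exact_mod_cast hγ)
  have hR : ∀ w : InfinitePlace K, (w (γ : K) ^ ((ℓ : ℝ)⁻¹)) ^ ℓ = w (γ : K) := fun w ↦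
    Real.rpow_inv_natCast_pow (hpos w).le hℓ
  refine ⟨fun w ↦ w (γ : K) ^ ((ℓ : ℝ)⁻¹), fun w ↦ Real.rpow_pos_of_pos (hpos w) _, hR, ?_⟩
  refine (pow_left_inj₀ (Finset.prod_nonneg fun w _ ↦ by positivity) (Nat.cast_nonneg _) hℓ).mp ?_
  rw [← Nat.cast_pow, ← map_pow, h, ← prod_pow_mult_eq_absNorm, ← Finset.prod_pow]
  refine Finset.prod_congr rfl fun w _ ↦ ?_
  rw [← pow_mul, mul_comm, pow_mul, hR]

end TorsionClasses

section SmallIdeals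

open Module

theorem exists_small_mem_mul {K : Type*} [Field K] [NumberField K] {J B : Ideal (𝓞 K)} (hJ : J ≠ ⊥)
    (hB : B ≠ ⊥) {R : InfinitePlace K → ℝ} (hR : ∀ w, 0 < R w)
    (hRJ : ∏ w, R w ^ w.mult = Ideal.absNorm J) {X t : ℝ} (ht : 0 < t)
    (hX : 2 ^ finrank ℚ K * √(absDisc K) < X) (htX : t ^ finrank ℚ K = X * Ideal.absNorm B) :
    ∃ (β : 𝓞 K) (A : Ideal (𝓞 K)), β ≠ 0 ∧ A ≠ ⊥ ∧ Ideal.span {β} = J * B * A ∧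
      (Ideal.absNorm A : ℝ) ≤ X ∧ (∀ w, w (β : K) < t * R w) ∧
      X⁻¹ ≤ ∏ w : InfinitePlace K, (w (β : K) / (t * R w)) ^ w.mult := by
  have hNJ : (0 : ℝ) < Ideal.absNorm J :=
    Nat.cast_pos.mpr (Nat.pos_of_ne_zero (Ideal.absNorm_eq_zero_iff.not.mpr hJ))
  have hNB : (0 : ℝ) < Ideal.absNorm B :=
    Nat.cast_pos.mpr (Nat.pos_of_ne_zero (Ideal.absNorm_eq_zero_iff.not.mpr hB))
  have hX0 : 0 < X := lt_of_le_of_lt (by positivity) hX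
  have hprod : ∏ w : InfinitePlace K, (t * R w) ^ w.mult = X * Ideal.absNorm B * Ideal.absNorm J := by
    simp_rw [mul_pow]
    rw [Finset.prod_mul_distrib, hRJ, Finset.prod_pow_eq_pow_sum, InfinitePlace.sum_mult_eq, htX]
  obtain ⟨β, hβ, hβ0, hβw⟩ := exists_ne_zero_mem_ideal_lt_of_prod_lt (J * B)
    (mul_ne_zero hJ hB) (fun w ↦ t * R w) (fun w ↦ (mul_pos ht (hR w)).le) <| by
      rw [hprod, map_mul, Nat.cast_mul]
      calc _ < X * (Ideal.absNorm J * Ideal.absNorm B) := by gcongr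
        _ = _ := by ring
  obtain ⟨A, hA⟩ := Ideal.dvd_span_singleton.mpr hβ
  have hA0 : A ≠ ⊥ := by
    rintro rfl
    rw [Ideal.mul_bot, Ideal.span_singleton_eq_bot] at hA
    exact hβ0 hA
  have hNA : (1 : ℝ) ≤ Ideal.absNorm A :=
    Nat.one_le_cast.mpr (Nat.one_le_iff_ne_zero.mpr (Ideal.absNorm_eq_zero_iff.not.mpr hA0))
  have hN : ∏ w : InfinitePlace K, w (β : K) ^ w.mult =
      Ideal.absNorm J * Ideal.absNorm B * Ideal.absNorm A := by
    rw [prod_pow_mult_eq_absNorm, hA]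
    push_cast [map_mul]
    rfl
  refine ⟨β, A, hβ0, hA0, hA, ?_, hβw, ?_⟩
  · have h : ∏ w : InfinitePlace K, w (β : K) ^ w.mult ≤
        ∏ w : InfinitePlace K, (t * R w) ^ w.mult :=
      Finset.prod_le_prod (fun w _ ↦ by positivity) fun w _ ↦
        pow_le_pow_left₀ (by positivity) (hβw w).le _
    rw [hN, hprod] at h
    refine le_of_mul_le_mul_left ?_ (mul_pos hNJ hNB)
    linarith
  · simp_rw [div_pow]
    rw [Finset.prod_div_distrib, hN, hprod, inv_eq_one_div, div_le_div_iff₀ hX0 (by positivity)]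
    have : 0 < X * Ideal.absNorm B * Ideal.absNorm J := by positivity
    nlinarith

theorem exists_span_mul_pow_eq {K : Type*} [Field K] [NumberField K] {ℓ : ℕ}
    {J J' B B' A : Ideal (𝓞 K)} (hJ : J ≠ ⊥) (hJ' : J' ≠ ⊥) (hA : A ≠ ⊥) {β β' γ γ' : 𝓞 K}
    (hγ : J ^ ℓ = Ideal.span {γ}) (hγ' : J' ^ ℓ = Ideal.span {γ'})
    (hβ : Ideal.span {β} = J * B * A) (hβ' : Ideal.span {β'} = J' * B' * A) :
    ∃ x : 𝓞 K, β ^ ℓ * γ' * (Ideal.absNorm B' : 𝓞 K) ^ ℓ = β' ^ ℓ * γ * x ∧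
      Ideal.span {x} * B' ^ ℓ = Ideal.span {(Ideal.absNorm B' : 𝓞 K) ^ ℓ} * B ^ ℓ := by
  have hp : Ideal.span {β ^ ℓ * γ'} = J ^ ℓ * J' ^ ℓ * A ^ ℓ * B ^ ℓ := by
    rw [← Ideal.span_singleton_mul_span_singleton, ← Ideal.span_singleton_pow, hβ, ← hγ']
    ring
  have hq : Ideal.span {β' ^ ℓ * γ} = J ^ ℓ * J' ^ ℓ * A ^ ℓ * B' ^ ℓ := by
    rw [← Ideal.span_singleton_mul_span_singleton, ← Ideal.span_singleton_pow, hβ', ← hγ]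
    ring
  have hE : J ^ ℓ * J' ^ ℓ * A ^ ℓ ≠ ⊥ :=
    mul_ne_zero (mul_ne_zero (pow_ne_zero _ hJ) (pow_ne_zero _ hJ')) (pow_ne_zero _ hA)
  have hB' : B' ^ ℓ ∣ Ideal.span {(Ideal.absNorm B' : 𝓞 K) ^ ℓ} := by
    rw [← Ideal.span_singleton_pow]
    exact pow_dvd_pow_of_dvd (Ideal.dvd_span_singleton.mpr (Ideal.absNorm_mem B')) ℓ
  have hdvd : Ideal.span {β' ^ ℓ * γ} ∣
      Ideal.span {β ^ ℓ * γ' * (Ideal.absNorm B' : 𝓞 K) ^ ℓ} := by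
    rw [← Ideal.span_singleton_mul_span_singleton (β ^ ℓ * γ'), hp, hq, mul_assoc _ (B ^ ℓ)]
    exact mul_dvd_mul_left _ (hB'.mul_left _)
  obtain ⟨x, hx⟩ := Ideal.span_singleton_le_span_singleton.mp (Ideal.le_of_dvd hdvd)
  refine ⟨x, hx, mul_left_cancel₀ hE ?_⟩
  have h := congrArg (fun z ↦ Ideal.span {z}) hx
  simp only [← Ideal.span_singleton_mul_span_singleton] at h
  rw [Ideal.span_singleton_mul_span_singleton (β ^ ℓ),
    Ideal.span_singleton_mul_span_singleton (β' ^ ℓ), hp, hq] at h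
  calc _ = J ^ ℓ * J' ^ ℓ * A ^ ℓ * B' ^ ℓ * Ideal.span {x} := by ring
    _ = _ := by
      rw [← h]
      ring

theorem mk0_eq_of_span_eq_mul {K : Type*} [Field K] [NumberField K]
    {J J' : nonZeroDivisors (Ideal (𝓞 K))} {A : Ideal (𝓞 K)} {β β' : 𝓞 K} (hβ0 : β ≠ 0)
    (hβ0' : β' ≠ 0) (hβ : Ideal.span {β} = J * A) (hβ' : Ideal.span {β'} = J' * A) :
    ClassGroup.mk0 J = ClassGroup.mk0 J' := by
  refine ClassGroup.mk0_eq_mk0_iff.mpr ⟨β', β, hβ0', hβ0, ?_⟩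
  rw [hβ, hβ']
  ring

/-- Multiplying the `ℓ`-torsion of the class group by a family of ideals of small norm whose
ratios are not `ℓ`-th roots of principal ideals with small generator still gives at most
`O(absDisc L ^ (1 / 2 + ε))` objects. -/
theorem exists_card_torsion_mul_card_le (n ℓ : ℕ) (hℓ : ℓ ≠ 0) (ε : ℝ) (hε : 0 < ε) :
    ∃ C : ℝ, 0 < C ∧ ∀ (L : Type) [Field L] [NumberField L], finrank ℚ L ≤ n →
      ∀ (I : Finset (Ideal (𝓞 L))) (Y : ℝ), (∀ B ∈ I, B ≠ ⊥ ∧ (Ideal.absNorm B : ℝ) ≤ Y) →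
      (∀ B ∈ I, ∀ B' ∈ I, B ≠ B' → ∀ x : 𝓞 L,
        Ideal.span {x} * B' ^ ℓ = Ideal.span {(Ideal.absNorm B' : 𝓞 L) ^ ℓ} * B ^ ℓ →
        ¬ ∀ w : InfinitePlace L, w (x : L) ≤ (Real.exp 1 * Y ^ 2) ^ ℓ) →
      (Nat.card {c : ClassGroup (𝓞 L) // c ^ ℓ = 1} : ℝ) * I.card ≤
        C * absDisc L ^ (1 / 2 + ε) := by
  obtain ⟨C₁, hC₁, h₁⟩ := exists_ncard_absNorm_le_rpow n ε hε
  obtain ⟨C₂, hC₂, h₂⟩ := exists_floor_log_pow_le_rpow n ε hε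
  refine ⟨C₁ * C₂ * (2 ^ (n + 1)) ^ (1 + 2 * ε), by positivity, ?_⟩
  intro L _ _ hL I Y hI hinj
  have hm : finrank ℚ L ≠ 0 := finrank_pos.ne'
  have hD := one_le_sqrt_absDisc L
  have hDpos := absDisc_pos L
  set X : ℝ := 2 ^ (finrank ℚ L + 1) * √(absDisc L) with hXdef
  have hX1 : 1 ≤ X := one_le_mul_of_one_le_of_one_le (one_le_pow₀ (by norm_num)) hD
  have hX : 2 ^ finrank ℚ L * √(absDisc L) < X := by
    rw [hXdef]
    gcongr
    · norm_num
    · omega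
  choose J γ hJ hγ using fun c : {c : ClassGroup (𝓞 L) // c ^ ℓ = 1} ↦ exists_ideal_pow_eq_span c.2
  have hJ0 : ∀ c, (J c : Ideal (𝓞 L)) ≠ ⊥ := fun c ↦ nonZeroDivisors.coe_ne_zero (J c)
  choose R hR hRγ hRJ using fun c ↦ exists_radii hℓ (hJ0 c) (hγ c)
  have hNB : ∀ B : I, (1 : ℝ) ≤ Ideal.absNorm B.1 := fun B ↦
    Nat.one_le_cast.mpr (Nat.one_le_iff_ne_zero.mpr
      (Ideal.absNorm_eq_zero_iff.not.mpr (hI B.1 B.2).1))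
  have ht : ∀ B : I, ∃ t : ℝ, 0 < t ∧ t ^ finrank ℚ L = X * Ideal.absNorm B.1 := by
    intro B
    have hpos : 0 < X * Ideal.absNorm B.1 := by
      have := hNB B
      positivity
    exact ⟨_, Real.rpow_pos_of_pos hpos _, Real.rpow_inv_natCast_pow hpos.le hm⟩
  choose t ht0 ht using ht
  choose β A hβ0 hA0 hβ hA hβw hprod using fun p : {c : ClassGroup (𝓞 L) // c ^ ℓ = 1} × I ↦
    exists_small_mem_mul (hJ0 p.1) (hI p.2.1 p.2.2).1 (hR p.1) (hRJ p.1) (ht0 p.2) hX (ht p.2)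
  have hβpos : ∀ p, ∀ w : InfinitePlace L, 0 < w (β p : L) := fun p w ↦
    w.pos_iff.mpr (by exact_mod_cast hβ0 p)
  let s := fun (p : {c : ClassGroup (𝓞 L) // c ^ ℓ = 1} × I) (w : InfinitePlace L) ↦
    w (β p : L) / (t p.2 * R p.1 w)
  have htR : ∀ (p : {c : ClassGroup (𝓞 L) // c ^ ℓ = 1} × I) (w : InfinitePlace L),
      0 < t p.2 * R p.1 w := fun p w ↦ mul_pos (ht0 _) (hR _ _)
  have hs0 : ∀ p w, 0 < s p w := fun p w ↦ div_pos (hβpos p w) (htR p w)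
  have hs1 : ∀ p w, s p w ≤ 1 := fun p w ↦ (div_le_one (htR p w)).mpr (hβw p w).le
  let T := {A : Ideal (𝓞 L) | A ≠ ⊥ ∧ (Ideal.absNorm A : ℝ) ≤ X}
  obtain ⟨hTfin, hT⟩ := h₁ L hL X hX1
  have : Finite T := hTfin
  let Φ : {c : ClassGroup (𝓞 L) // c ^ ℓ = 1} × I → T × (InfinitePlace L → Fin (⌊Real.log X⌋₊ + 1)) :=
    fun p ↦ (⟨A p, hA0 p, hA p⟩, fun w ↦ ⟨⌊-Real.log (s p w)⌋₊,
      floor_neg_log_lt (hs0 p) (hs1 p) hX1 (hprod p) w⟩)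
  have hΦ : Function.Injective Φ := by
    intro p q hpq
    have hAeq : A p = A q := congrArg (fun z ↦ (z.1 : Ideal (𝓞 L))) hpq
    have hse : ∀ w, s p w ≤ Real.exp 1 * s q w := fun w ↦
      le_exp_one_mul_of_floor_neg_log_eq (hs0 p w) (hs1 p w) (hs0 q w)
        (congrArg (fun z ↦ (z.2 w : ℕ)) hpq)
    by_cases hB : p.2 = q.2
    · refine Prod.ext (Subtype.ext ?_) hB
      rw [← hJ p.1, ← hJ q.1]
      refine mk0_eq_of_span_eq_mul (A := p.2 * A p) (hβ0 p) (hβ0 q) ?_ ?_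
      · rw [hβ p, mul_assoc]
      · rw [hβ q, mul_assoc, hAeq, hB]
    · exfalso
      obtain ⟨x, hx, hxB⟩ := exists_span_mul_pow_eq (hJ0 p.1) (hJ0 q.1) (hA0 p) (hγ p.1) (hγ q.1)
        (hβ p) ((hβ q).trans (by rw [hAeq]))
      refine hinj p.2.1 p.2.2 q.2.1 q.2.2 (fun h ↦ hB (Subtype.ext h)) x hxB fun w ↦ ?_
      have hY : (Ideal.absNorm q.2.1 : ℝ) ≤ Y := (hI _ q.2.2).2
      have hY1 : 1 ≤ Y := (hNB q.2).trans hY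
      have htt : t p.2 ≤ Y * t q.2 := by
        refine le_of_pow_le_pow_left₀ hm (by have := ht0 q.2; positivity) ?_
        rw [mul_pow, ht, ht]
        have h3 : Y ≤ Y ^ finrank ℚ L := le_self_pow₀ hY1 hm
        calc _ ≤ X * Y := by gcongr; exact (hI _ p.2.2).2
          _ ≤ Y ^ finrank ℚ L * (X * 1) := by nlinarith
          _ ≤ _ := by gcongr; exact hNB q.2
      have hw := congrArg (fun z : 𝓞 L ↦ w (z : L)) hx
      simp only [map_mul, map_pow, map_natCast] at hw
      have hwN : w ((Ideal.absNorm q.2.1 : ℕ) : L) = (Ideal.absNorm q.2.1 : ℝ) := by simp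
      rw [hwN, ← hRγ, ← hRγ, ← mul_pow, ← mul_pow, ← mul_pow] at hw
      have hβp : w (β p : L) = s p w * (t p.2 * R p.1 w) := (div_mul_cancel₀ _ (htR p w).ne').symm
      have hβq : w (β q : L) = s q w * (t q.2 * R q.1 w) := (div_mul_cancel₀ _ (htR q w).ne').symm
      have hpos : 0 < w (β q : L) * R p.1 w := mul_pos (hβpos q w) (hR _ _)
      refine le_of_mul_le_mul_left (hw.symm.le.trans ?_) (pow_pos hpos ℓ)
      rw [← mul_pow]
      have hsq := hs0 q w
      have htq := ht0 q.2
      have htp := ht0 p.2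
      have hRp := hR p.1 w
      have hRq := hR q.1 w
      refine pow_le_pow_left₀ (by positivity) ?_ ℓ
      rw [hβp, hβq]
      calc s p w * (t p.2 * R p.1 w) * R q.1 w * Ideal.absNorm q.2.1
          ≤ Real.exp 1 * s q w * (Y * t q.2 * R p.1 w) * R q.1 w * Y := by
            gcongr
            exact hse w
        _ = _ := by ring
  have hcard := Nat.card_le_card_of_injective Φ hΦ
  rw [Nat.card_prod, Nat.card_prod, Nat.card_coe_set_eq, Nat.card_eq_fintype_card (α := I),
    Fintype.card_coe, Nat.card_fun, Nat.card_eq_fintype_card (α := InfinitePlace L),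
    Nat.card_fin] at hcard
  have h3 := h₂ X hX1 _ ((card_infinitePlace_le_finrank L).trans hL)
  calc _ ≤ (T.ncard : ℝ) * ((⌊Real.log X⌋₊ + 1 : ℕ) : ℝ) ^ Fintype.card (InfinitePlace L) := by
        exact_mod_cast hcard
    _ ≤ (C₁ * X ^ (1 + ε)) * (C₂ * X ^ ε) := by gcongr
    _ = C₁ * C₂ * X ^ (1 + 2 * ε) := by
        rw [show 1 + 2 * ε = (1 + ε) + ε by ring, Real.rpow_add (by linarith) (1 + ε)]
        ring
    _ ≤ C₁ * C₂ * (2 ^ (n + 1) * √(absDisc L)) ^ (1 + 2 * ε) := by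
        rw [hXdef]
        gcongr
        norm_num
    _ = _ := by
        rw [Real.mul_rpow (by positivity) (by positivity), Real.sqrt_eq_rpow,
          ← Real.rpow_mul hDpos.le]
        ring_nf

end SmallIdeals

section SmallFixedDiscriminant

open Module IntermediateField
open scoped Pointwise

theorem ne_bot_of_natCast_mem {K : Type*} [Field K] [NumberField K] {P : Ideal (𝓞 K)} {p : ℕ}
    (hp : p.Prime) (h : (p : 𝓞 K) ∈ P) : P ≠ ⊥ := by
  rintro rfl
  exact hp.ne_zero (by exact_mod_cast (Ideal.mem_bot.mp h))

theorem mem_and_eq_of_dvd_prod {K : Type*} [Field K] [NumberField K] {T : Finset ℕ}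
    (hT : ∀ q ∈ T, q.Prime) {Q : ℕ → Ideal (𝓞 K)}
    (hQ : ∀ q ∈ T, (Q q).IsPrime ∧ (q : 𝓞 K) ∈ Q q) {P : Ideal (𝓞 K)} (hP : P.IsPrime) {p : ℕ}
    (hp : p.Prime) (hpP : (p : 𝓞 K) ∈ P) (h : P ∣ ∏ q ∈ T, Q q) : p ∈ T ∧ Q p = P := by
  have hP0 := ne_bot_of_natCast_mem hp hpP
  obtain ⟨q, hq, hPq⟩ := (Ideal.prime_of_isPrime hP0 hP).exists_mem_finset_dvd h
  have hle := Ideal.le_of_dvd hPq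
  have hpq : q = p := by
    by_contra hne
    have hco : Nat.Coprime q p := (Nat.coprime_primes (hT q hq) hp).mpr hne
    obtain ⟨a, b, hab⟩ := Int.isCoprime_iff_gcd_eq_one.mpr (show Int.gcd q p = 1 from hco)
    refine hP.ne_top ((Ideal.eq_top_iff_one _).mpr ?_)
    have h1 : ((a * q + b * p : ℤ) : 𝓞 K) ∈ P := by
      push_cast
      exact P.add_mem (P.mul_mem_left _ (hle (hQ q hq).2)) (P.mul_mem_left _ hpP)
    rwa [hab, Int.cast_one] at h1
  subst hpq
  refine ⟨hq, ?_⟩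
  have hmax := (hQ q hq).1.isMaximal (ne_bot_of_natCast_mem (hT q hq) (hQ q hq).2)
  exact hmax.eq_of_le hP.ne_top hle

theorem absNorm_prod_le {K : Type*} [Field K] [NumberField K] {T : Finset ℕ}
    (hT : ∀ q ∈ T, q.Prime) {Q : ℕ → Ideal (𝓞 K)} (hQ : ∀ q ∈ T, (q : 𝓞 K) ∈ Q q) :
    Ideal.absNorm (∏ q ∈ T, Q q) ≤ (∏ q ∈ T, q) ^ finrank ℚ K := by
  rw [map_prod, ← Finset.prod_pow]
  refine Finset.prod_le_prod' fun q hq ↦ ?_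
  have h := Ideal.absNorm_dvd_absNorm_of_le ((Ideal.span_singleton_le_iff_mem _).mpr (hQ q hq))
  rw [Ideal.absNorm_span_natCast, RingOfIntegers.rank] at h
  exact Nat.le_of_dvd (pow_pos (hT q hq).pos _) h

theorem notMem_fixedField_of_span_mul_eq {L : Type} [Field L] [NumberField L]
    {M : Subgroup (L ≃ₐ[ℚ] L)} {ℓ : ℕ} (hℓ : ℓ ≠ 0) {Q : ℕ → Ideal (𝓞 L)} {T T' : Finset ℕ}
    (hT : ∀ q ∈ T, q.Prime ∧ (Q q).IsPrime ∧ (q : 𝓞 L) ∈ Q q ∧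
      ¬ M ≤ MulAction.stabilizer (L ≃ₐ[ℚ] L) (Q q))
    (hT' : ∀ q ∈ T', q.Prime ∧ (Q q).IsPrime ∧ (q : 𝓞 L) ∈ Q q ∧
      ¬ M ≤ MulAction.stabilizer (L ≃ₐ[ℚ] L) (Q q)) (hne : T ≠ T') {x : 𝓞 L} {N : ℕ} (hN : N ≠ 0)
    (hx : Ideal.span {x} * (∏ q ∈ T', Q q) ^ ℓ =
      Ideal.span {(N : 𝓞 L) ^ ℓ} * (∏ q ∈ T, Q q) ^ ℓ) : (x : L) ∉ fixedField M := by
  intro hxM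
  have hprod0 : ∀ {T : Finset ℕ}, (∀ q ∈ T, q.Prime ∧ (Q q).IsPrime ∧ (q : 𝓞 L) ∈ Q q ∧
      ¬ M ≤ MulAction.stabilizer (L ≃ₐ[ℚ] L) (Q q)) → ∏ q ∈ T, Q q ≠ 0 := fun h ↦
    Finset.prod_ne_zero_iff.mpr fun q hq ↦ ne_bot_of_natCast_mem (h q hq).1 (h q hq).2.2.1
  have hN0 : Ideal.span {(N : 𝓞 L) ^ ℓ} ≠ 0 := by
    rw [Ne, Ideal.zero_eq_bot, Ideal.span_singleton_eq_bot]
    exact pow_ne_zero _ (Nat.cast_ne_zero.mpr hN)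
  have hx0 : Ideal.span {x} ≠ 0 := by
    intro h
    rw [h, zero_mul] at hx
    exact mul_ne_zero hN0 (pow_ne_zero ℓ (hprod0 hT)) hx.symm
  have key : ∀ σ ∈ M, (∏ q ∈ T', Q q) ^ ℓ * (∏ q ∈ T, σ • Q q) ^ ℓ =
      (∏ q ∈ T, Q q) ^ ℓ * (∏ q ∈ T', σ • Q q) ^ ℓ := by
    intro σ hσ
    have hσx : σ • x = x := by
      refine RingOfIntegers.ext ?_
      exact (mem_fixedField_iff _ _).mp hxM σ hσ
    have h := congrArg (fun I ↦ σ • I) hx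
    simp only [smul_mul', smul_pow', Finset.smul_prod', Ideal.smul_closure, Set.smul_set_singleton] at h
    rw [hσx] at h
    have hσN : σ • (N : 𝓞 L) = N := by
      exact map_natCast (MulSemiringAction.toRingHom (L ≃ₐ[ℚ] L) (𝓞 L) σ) N
    rw [hσN] at h
    refine mul_left_cancel₀ (mul_ne_zero hx0 hN0) ?_
    calc _ = (Ideal.span {x} * (∏ q ∈ T', Q q) ^ ℓ) *
          (Ideal.span {(N : 𝓞 L) ^ ℓ} * (∏ q ∈ T, σ • Q q) ^ ℓ) := by ring
      _ = _ := by
        rw [hx, ← h]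
        ring
  have main : ∀ {T T' : Finset ℕ}, (∀ q ∈ T, q.Prime ∧ (Q q).IsPrime ∧ (q : 𝓞 L) ∈ Q q ∧
      ¬ M ≤ MulAction.stabilizer (L ≃ₐ[ℚ] L) (Q q)) →
      (∀ q ∈ T', q.Prime ∧ (Q q).IsPrime ∧ (q : 𝓞 L) ∈ Q q ∧
      ¬ M ≤ MulAction.stabilizer (L ≃ₐ[ℚ] L) (Q q)) →
      (∀ σ ∈ M, (∏ q ∈ T', Q q) ^ ℓ * (∏ q ∈ T, σ • Q q) ^ ℓ =
      (∏ q ∈ T, Q q) ^ ℓ * (∏ q ∈ T', σ • Q q) ^ ℓ) → T ⊆ T' := by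
    intro T T' hT hT' key p hp
    obtain ⟨hpp, hP, hpP, hmov⟩ := hT p hp
    obtain ⟨σ, hσ, hσP⟩ := SetLike.not_le_iff_exists.mp hmov
    have hprime := Ideal.prime_of_isPrime (ne_bot_of_natCast_mem hpp hpP) hP
    have hdvd : Q p ∣ (∏ q ∈ T', Q q) ^ ℓ * (∏ q ∈ T, σ • Q q) ^ ℓ := by
      rw [key σ hσ]
      exact ((Finset.dvd_prod_of_mem Q hp).trans (dvd_pow_self _ hℓ)).mul_right _
    rcases hprime.dvd_or_dvd hdvd with h | h
    · exact (mem_and_eq_of_dvd_prod (fun q hq ↦ (hT' q hq).1)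
        (fun q hq ↦ ⟨(hT' q hq).2.1, (hT' q hq).2.2.1⟩) hP hpp hpP (hprime.dvd_of_dvd_pow h)).1
    · refine absurd (mem_and_eq_of_dvd_prod (Q := fun q ↦ σ • Q q) (fun q hq ↦ (hT q hq).1)
        (fun q hq ↦ ⟨?_, ?_⟩) hP hpp hpP (hprime.dvd_of_dvd_pow h)).2 hσP
      · have := (hT q hq).2.1
        exact Ideal.IsPrime.smul σ
      · have h := Ideal.smul_mem_pointwise_smul σ _ _ (hT q hq).2.2.1
        have hσq : σ • (q : 𝓞 L) = q :=
          map_natCast (MulSemiringAction.toRingHom (L ≃ₐ[ℚ] L) (𝓞 L) σ) q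
        rwa [hσq] at h
  exact hne ((main hT hT' key).antisymm (main hT' hT fun σ hσ ↦ by rw [mul_comm, key σ hσ, mul_comm]))

/-- If the fixed field of a minimal normal subgroup has very small discriminant, then the primes
moved by this subgroup give a power saving for the torsion in the class group. -/
theorem exists_card_torsion_le_of_absDisc_fixedField_le (n ℓ : ℕ) (hn : 2 ≤ n) (hℓ : ℓ ≠ 0) :
    ∃ κ : ℝ, 0 < κ ∧ ∃ η : ℝ, 0 < η ∧ ∃ C : ℝ, 0 < C ∧
      ∀ (L : Type) [Field L] [NumberField L] [IsGalois ℚ L], finrank ℚ L = n →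
      ∀ M : Subgroup (L ≃ₐ[ℚ] L), M.Normal → M ≠ ⊥ →
      (∀ N : Subgroup (L ≃ₐ[ℚ] L), N.Normal → N ≤ M → N = ⊥ ∨ N = M) →
      (∃ g, ∀ m ∈ M, Subgroup.zpowers (g * m) ⊓ M = ⊥) →
      absDisc (fixedField M) ≤ absDisc L ^ κ →
      (Nat.card {c : ClassGroup (𝓞 L) // c ^ ℓ = 1} : ℝ) ≤ C * absDisc L ^ (1 / 2 - η) := by
  obtain ⟨c, hc, hmoved⟩ := exists_rpow_le_card_movedPrimes n hn
  obtain ⟨C₁, hC₁, hdisc⟩ := exists_absDisc_le_of_notMem_fixedField n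
  have hn0 : (0 : ℝ) < n := by positivity
  have hℓ0 : (0 : ℝ) < ℓ := by positivity
  set θ : ℝ := 1 / (16 * n ^ 3 * ℓ) with hθdef
  have hθ : 0 < θ := by positivity
  obtain ⟨C₂, hC₂, hcount⟩ := exists_card_torsion_mul_card_le n ℓ hℓ (θ * c / 8) (by positivity)
  obtain ⟨Y₀, hY₀⟩ := hmoved (2 / θ) (by positivity)
  obtain ⟨D₀, hD₀⟩ : ∃ D₀ : ℝ, ∀ D ≥ D₀, C₁ * Real.exp 1 ^ (ℓ * (2 * n ^ 2)) < D ^ (1 / 2 : ℝ) ∧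
      max 2 Y₀ ≤ D ^ (θ / 2) := by
    refine Filter.eventually_atTop.mp (Filter.Eventually.and ?_ ?_)
    · exact (tendsto_rpow_atTop (by norm_num)).eventually_gt_atTop _
    · exact (tendsto_rpow_atTop (by positivity)).eventually_ge_atTop _
  refine ⟨min (θ * c / 2) (1 / (8 * n ^ 2)), by positivity, θ * c / 8, by positivity,
    C₂ * max 1 D₀ ^ (θ * c / 4), by positivity, ?_⟩
  intro L _ _ _ hL M hM hM0 hmin hg hF
  have hD1 := one_le_absDisc L
  set D := absDisc L with hDdef
  have hD : 0 < D := absDisc_pos L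
  have hm : (1 : ℝ) ≤ max 1 D₀ ^ (θ * c / 4) := Real.one_le_rpow (le_max_left _ _) (by positivity)
  have hsplit : D ^ (1 / 2 + θ * c / 8) = D ^ (1 / 2 - θ * c / 8) * D ^ (θ * c / 4) := by
    rw [← Real.rpow_add hD]
    ring_nf
  rcases lt_or_ge D D₀ with hlt | hge
  · have h := hcount L hL.le {⊤} 1 (by simp) (by simp +contextual)
    rw [Finset.card_singleton, Nat.cast_one, mul_one] at h
    refine h.trans ?_
    rw [hsplit]
    calc C₂ * (D ^ (1 / 2 - θ * c / 8) * D ^ (θ * c / 4))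
        ≤ C₂ * (D ^ (1 / 2 - θ * c / 8) * max 1 D₀ ^ (θ * c / 4)) := by
          gcongr
          exact hlt.le.trans (le_max_right _ _)
      _ = _ := by ring
  · obtain ⟨hDbig, hDθ⟩ := hD₀ D hge
    set z := D ^ (θ / 2) with hz
    have hz2 : 2 ≤ z := (le_max_left _ _).trans hDθ
    have hz0 : 0 < z := by linarith
    have hzz : D ^ θ = z * z := by
      rw [hz, ← Real.rpow_add hD]
      ring_nf
    set y := ⌊D ^ θ⌋₊ with hy
    have hyle : (y : ℝ) ≤ D ^ θ := Nat.floor_le (by positivity)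
    have hyge : z ≤ y := by
      have := Nat.lt_floor_add_one (D ^ θ)
      rw [← hy, hzz] at this
      nlinarith
    have hy1 : (1 : ℝ) ≤ y := by linarith
    have hFle : absDisc (fixedField M) ≤ (y : ℝ) ^ c := by
      calc _ ≤ D ^ min (θ * c / 2) (1 / (8 * (n : ℝ) ^ 2)) := hF
        _ ≤ D ^ (θ / 2 * c) := by
          refine Real.rpow_le_rpow_of_exponent_le hD1 ((min_le_left _ _).trans_eq (by ring))
        _ = z ^ c := Real.rpow_mul hD.le _ _
        _ ≤ _ := by gcongr
    have hLle : D ≤ (y : ℝ) ^ (2 / θ) := by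
      calc D = z ^ (2 / θ) := by
            rw [hz, ← Real.rpow_mul hD.le, show θ / 2 * (2 / θ) = 1 by field_simp, Real.rpow_one]
        _ ≤ _ := by gcongr
    have hS := hY₀ L hL.le M hM hM0 hmin hg y (((le_max_right _ _).trans hDθ).trans hyge) hFle hLle
    have hQ : ∀ p, ∃ P : Ideal (𝓞 L), p ∈ movedPrimes M y → P.IsPrime ∧ (p : 𝓞 L) ∈ P ∧
        ¬ M ≤ MulAction.stabilizer (L ≃ₐ[ℚ] L) P := by
      intro p
      by_cases h : p ∈ movedPrimes M y
      · obtain ⟨P, hP⟩ := (mem_movedPrimes.mp h).2.2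
        exact ⟨P, fun _ ↦ hP⟩
      · exact ⟨⊤, fun h' ↦ absurd h' h⟩
    choose Q hQ using hQ
    have hT : ∀ T ∈ subsetsProdLE (movedPrimes M y) y, ∀ q ∈ T, q.Prime ∧ (Q q).IsPrime ∧
        (q : 𝓞 L) ∈ Q q ∧ ¬ M ≤ MulAction.stabilizer (L ≃ₐ[ℚ] L) (Q q) := fun T hT q hq ↦
      have hq' := (mem_subsetsProdLE.mp hT).1 hq
      ⟨(mem_movedPrimes.mp hq').2.1, hQ q hq'⟩
    have hne : ∀ T ∈ subsetsProdLE (movedPrimes M y) y, ∏ q ∈ T, Q q ≠ ⊥ := fun T hT' ↦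
      Finset.prod_ne_zero_iff.mpr fun q hq ↦
        ne_bot_of_natCast_mem (hT T hT' q hq).1 (hT T hT' q hq).2.2.1
    classical
    let I := (subsetsProdLE (movedPrimes M y) y).image fun T ↦ ∏ q ∈ T, Q q
    have hI : I.card = (subsetsProdLE (movedPrimes M y) y).card := by
      refine Finset.card_image_of_injOn fun T h T' h' heq ↦ ?_
      by_contra hTT
      have hN : Ideal.absNorm (∏ q ∈ T, Q q) ≠ 0 := Ideal.absNorm_eq_zero_iff.not.mpr (hne T h)
      refine notMem_fixedField_of_span_mul_eq (M := M) (x := (Ideal.absNorm (∏ q ∈ T, Q q) : 𝓞 L) ^ ℓ)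
        hℓ (hT T h) (hT T' h') hTT hN ?_ ?_
      · rw [show ∏ q ∈ T', Q q = ∏ q ∈ T, Q q from heq.symm]
      · push_cast
        exact _root_.pow_mem (_root_.natCast_mem _ _) _
    have h := hcount L hL.le I ((y : ℝ) ^ n) ?_ ?_
    · rw [hI, hsplit] at h
      have hzc : D ^ (θ * c / 4) ≤ (subsetsProdLE (movedPrimes M y) y).card := by
        calc _ = z ^ (c / 2) := by
              rw [hz, ← Real.rpow_mul hD.le]
              ring_nf
          _ ≤ (y : ℝ) ^ (c / 2) := by gcongr
          _ ≤ _ := hS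
      have hpos : 0 < D ^ (θ * c / 4) := by positivity
      refine le_of_mul_le_mul_right ?_ hpos
      calc _ ≤ _ := mul_le_mul_of_nonneg_left hzc (Nat.cast_nonneg _)
        _ ≤ C₂ * 1 * D ^ (1 / 2 - θ * c / 8) * D ^ (θ * c / 4) := h.trans_eq (by ring)
        _ ≤ _ := by gcongr
    · intro B hB
      obtain ⟨T, hTm, rfl⟩ := Finset.mem_image.mp hB
      refine ⟨hne T hTm, ?_⟩
      have h1 := absNorm_prod_le (fun q hq ↦ (hT T hTm q hq).1) fun q hq ↦ (hT T hTm q hq).2.2.1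
      rw [hL] at h1
      exact_mod_cast h1.trans (Nat.pow_le_pow_left (mem_subsetsProdLE.mp hTm).2 n)
    · intro B hB B' hB' hBB x hx hxw
      obtain ⟨T, hTm, rfl⟩ := Finset.mem_image.mp hB
      obtain ⟨T', hTm', rfl⟩ := Finset.mem_image.mp hB'
      have hTT : T ≠ T' := fun h ↦ hBB (by rw [h])
      have hxM := notMem_fixedField_of_span_mul_eq hℓ (hT T hTm) (hT T' hTm') hTT
        (Ideal.absNorm_eq_zero_iff.not.mpr (hne T' hTm')) hx
      have hH : (1 : ℝ) ≤ (Real.exp 1 * ((y : ℝ) ^ n) ^ 2) ^ ℓ :=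
        one_le_pow₀ (one_le_mul_of_one_le_of_one_le (Real.one_le_exp zero_le_one)
          (one_le_pow₀ (one_le_pow₀ hy1)))
      have h := hdisc L hL M hM hmin x hxM _ hH hxw
      have hHle : (Real.exp 1 * ((y : ℝ) ^ n) ^ 2) ^ ℓ ≤ Real.exp 1 ^ ℓ * D ^ (1 / (8 * (n : ℝ) ^ 2)) := by
        rw [mul_pow, ← pow_mul, ← pow_mul]
        gcongr
        calc (y : ℝ) ^ (n * (2 * ℓ)) ≤ (D ^ θ) ^ (n * (2 * ℓ)) := by gcongr
          _ = _ := by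
            rw [← Real.rpow_mul_natCast hD.le, hθdef]
            congr 1
            push_cast
            field_simp
            norm_num
      have hFle' : absDisc (fixedField M) ≤ D ^ (1 / (8 * (n : ℝ) ^ 2)) :=
        hF.trans (Real.rpow_le_rpow_of_exponent_le hD1 (min_le_right _ _))
      have hDle : D ≤ C₁ * Real.exp 1 ^ (ℓ * (2 * n ^ 2)) * D ^ (1 / 2 : ℝ) := by
        have hF0 := absDisc_pos (fixedField M)
        calc D ≤ _ := h
          _ ≤ C₁ * (D ^ (1 / (8 * (n : ℝ) ^ 2)) *
              (Real.exp 1 ^ ℓ * D ^ (1 / (8 * (n : ℝ) ^ 2)))) ^ (2 * n ^ 2) := by gcongr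
          _ = C₁ * Real.exp 1 ^ (ℓ * (2 * n ^ 2)) *
              (D ^ (1 / (8 * (n : ℝ) ^ 2)) * D ^ (1 / (8 * (n : ℝ) ^ 2))) ^ (2 * n ^ 2) := by ring
          _ = _ := by
            rw [← Real.rpow_add hD, ← Real.rpow_mul_natCast hD.le]
            congr 2
            push_cast
            field_simp
            norm_num
      have h2 : D = D ^ (1 / 2 : ℝ) * D ^ (1 / 2 : ℝ) := by
        rw [← Real.rpow_add hD]
        norm_num
      have h3 : 0 < D ^ (1 / 2 : ℝ) := by positivity
      nlinarith

end SmallFixedDiscriminant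

section SelmerRepresentatives

open Module

theorem exists_units_representatives (K : Type*) [Field K] [NumberField K] {ℓ : ℕ} (hℓ : ℓ ≠ 0) :
    ∃ R : Finset (𝓞 K)ˣ, R.card ≤ ℓ ^ finrank ℚ K ∧ ∀ u, ∃ r ∈ R, ∃ v, u = r * v ^ ℓ := by
  classical
  obtain ⟨ζ, hζ⟩ := IsCyclic.exists_generator (α := Units.torsion K)
  have hℓ' : (ℓ : ℤ) ≠ 0 := by exact_mod_cast hℓ
  let f : Fin ℓ × (Fin (Units.rank K) → Fin ℓ) → (𝓞 K)ˣ := fun p ↦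
    (ζ : (𝓞 K)ˣ) ^ (p.1 : ℕ) * ∏ i, Units.fundSystem K i ^ (p.2 i : ℕ)
  refine ⟨Finset.univ.image f, ?_, fun u ↦ ?_⟩
  · refine Finset.card_image_le.trans ?_
    rw [Finset.card_univ, Fintype.card_prod, Fintype.card_fun, Fintype.card_fin, Fintype.card_fin,
      ← _root_.pow_succ']
    refine Nat.pow_le_pow_right (Nat.pos_of_ne_zero hℓ) ?_
    have h1 := card_infinitePlace_le_finrank K
    have h2 : 0 < Fintype.card (InfinitePlace K) := Fintype.card_pos
    rw [Units.rank]
    omega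
  · obtain ⟨⟨ξ, e⟩, hu, -⟩ := Units.exist_unique_eq_mul_prod K u
    obtain ⟨k, hk⟩ := Subgroup.mem_zpowers_iff.mp (hζ ξ)
    have hmod : ∀ z : ℤ, (z % ℓ).toNat < ℓ := fun z ↦ by
      have h1 := Int.emod_nonneg z hℓ'
      have h2 := Int.emod_lt_of_pos z (show (0 : ℤ) < ℓ by omega)
      omega
    have hpow : ∀ (g : (𝓞 K)ˣ) (z : ℤ), g ^ z = g ^ (z % ℓ).toNat * (g ^ (z / ℓ)) ^ ℓ := fun g z ↦ by
      rw [← zpow_natCast g, Int.toNat_of_nonneg (Int.emod_nonneg z hℓ'), ← zpow_natCast (g ^ _),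
        ← zpow_mul, ← zpow_add, mul_comm (z / ℓ), Int.emod_add_mul_ediv]
    refine ⟨_, Finset.mem_image_of_mem f (Finset.mem_univ
      (⟨(k % ℓ).toNat, hmod k⟩, fun i ↦ ⟨(e i % ℓ).toNat, hmod (e i)⟩)),
      (ζ : (𝓞 K)ˣ) ^ (k / ℓ) * ∏ i, Units.fundSystem K i ^ (e i / ℓ), ?_⟩
    rw [hu, ← hk, Subgroup.coe_zpow, hpow]
    simp_rw [hpow (Units.fundSystem K _) (e _)]
    rw [Finset.prod_mul_distrib, Finset.prod_pow, mul_pow]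
    simp only [f]
    exact mul_mul_mul_comm _ _ _ _

/-- Representatives of the group of pairs `(J, γ)` with `J ^ ℓ = (γ)`. -/
theorem exists_pow_eq_span_representatives (K : Type*) [Field K] [NumberField K] {ℓ : ℕ}
    (hℓ : ℓ ≠ 0) : ∃ S : Finset (Ideal (𝓞 K) × 𝓞 K),
      S.card ≤ Nat.card {c : ClassGroup (𝓞 K) // c ^ ℓ = 1} * ℓ ^ finrank ℚ K ∧
      (∀ p ∈ S, p.1 ≠ ⊥ ∧ p.1 ^ ℓ = Ideal.span {p.2}) ∧
      ∀ (J : Ideal (𝓞 K)) (γ : 𝓞 K), J ≠ ⊥ → J ^ ℓ = Ideal.span {γ} →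
        ∃ p ∈ S, ∃ a b : 𝓞 K, a ≠ 0 ∧ b ≠ 0 ∧ Ideal.span {b} * J = Ideal.span {a} * p.1 ∧
          b ^ ℓ * γ = a ^ ℓ * p.2 := by
  classical
  obtain ⟨R, hR, hRu⟩ := exists_units_representatives K hℓ
  choose J₀ g hJ₀ hg using fun c : {c : ClassGroup (𝓞 K) // c ^ ℓ = 1} ↦ exists_ideal_pow_eq_span c.2
  let f : {c : ClassGroup (𝓞 K) // c ^ ℓ = 1} × (𝓞 K)ˣ → Ideal (𝓞 K) × 𝓞 K := fun q ↦
    (J₀ q.1, q.2 * g q.1)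
  refine ⟨(Finset.univ ×ˢ R).image f, ?_, ?_, fun J γ hJ hγ ↦ ?_⟩
  · refine Finset.card_image_le.trans ?_
    rw [Finset.card_product, Finset.card_univ, Nat.card_eq_fintype_card]
    exact Nat.mul_le_mul_left _ hR
  · intro p hp
    obtain ⟨q, -, rfl⟩ := Finset.mem_image.mp hp
    refine ⟨nonZeroDivisors.coe_ne_zero _, ?_⟩
    rw [Ideal.span_singleton_mul_left_unit q.2.isUnit]
    exact hg q.1
  · let J' : nonZeroDivisors (Ideal (𝓞 K)) := ⟨J, mem_nonZeroDivisors_of_ne_zero hJ⟩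
    have hc : ClassGroup.mk0 J' ^ ℓ = 1 := by
      rw [← map_pow, ClassGroup.mk0_eq_one_iff (J' ^ ℓ).2]
      exact ⟨γ, hγ⟩
    obtain ⟨x, y, hx, hy, hxy⟩ := ClassGroup.mk0_eq_mk0_iff.mp (hJ₀ ⟨_, hc⟩).symm
    have hspan : Ideal.span {y ^ ℓ * g ⟨_, hc⟩} = Ideal.span {x ^ ℓ * γ} := by
      rw [← Ideal.span_singleton_mul_span_singleton, ← Ideal.span_singleton_mul_span_singleton,
        ← Ideal.span_singleton_pow, ← Ideal.span_singleton_pow, ← hγ, ← hg, ← mul_pow, ← mul_pow,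
        ← hxy]
    obtain ⟨u, hu⟩ := Ideal.span_singleton_eq_span_singleton.mp hspan
    obtain ⟨r, hr, v, rfl⟩ := hRu u
    refine ⟨_, Finset.mem_image_of_mem f (Finset.mk_mem_product (Finset.mem_univ ⟨_, hc⟩) hr),
      y * v, x, mul_ne_zero hy v.ne_zero, hx, ?_, ?_⟩
    · rw [Ideal.span_singleton_mul_right_unit v.isUnit]
      exact hxy
    · rw [← hu]
      simp only [f]
      push_cast
      ring

end SelmerRepresentatives

section RelativeBound

open Module

/-- In boxes of volume a large power of the discriminant, lattice points of ideals are counted by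
the volume up to a constant factor. -/
theorem exists_ncard_box_bounds (n : ℕ) (hn : n ≠ 0) : ∃ C A : ℝ, 1 ≤ C ∧ 0 < A ∧
    ∀ (K : Type) [Field K] [NumberField K], finrank ℚ K ≤ n → ∀ D : ℝ, absDisc K ≤ D →
      ∀ J : Ideal (𝓞 K), J ≠ ⊥ → ∀ f : InfinitePlace K → ℝ, (∀ w, 0 < f w) →
      ∏ w, f w ^ w.mult = (C * D ^ A) ^ n * Ideal.absNorm J →
      {x : 𝓞 K | x ∈ J ∧ ∀ w : InfinitePlace K, w (x : K) < f w}.Finite ∧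
      (C * D ^ A) ^ n / (2 * √(absDisc K)) ≤
        ({x : 𝓞 K | x ∈ J ∧ ∀ w : InfinitePlace K, w (x : K) < f w} \ {0}).ncard ∧
      ({x : 𝓞 K | x ∈ J ∧ ∀ w : InfinitePlace K, w (x : K) < f w}.ncard : ℝ) ≤
        C * ((C * D ^ A) ^ n / √(absDisc K)) := by
  obtain ⟨C, A, hC, hA, h⟩ := exists_abs_ncard_box_sub_le n hn
  have hC' : (4 * (C + 1)) ≤ 4 * (C + 1) + (2 * Real.pi) ^ n := by
    have := Real.pi_pos
    linarith [show (0 : ℝ) < (2 * Real.pi) ^ n by positivity]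
  set C' : ℝ := 4 * (C + 1) + (2 * Real.pi) ^ n with hC'def
  refine ⟨C', A + 1 / 2, by linarith, by linarith, ?_⟩
  intro K _ _ hK D hD J hJ f hf hprod
  have hdpos := absDisc_pos K
  have hd := one_le_absDisc K
  have hsd := one_le_sqrt_absDisc K
  have hD1 : 1 ≤ D := hd.trans hD
  set Y : ℝ := C' * D ^ (A + 1 / 2) with hY
  have hYA : C' * (absDisc K ^ A * √(absDisc K)) ≤ Y := by
    rw [hY, Real.sqrt_eq_rpow, ← Real.rpow_add hdpos]
    gcongr
  have hdA : 1 ≤ absDisc K ^ A := Real.one_le_rpow hd hA.le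
  have hY4 : 4 * √(absDisc K) ≤ Y := by
    refine le_trans ?_ hYA
    have h5 : √(absDisc K) ≤ absDisc K ^ A * √(absDisc K) := by nlinarith
    nlinarith [show 4 ≤ C' by linarith]
  have hY1 : 1 ≤ Y := by linarith
  have hZ1 : 1 ≤ Y ^ n := one_le_pow₀ hY1
  have hYZ : Y ≤ Y ^ n := le_self_pow₀ hY1 hn
  obtain ⟨hfin, habs⟩ := h K hK J hJ f hf (Y ^ n) hZ1 hprod
  have hexp : (Y ^ n) ^ (1 - 1 / (n : ℝ)) = Y ^ n / Y := by
    rw [Real.rpow_sub (by positivity), Real.rpow_one, one_div,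
      Real.pow_rpow_inv_natCast (by positivity) hn]
  rw [hexp] at habs
  have herr : C * absDisc K ^ A * (Y ^ n / Y) ≤ Y ^ n / (4 * √(absDisc K)) := by
    rw [mul_div_assoc', div_le_div_iff₀ (by positivity) (by positivity)]
    have : 4 * C * (absDisc K ^ A * √(absDisc K)) ≤ Y := by
      refine le_trans ?_ hYA
      gcongr
      linarith
    nlinarith
  have hone : 1 ≤ Y ^ n / (4 * √(absDisc K)) := by
    rw [le_div_iff₀ (by positivity)]
    linarith
  have hlow : Y ^ n / √(absDisc K) ≤ boxConst K * Y ^ n := by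
    rw [div_eq_mul_inv, mul_comm]
    gcongr
    exact inv_le_boxConst K
  have hup : boxConst K * Y ^ n ≤ (2 * Real.pi) ^ n * (Y ^ n / √(absDisc K)) := by
    have h6 : (2 * Real.pi) ^ finrank ℚ K ≤ (2 * Real.pi) ^ n :=
      pow_le_pow_right₀ (by linarith [Real.pi_gt_three]) hK
    calc _ ≤ ((2 * Real.pi) ^ n / √(absDisc K)) * Y ^ n := by
          gcongr
          exact (boxConst_le K).trans (by gcongr)
      _ = _ := by ring
  have hq : Y ^ n / (4 * √(absDisc K)) = Y ^ n / √(absDisc K) / 4 := by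
    rw [mul_comm, div_div]
  have hq2 : Y ^ n / (2 * √(absDisc K)) = Y ^ n / √(absDisc K) / 2 := by
    rw [mul_comm, div_div]
  rw [abs_le] at habs
  refine ⟨hfin, ?_, ?_⟩
  · have h7 : ({x : 𝓞 K | x ∈ J ∧ ∀ w : InfinitePlace K, w (x : K) < f w}.ncard : ℝ) ≤
        ({x : 𝓞 K | x ∈ J ∧ ∀ w : InfinitePlace K, w (x : K) < f w} \ {0}).ncard + 1 := by
      exact_mod_cast Set.ncard_le_ncard_sdiff_add_ncard _ {(0 : 𝓞 K)} |>.trans (by simp)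
    linarith
  · have h8 : (0 : ℝ) ≤ Y ^ n / √(absDisc K) := by positivity
    rw [hC'def]
    nlinarith

theorem infinitePlace_norm_lt {F L : Type*} [Field F] [NumberField F] [Field L] [NumberField L]
    [Algebra F L] {x y : L} (hx : x ≠ 0) {t : ℝ} (h : ∀ w : InfinitePlace L, w x < t * w y)
    (v : InfinitePlace F) :
    v (Algebra.norm F x) < t ^ finrank F L * v (Algebra.norm F y) := by
  let : Algebra F ℂ := v.embedding.toAlgebra
  have hv : ∀ z : L, v (Algebra.norm F z) = ∏ σ : L →ₐ[F] ℂ, ‖σ z‖ := fun z ↦ by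
    rw [← norm_prod, ← Algebra.norm_eq_prod_embeddings, ← v.norm_embedding_eq]
    rfl
  have hcard : Fintype.card (L →ₐ[F] ℂ) = finrank F L := AlgHom.card F L ℂ
  have : Nonempty (L →ₐ[F] ℂ) := by
    rw [← Fintype.card_pos_iff, hcard]
    exact finrank_pos
  rw [hv, hv, ← hcard, ← Finset.card_univ, ← Finset.prod_const, ← Finset.prod_mul_distrib]
  refine Finset.prod_lt_prod_of_nonempty (fun σ _ ↦ by simpa using hx) (fun σ _ ↦ ?_)
    Finset.univ_nonempty
  exact h (InfinitePlace.mk (σ : L →+* ℂ))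

theorem exists_relative_norm_point {F L : Type*} [Field F] [NumberField F] [Field L]
    [NumberField L] [Algebra F L] {ℓ : ℕ} (hℓ : ℓ ≠ 0) {J A : Ideal (𝓞 L)} {J₀ : Ideal (𝓞 F)}
    {γ β : 𝓞 L} {γ₀ a b : 𝓞 F} (ha : a ≠ 0) (hβ0 : β ≠ 0) (hβ : Ideal.span {β} = J * A)
    (hJ₀ : Ideal.span {b} * Ideal.relNorm (𝓞 F) J = Ideal.span {a} * J₀)
    (hγ₀ : b ^ ℓ * Algebra.intNorm (𝓞 F) (𝓞 L) γ = a ^ ℓ * γ₀) (hb : b ≠ 0)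
    {R : InfinitePlace L → ℝ} (hR : ∀ w, R w ^ ℓ = w (γ : L))
    {R₀ : InfinitePlace F → ℝ} (hR₀pos : ∀ v, 0 < R₀ v) (hR₀ : ∀ v, R₀ v ^ ℓ = v (γ₀ : F))
    {t : ℝ} (ht : 0 < t) (hβt : ∀ w : InfinitePlace L, w (β : L) < t * R w) :
    ∃ z : 𝓞 F, z ∈ J₀ ∧ (∀ v : InfinitePlace F, v (z : F) < t ^ finrank F L * R₀ v) ∧
      Ideal.absNorm (Ideal.span {z}) = Ideal.absNorm J₀ * Ideal.absNorm A := by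
  have hspan : Ideal.span {b * Algebra.intNorm (𝓞 F) (𝓞 L) β} =
      Ideal.span {a} * (J₀ * Ideal.relNorm (𝓞 F) A) := by
    rw [← Ideal.span_singleton_mul_span_singleton, ← Ideal.relNorm_singleton, hβ, map_mul,
      ← mul_assoc, hJ₀, mul_assoc]
  obtain ⟨z, hz⟩ := Ideal.span_singleton_le_span_singleton.mp
    (hspan.trans_le Ideal.mul_le_left)
  have hzJ : Ideal.span {z} = J₀ * Ideal.relNorm (𝓞 F) A := by
    rw [hz, ← Ideal.span_singleton_mul_span_singleton] at hspan
    exact mul_left_cancel₀ (by simpa using ha) hspan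
  refine ⟨z, ?_, fun v ↦ ?_, ?_⟩
  · exact Ideal.mul_le_left (hzJ ▸ Ideal.mem_span_singleton_self z)
  · have h := infinitePlace_norm_lt (F := F) (x := (β : L) ^ ℓ) (y := (γ : L)) (t := t ^ ℓ)
      (pow_ne_zero _ (by exact_mod_cast hβ0)) (fun w ↦ by
        rw [map_pow, ← hR, ← mul_pow]
        exact pow_lt_pow_left₀ (hβt w) (by positivity) hℓ) v
    have hN : ∀ x : 𝓞 L, ((Algebra.intNorm (𝓞 F) (𝓞 L) x : 𝓞 F) : F) = Algebra.norm F (x : L) :=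
      fun x ↦ Algebra.algebraMap_intNorm (A := 𝓞 F) (K := F) (L := L) (B := 𝓞 L) x
    have h1 : v (b : F) * v (Algebra.norm F (β : L)) = v (a : F) * v (z : F) := by
      have h3 := congrArg (fun x : 𝓞 F ↦ v (x : F)) hz
      simp only [map_mul] at h3
      rwa [← hN]
    have h2 : v (b : F) ^ ℓ * v (Algebra.norm F (γ : L)) = v (a : F) ^ ℓ * v (γ₀ : F) := by
      have h3 := congrArg (fun x : 𝓞 F ↦ v (x : F)) hγ₀
      simp only [map_mul, map_pow] at h3
      rwa [← hN]
    have hva : 0 < v (a : F) := v.pos_iff.mpr (by exact_mod_cast ha)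
    have hvb : 0 < v (b : F) := v.pos_iff.mpr (by exact_mod_cast hb)
    refine lt_of_pow_lt_pow_left₀ ℓ (by have := hR₀pos v; positivity) ?_
    refine lt_of_mul_lt_mul_left ?_ (pow_pos hva ℓ).le
    rw [← mul_pow, ← h1, mul_pow, mul_pow, hR₀, mul_left_comm, ← h2, ← map_pow v (Algebra.norm F _),
      ← map_pow (Algebra.norm F)]
    calc _ < v (b : F) ^ ℓ * ((t ^ ℓ) ^ finrank F L * v (Algebra.norm F (γ : L))) := by gcongr
      _ = _ := by ring
  · rw [hzJ, map_mul, Ideal.absNorm_relNorm]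

end RelativeBound

section RelativeCount

open Module

/-- Small elements of pairwise inequivalent ideals whose relative index is prescribed are few. -/
theorem exists_card_pairs_le (n : ℕ) (ε : ℝ) (hε : 0 < ε) :
    ∃ C : ℝ, 0 < C ∧ ∀ (L : Type) [Field L] [NumberField L], finrank ℚ L ≤ n →
      ∀ {ι : Type} (J : ι → nonZeroDivisors (Ideal (𝓞 L))),
      Function.Injective (fun i ↦ ClassGroup.mk0 (J i)) →
      ∀ (R : ι → InfinitePlace L → ℝ), (∀ i w, 0 < R i w) →
      (∀ i, ∏ w, R i w ^ w.mult = Ideal.absNorm (J i : Ideal (𝓞 L))) →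
      ∀ (t Z : ℝ), 0 < t → 1 ≤ Z → t ^ finrank ℚ L = Z →
      ∀ (N : ℕ) (P : Finset (ι × 𝓞 L)), (∀ p ∈ P, p.2 ≠ 0 ∧
        (∀ w : InfinitePlace L, w (p.2 : L) < t * R p.1 w) ∧
        ∃ A, Ideal.span {p.2} = (J p.1 : Ideal (𝓞 L)) * A ∧ Ideal.absNorm A = N) →
      (P.card : ℝ) ≤ C * Z ^ ε := by
  classical
  obtain ⟨C₁, hC₁, h₁⟩ := exists_ncard_absNorm_eq_le_rpow n (ε / 2) (by positivity)
  obtain ⟨C₂, hC₂, h₂⟩ := exists_floor_log_pow_le_rpow n (ε / 2) (by positivity)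
  obtain ⟨B, hB⟩ := exists_ncard_integers_le n (Real.exp 1)
  refine ⟨C₁ * C₂ * (B + 1), by positivity, ?_⟩
  intro L _ _ hL ι J hJinj R hR hRJ t Z ht hZ htZ N P hP
  choose! hβ0 hβw A hA hAN using hP
  rcases P.eq_empty_or_nonempty with rfl | ⟨p₀, hp₀⟩
  · simpa using by positivity
  have hJ0 : ∀ i, (0 : ℝ) < Ideal.absNorm (J i : Ideal (𝓞 L)) := fun i ↦
    Nat.cast_pos.mpr (Nat.pos_of_ne_zero (Ideal.absNorm_eq_zero_iff.not.mpr
      (nonZeroDivisors.coe_ne_zero (J i))))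
  have htR : ∀ i w, 0 < t * R i w := fun i w ↦ mul_pos ht (hR i w)
  have hprod : ∀ i, ∏ w : InfinitePlace L, (t * R i w) ^ w.mult =
      Z * Ideal.absNorm (J i : Ideal (𝓞 L)) := fun i ↦ by
    simp_rw [mul_pow]
    rw [Finset.prod_mul_distrib, hRJ, Finset.prod_pow_eq_pow_sum, InfinitePlace.sum_mult_eq, htZ]
  have hprodβ : ∀ p ∈ P, ∏ w : InfinitePlace L, w (p.2 : L) ^ w.mult =
      Ideal.absNorm (J p.1 : Ideal (𝓞 L)) * N := fun p hp ↦ by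
    rw [prod_pow_mult_eq_absNorm, hA p hp, map_mul, hAN p hp, Nat.cast_mul]
  have hA0 : ∀ p ∈ P, A p ≠ ⊥ := fun p hp h ↦ by
    have := hA p hp
    rw [h, Ideal.mul_bot, Ideal.span_singleton_eq_bot] at this
    exact hβ0 p hp this
  have hN0 : N ≠ 0 := by
    rw [← hAN p₀ hp₀]
    exact Ideal.absNorm_eq_zero_iff.not.mpr (hA0 p₀ hp₀)
  have hN1 : (1 : ℝ) ≤ N := Nat.one_le_cast.mpr (Nat.one_le_iff_ne_zero.mpr hN0)
  have hNZ : (N : ℝ) ≤ Z := by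
    have h : ∏ w : InfinitePlace L, w (p₀.2 : L) ^ w.mult ≤
        ∏ w : InfinitePlace L, (t * R p₀.1 w) ^ w.mult :=
      Finset.prod_le_prod (fun w _ ↦ by positivity) fun w _ ↦
        pow_le_pow_left₀ (by positivity) (hβw p₀ hp₀ w).le _
    rw [hprod, hprodβ p₀ hp₀, mul_comm] at h
    exact le_of_mul_le_mul_right h (hJ0 _)
  let s := fun (p : ι × 𝓞 L) (w : InfinitePlace L) ↦ w (p.2 : L) / (t * R p.1 w)
  have hs0 : ∀ p ∈ P, ∀ w, 0 < s p w := fun p hp w ↦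
    div_pos (w.pos_iff.mpr (by exact_mod_cast hβ0 p hp)) (htR _ w)
  have hs1 : ∀ p ∈ P, ∀ w, s p w ≤ 1 := fun p hp w ↦ (div_le_one (htR _ w)).mpr (hβw p hp w).le
  have hsZ : ∀ p ∈ P, Z⁻¹ ≤ ∏ w : InfinitePlace L, s p w ^ w.mult := by
    intro p hp
    simp_rw [s, div_pow]
    rw [Finset.prod_div_distrib, hprodβ p hp, hprod, inv_eq_one_div,
      div_le_div_iff₀ (by positivity) (mul_pos (by positivity) (hJ0 _))]
    have := mul_pos (lt_of_lt_of_le one_pos hZ) (hJ0 p.1)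
    nlinarith
  have hfin : {I : Ideal (𝓞 L) | Ideal.absNorm I = N}.Finite := Ideal.finite_setOfPred_absNorm_eq N
  let T : Finset (Ideal (𝓞 L) × (InfinitePlace L → ℕ)) :=
    hfin.toFinset ×ˢ Fintype.piFinset fun _ ↦ Finset.range (⌊Real.log Z⌋₊ + 1)
  let Φ : ι × 𝓞 L → Ideal (𝓞 L) × (InfinitePlace L → ℕ) :=
    fun p ↦ (A p, fun w ↦ ⌊-Real.log (s p w)⌋₊)
  have hmaps : ∀ p ∈ P, Φ p ∈ T := fun p hp ↦ by
    refine Finset.mem_product.mpr ⟨hfin.mem_toFinset.mpr (hAN p hp),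
      Fintype.mem_piFinset.mpr fun w ↦ Finset.mem_range.mpr ?_⟩
    exact floor_neg_log_lt (hs0 p hp) (hs1 p hp) hZ (hsZ p hp) w
  have hfib : ∀ x ∈ T, (P.filter fun p ↦ Φ p = x).card ≤ B := by
    intro x _
    rcases Finset.eq_empty_or_nonempty (P.filter fun p ↦ Φ p = x) with h | ⟨q, hq⟩
    · simp [h]
    obtain ⟨hqP, rfl⟩ := Finset.mem_filter.mp hq
    have key : ∀ p ∈ P.filter (fun p ↦ Φ p = Φ q), p.1 = q.1 ∧ ∃ u : 𝓞 L, p.2 = q.2 * u ∧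
        ∀ w : InfinitePlace L, w (u : L) ≤ Real.exp 1 := by
      intro p hp
      obtain ⟨hpP, hpq⟩ := Finset.mem_filter.mp hp
      have hAeq : A p = A q := congrArg Prod.fst hpq
      have h1 : p.1 = q.1 := hJinj (mk0_eq_of_span_eq_mul (hβ0 p hpP) (hβ0 q hqP) (hA p hpP)
        (by rw [hA q hqP, hAeq]))
      have hspan : Ideal.span {p.2} = Ideal.span {q.2} := by
        rw [hA p hpP, hA q hqP, hAeq, h1]
      obtain ⟨u, hu⟩ := Ideal.span_singleton_le_span_singleton.mp hspan.le
      refine ⟨h1, u, hu, fun w ↦ ?_⟩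
      have h2 := le_exp_one_mul_of_floor_neg_log_eq (hs0 p hpP w) (hs1 p hpP w) (hs0 q hqP w)
        (congrFun (congrArg Prod.snd hpq) w)
      have h3 := congrArg (fun x : 𝓞 L ↦ w (x : L)) hu
      simp only [map_mul] at h3
      simp only [s] at h2
      rw [h1, ← mul_div_assoc, div_le_div_iff_of_pos_right (htR _ w), h3, mul_comm] at h2
      exact le_of_mul_le_mul_right h2 (w.pos_iff.mpr (RingOfIntegers.coe_ne_zero_iff.mpr (hβ0 q hqP)))
    choose! h1 u hu huw using key
    obtain ⟨hBfin, hBcard⟩ := hB L hL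
    rw [Set.ncard_eq_toFinset_card _ hBfin] at hBcard
    refine (Finset.card_le_card_of_injOn u (fun p hp ↦ ?_) fun p hp p' hp' h ↦ ?_).trans hBcard
    · exact hBfin.mem_toFinset.mpr (huw p hp)
    · exact Prod.ext ((h1 p hp).trans (h1 p' hp').symm) (by rw [hu p hp, hu p' hp', h])
  have hcard := Finset.card_le_mul_card_image_of_maps_to hmaps B hfib
  rw [Finset.card_product, Fintype.card_piFinset, Finset.prod_const, Finset.card_range, Finset.card_univ,
    ← Set.ncard_eq_toFinset_card _ hfin] at hcard
  have h3 := h₁ L hL N hN0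
  have h4 := h₂ Z hZ _ ((card_infinitePlace_le_finrank L).trans hL)
  calc (P.card : ℝ) ≤ B * ({I : Ideal (𝓞 L) | Ideal.absNorm I = N}.ncard *
        ((⌊Real.log Z⌋₊ + 1 : ℕ) : ℝ) ^ Fintype.card (InfinitePlace L)) := by exact_mod_cast hcard
    _ ≤ (B + 1) * ((C₁ * Z ^ (ε / 2)) * (C₂ * Z ^ (ε / 2))) := by
        gcongr
        · linarith
        · exact h3.trans (by gcongr)
    _ = C₁ * C₂ * (B + 1) * (Z ^ (ε / 2) * Z ^ (ε / 2)) := by ring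
    _ = _ := by rw [← Real.rpow_add (by positivity), add_halves]

end RelativeCount

section RelativeTorsion

open Module

/-- The relative bound for torsion in class groups: passing from `F` to an extension `L` costs at
most the square root of the quotient of the discriminants, up to `ε`. -/
theorem exists_card_torsion_le_relative (n ℓ : ℕ) (hn : n ≠ 0) (hℓ : ℓ ≠ 0) (ε : ℝ) (hε : 0 < ε) :
    ∃ C : ℝ, 0 < C ∧ ∀ (F L : Type) [Field F] [NumberField F] [Field L] [NumberField L]
      [Algebra F L], finrank ℚ L ≤ n →
      (Nat.card {c : ClassGroup (𝓞 L) // c ^ ℓ = 1} : ℝ) ≤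
        C * Nat.card {c : ClassGroup (𝓞 F) // c ^ ℓ = 1} * absDisc L ^ (1 / 2 + ε) /
          √(absDisc F) := by
  classical
  obtain ⟨C, A, hC, hA, hbox⟩ := exists_ncard_box_bounds n hn
  have hn' : (0 : ℝ) < n := by positivity
  obtain ⟨C₁, hC₁, hpairs⟩ := exists_card_pairs_le n (ε / (n * A)) (by positivity)
  have hC0 : 0 < C := by linarith
  refine ⟨2 * C * C₁ * ℓ ^ n * (C ^ n) ^ (ε / (n * A)), by positivity, ?_⟩
  intro F L _ _ _ _ _ hL
  have hD := one_le_absDisc L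
  have hDpos := absDisc_pos L
  have hDF := absDisc_pos F
  have hm : finrank ℚ L ≠ 0 := finrank_pos.ne'
  have hmul : finrank ℚ F * finrank F L = finrank ℚ L := finrank_mul_finrank ℚ F L
  have hF : finrank ℚ F ≤ n := by
    have : 0 < finrank F L := finrank_pos
    exact (Nat.le_mul_of_pos_right _ this).trans (hmul.trans_le hL)
  set Z : ℝ := (C * absDisc L ^ A) ^ n with hZdef
  have hZ1 : 1 ≤ Z :=
    one_le_pow₀ (one_le_mul_of_one_le_of_one_le hC (Real.one_le_rpow hD hA.le))
  obtain ⟨t, ht, htZ⟩ : ∃ t : ℝ, 0 < t ∧ t ^ finrank ℚ L = Z :=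
    ⟨_, Real.rpow_pos_of_pos (by positivity) _, Real.rpow_inv_natCast_pow (by positivity) hm⟩
  have hprod : ∀ {K : Type} [Field K] [NumberField K] (e : ℕ), finrank ℚ K * e = finrank ℚ L →
      ∀ (J : Ideal (𝓞 K)) (R : InfinitePlace K → ℝ), ∏ w, R w ^ w.mult = Ideal.absNorm J →
      ∏ w, (t ^ e * R w) ^ w.mult = Z * Ideal.absNorm J := by
    intro K _ _ e he J R hR
    simp_rw [mul_pow]
    rw [Finset.prod_mul_distrib, hR, Finset.prod_pow_eq_pow_sum, InfinitePlace.sum_mult_eq,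
      ← pow_mul, mul_comm e, he, htZ]
  let ι := {c : ClassGroup (𝓞 L) // c ^ ℓ = 1}
  choose J γ hJ hγ using fun c : ι ↦ exists_ideal_pow_eq_span c.2
  have hJ0 : ∀ c, (J c : Ideal (𝓞 L)) ≠ ⊥ := fun c ↦ nonZeroDivisors.coe_ne_zero (J c)
  choose R hR hRγ hRJ using fun c ↦ exists_radii hℓ (hJ0 c) (hγ c)
  have hβbox : ∀ c, ∃ s : Finset (𝓞 L), (∀ x ∈ s, x ∈ (J c : Ideal (𝓞 L)) ∧
      (∀ w : InfinitePlace L, w (x : L) < t * R c w) ∧ x ≠ 0) ∧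
      Z / (2 * √(absDisc L)) ≤ s.card := by
    intro c
    obtain ⟨hfin, hlow, -⟩ := hbox L hL _ le_rfl _ (hJ0 c) (fun w ↦ t * R c w)
      (fun w ↦ mul_pos ht (hR c w)) (by simpa using hprod 1 (mul_one _) _ _ (hRJ c))
    have hfin' := hfin.sdiff (t := {0})
    refine ⟨hfin'.toFinset, fun x hx ↦ ?_, by rwa [← Set.ncard_eq_toFinset_card _ hfin']⟩
    obtain ⟨⟨h1, h2⟩, h3⟩ := hfin'.mem_toFinset.mp hx
    exact ⟨h1, h2, h3⟩
  choose box hboxmem hboxcard using hβbox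
  let P : Finset (ι × 𝓞 L) :=
    (Finset.univ.sigma box).map (Equiv.sigmaEquivProd ι (𝓞 L)).toEmbedding
  have hP : ∀ p : ι × 𝓞 L, p ∈ P → p.2 ∈ box p.1 := by
    intro p hp
    obtain ⟨x, hx, rfl⟩ := Finset.mem_map.mp hp
    exact (Finset.mem_sigma.mp hx).2
  have hPcard : Nat.card ι * (Z / (2 * √(absDisc L))) ≤ P.card := by
    rw [Finset.card_map, Finset.card_sigma, Nat.card_eq_fintype_card, ← Finset.card_univ,
      ← nsmul_eq_mul, Nat.cast_sum]
    exact Finset.card_nsmul_le_sum _ _ _ fun c _ ↦ hboxcard c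
  obtain ⟨S, hScard, hSmem, hS⟩ := exists_pow_eq_span_representatives F hℓ
  have hzbox : ∀ p : Ideal (𝓞 F) × 𝓞 F, p ∈ S → ∃ (R₀ : InfinitePlace F → ℝ) (s : Finset (𝓞 F)),
      (∀ v, 0 < R₀ v) ∧ (∀ v, R₀ v ^ ℓ = v (p.2 : F)) ∧
      (∀ x ∈ p.1, (∀ v : InfinitePlace F, v (x : F) < t ^ finrank F L * R₀ v) → x ∈ s) ∧
      (s.card : ℝ) ≤ C * (Z / √(absDisc F)) := by
    intro p hp
    obtain ⟨hp0, hpγ⟩ := hSmem p hp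
    obtain ⟨R₀, hR₀, hR₀γ, hR₀J⟩ := exists_radii hℓ hp0 hpγ
    obtain ⟨hfin, -, hup⟩ := hbox F hF _ (absDisc_le_of_algebra (K := F) (L := L)) _ hp0
      (fun v ↦ t ^ finrank F L * R₀ v) (fun v ↦ mul_pos (by positivity) (hR₀ v))
      (hprod _ hmul _ _ hR₀J)
    refine ⟨R₀, hfin.toFinset, hR₀, hR₀γ, fun x hx hxv ↦ hfin.mem_toFinset.mpr ⟨hx, hxv⟩, ?_⟩
    rwa [← Set.ncard_eq_toFinset_card _ hfin]
  choose! R₀ zbox hR₀ hR₀γ hzmem hzcard using hzbox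
  let U : Finset (Σ _ : Ideal (𝓞 F) × 𝓞 F, 𝓞 F) := S.sigma zbox
  have hΨ : ∀ p : ι × 𝓞 L, p ∈ P → ∃ (x : Σ _ : Ideal (𝓞 F) × 𝓞 F, 𝓞 F), x ∈ U ∧
      ∃ B : Ideal (𝓞 L), Ideal.span {p.2} = J p.1 * B ∧
        Ideal.absNorm (Ideal.span {x.2}) = Ideal.absNorm x.1.1 * Ideal.absNorm B := by
    intro p hp
    obtain ⟨hpJ, hpw, hp0⟩ := hboxmem _ _ (hP p hp)
    obtain ⟨B, hB⟩ := Ideal.dvd_span_singleton.mpr hpJ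
    obtain ⟨q, hq, a, b, ha, hb, hab, hab'⟩ := hS (Ideal.relNorm (𝓞 F) (J p.1 : Ideal (𝓞 L)))
      (Algebra.intNorm (𝓞 F) (𝓞 L) (γ p.1)) (by rw [Ne, Ideal.relNorm_eq_bot_iff]; exact hJ0 _)
      (by rw [← map_pow, hγ, Ideal.relNorm_singleton])
    obtain ⟨z, hz, hzv, hzN⟩ := exists_relative_norm_point hℓ ha hp0 hB hab hab' hb (hRγ p.1)
      (hR₀ q hq) (hR₀γ q hq) ht hpw
    exact ⟨⟨q, z⟩, Finset.mem_sigma.mpr ⟨hq, hzmem q hq z hz hzv⟩, B, hB, hzN⟩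
  choose! Ψ hΨU B hB hΨB using hΨ
  have hfib : ∀ x ∈ U, (P.filter fun p ↦ Ψ p = x).card ≤ ⌊C₁ * Z ^ (ε / (n * A))⌋₊ := by
    intro x hx
    refine Nat.le_floor (hpairs L hL J ?_ R hR hRJ t Z ht hZ1 htZ
      (Ideal.absNorm (Ideal.span {x.2}) / Ideal.absNorm x.1.1) _ fun p hp ↦ ?_)
    · intro c c' h
      simp only [hJ] at h
      exact Subtype.ext h
    · obtain ⟨hpP, hpx⟩ := Finset.mem_filter.mp hp
      obtain ⟨-, hpw, hp0⟩ := hboxmem _ _ (hP p hpP)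
      refine ⟨hp0, hpw, B p, hB p hpP, ?_⟩
      have hx0 : 0 < Ideal.absNorm x.1.1 := Nat.pos_of_ne_zero
        (Ideal.absNorm_eq_zero_iff.not.mpr (hSmem _ (Finset.mem_sigma.mp hx).1).1)
      rw [← hpx] at hx0 ⊢
      rw [hΨB p hpP, Nat.mul_div_cancel_left _ hx0]
  have hcard := Finset.card_le_mul_card_image_of_maps_to hΨU _ hfib
  have hUcard : (U.card : ℝ) ≤ Nat.card {c : ClassGroup (𝓞 F) // c ^ ℓ = 1} * ℓ ^ n *
      (C * (Z / √(absDisc F))) := by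
    rw [Finset.card_sigma, Nat.cast_sum]
    refine (Finset.sum_le_card_nsmul _ _ _ hzcard).trans ?_
    rw [nsmul_eq_mul]
    gcongr
    have h1 : ℓ ^ finrank ℚ F ≤ ℓ ^ n := Nat.pow_le_pow_right (Nat.pos_of_ne_zero hℓ) hF
    exact_mod_cast hScard.trans (Nat.mul_le_mul_left _ h1)
  have hZε : Z ^ (ε / (n * A)) = (C ^ n) ^ (ε / (n * A)) * absDisc L ^ ε := by
    rw [hZdef, mul_pow, Real.mul_rpow (by positivity) (by positivity),
      ← Real.rpow_mul_natCast hDpos.le, ← Real.rpow_mul hDpos.le]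
    congr 2
    field_simp
  have hmain : Nat.card ι * (Z / (2 * √(absDisc L))) ≤ C₁ * Z ^ (ε / (n * A)) *
      (Nat.card {c : ClassGroup (𝓞 F) // c ^ ℓ = 1} * ℓ ^ n * (C * (Z / √(absDisc F)))) := by
    calc _ ≤ (P.card : ℝ) := hPcard
      _ ≤ ⌊C₁ * Z ^ (ε / (n * A))⌋₊ * U.card := by exact_mod_cast hcard
      _ ≤ _ := by
        gcongr
        exact Nat.floor_le (by positivity)
  have hZ0 : 0 < Z := by linarith
  have hsL : 0 < √(absDisc L) := Real.sqrt_pos.mpr hDpos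
  have hpos : 0 < Z / (2 * √(absDisc L)) := by positivity
  refine le_of_mul_le_mul_right (hmain.trans_eq ?_) hpos
  rw [hZε, Real.rpow_add hDpos, ← Real.sqrt_eq_rpow]
  field_simp

end RelativeTorsion

section InductiveStep

open Module

/-- A saving over the trivial bound for torsion of the class group passes from the fixed field of
a minimal normal subgroup `M` to the whole field. -/
theorem exists_card_torsion_le_of_fixedField (n ℓ : ℕ) (hn : 2 ≤ n) (hℓ : ℓ ≠ 0) (δ C : ℝ)
    (hδ : 0 < δ) (hC : 0 < C) :
    ∃ δ' : ℝ, 0 < δ' ∧ ∃ C' : ℝ, 0 < C' ∧ ∀ (L : Type) [Field L] [NumberField L] [IsGalois ℚ L],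
      finrank ℚ L = n → ∀ M : Subgroup (L ≃ₐ[ℚ] L), M.Normal → M ≠ ⊥ →
      (∀ N : Subgroup (L ≃ₐ[ℚ] L), N.Normal → N ≤ M → N = ⊥ ∨ N = M) →
      (∃ g : L ≃ₐ[ℚ] L, ∀ m ∈ M, Subgroup.zpowers (g * m) ⊓ M = ⊥) →
      (Nat.card {c : ClassGroup (𝓞 (IntermediateField.fixedField M)) // c ^ ℓ = 1} : ℝ) ≤
        C * absDisc (IntermediateField.fixedField M) ^ (1 / 2 - δ) →
      (Nat.card {c : ClassGroup (𝓞 L) // c ^ ℓ = 1} : ℝ) ≤ C' * absDisc L ^ (1 / 2 - δ') := by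
  obtain ⟨κ, hκ, η, hη, C₁, hC₁, h₁⟩ := exists_card_torsion_le_of_absDisc_fixedField_le n ℓ hn hℓ
  obtain ⟨C₂, hC₂, h₂⟩ := exists_card_torsion_le_relative n ℓ (by omega) hℓ (δ * κ / 2)
    (by positivity)
  refine ⟨min η (δ * κ / 2), by positivity, max C₁ (C₂ * C), by positivity, ?_⟩
  intro L _ _ _ hL M hM hM0 hmin hg hF
  have hD := one_le_absDisc L
  have hDpos := absDisc_pos L
  have hDF := absDisc_pos (IntermediateField.fixedField M)
  rcases le_total (absDisc (IntermediateField.fixedField M)) (absDisc L ^ κ) with h | h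
  · refine (h₁ L hL M hM hM0 hmin hg h).trans ?_
    gcongr
    · exact le_max_left _ _
    · exact min_le_left _ _
  · have h3 := h₂ (IntermediateField.fixedField M) L hL.le
    have h4 : absDisc L ^ (κ * δ) ≤ absDisc (IntermediateField.fixedField M) ^ δ := by
      rw [Real.rpow_mul hDpos.le]
      gcongr
    have h5 : absDisc (IntermediateField.fixedField M) ^ ((1 : ℝ) / 2 - δ) =
        √(absDisc (IntermediateField.fixedField M)) /
          absDisc (IntermediateField.fixedField M) ^ δ := by
      rw [Real.rpow_sub hDF, Real.sqrt_eq_rpow]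
    have hs : 0 < √(absDisc (IntermediateField.fixedField M)) := Real.sqrt_pos.mpr hDF
    have hpd : 0 < absDisc (IntermediateField.fixedField M) ^ δ := by positivity
    calc _ ≤ C₂ * (C * absDisc (IntermediateField.fixedField M) ^ ((1 : ℝ) / 2 - δ)) *
          absDisc L ^ (1 / 2 + δ * κ / 2) / √(absDisc (IntermediateField.fixedField M)) := by
          refine h3.trans ?_
          gcongr
      _ = C₂ * C * (absDisc L ^ (1 / 2 + δ * κ / 2) /
          absDisc (IntermediateField.fixedField M) ^ δ) := by
          rw [h5]
          field_simp
      _ ≤ C₂ * C * (absDisc L ^ (1 / 2 + δ * κ / 2) / absDisc L ^ (κ * δ)) := by gcongr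
      _ = C₂ * C * absDisc L ^ (1 / 2 - δ * κ / 2) := by
          rw [← Real.rpow_sub hDpos]
          ring_nf
      _ ≤ _ := by
          gcongr
          · exact le_max_right _ _
          · exact min_le_right _ _

end InductiveStep

section Induction

open Module

/-- The number fields with Galois group `G` satisfy a power saving over the trivial bound for
`ℓ`-torsion of the class group. -/
def HasTorsionSaving (ℓ : ℕ) (G : Type) [Group G] : Prop :=
  ∃ δ : ℝ, 0 < δ ∧ ∃ C : ℝ, 0 < C ∧ ∀ (F : Type) [Field F] [NumberField F] [IsGalois ℚ F],
    Nonempty ((F ≃ₐ[ℚ] F) ≃* G) → (ellTorsion F ℓ : ℝ) ≤ C * absDisc F ^ ((1 : ℝ) / 2 - δ)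

theorem HasTorsionSaving.congr {ℓ : ℕ} {G G' : Type} [Group G] [Group G']
    (h : HasTorsionSaving ℓ G) (e : G' ≃* G) : HasTorsionSaving ℓ G' := by
  obtain ⟨δ, hδ, C, hC, h⟩ := h
  exact ⟨δ, hδ, C, hC, fun F _ _ _ ⟨f⟩ ↦ h F ⟨f.trans e⟩⟩

theorem IsForcingExtension.quotient_lift {G G' : Type*} [Group G] [Group G'] {π : G' →* G}
    (h : IsForcingExtension π) (M : Subgroup G') [M.Normal] (hM : M ≤ π.ker) :
    IsForcingExtension (QuotientGroup.lift M π hM) := by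
  obtain ⟨hsurj, c₀, hc₀⟩ := h
  refine ⟨QuotientGroup.lift_surjective_of_surjective _ _ hsurj hM, c₀, fun c hc g hg ↦ ?_⟩
  obtain ⟨g, rfl⟩ := QuotientGroup.mk_surjective g
  have hg' : π g = c := hg
  refine Nat.dvd_antisymm ?_ ?_
  · rw [← hc₀ c hc g hg']
    exact orderOf_map_dvd (QuotientGroup.mk' M) g
  · rw [← hg]
    exact orderOf_map_dvd (QuotientGroup.lift M π hM) _

theorem IsForcingExtension.exists_zpowers_inf_ker_eq_bot {G G' : Type*} [Group G] [Group G']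
    [Finite G'] {π : G' →* G} (h : IsForcingExtension π) :
    ∃ g, ∀ m ∈ π.ker, Subgroup.zpowers (g * m) ⊓ π.ker = ⊥ := by
  obtain ⟨hsurj, c₀, hc₀⟩ := h
  obtain ⟨g, hg⟩ := hsurj c₀
  refine ⟨g, fun m hm ↦ (Subgroup.eq_bot_iff_forall _).mpr ?_⟩
  rintro x ⟨hx, hxker⟩
  obtain ⟨k, rfl⟩ := Subgroup.mem_zpowers_iff.mp hx
  have hgm : π (g * m) = c₀ := by rw [map_mul, hm, mul_one, hg]
  have hx' : c₀ ^ k = 1 := by rw [← hgm, ← map_zpow]; exact hxker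
  rwa [← orderOf_dvd_iff_zpow_eq_one, hc₀ c₀ (IsConj.refl _) _ hgm, orderOf_dvd_iff_zpow_eq_one]

theorem exists_minimal_normal_le {G : Type*} [Group G] [Finite G] {K : Subgroup G} (hK : K.Normal)
    (hK0 : K ≠ ⊥) : ∃ M : Subgroup G, M.Normal ∧ M ≠ ⊥ ∧ M ≤ K ∧
      ∀ N : Subgroup G, N.Normal → N ≤ M → N = ⊥ ∨ N = M := by
  obtain ⟨M, hMK, hM⟩ := (Set.toFinite {M : Subgroup G | M.Normal ∧ M ≠ ⊥}).exists_le_minimal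
    (show K ∈ _ from ⟨hK, hK0⟩)
  refine ⟨M, hM.prop.1, hM.prop.2, hMK, fun N hN hNM ↦ or_iff_not_imp_left.mpr fun hN0 ↦ ?_⟩
  exact le_antisymm hNM (hM.le_of_le ⟨hN, hN0⟩ hNM)

theorem HasTorsionSaving.of_quotient {ℓ : ℕ} (hℓ : ℓ ≠ 0) {G : Type} [Group G] [Finite G]
    (M : Subgroup G) [M.Normal] (hM0 : M ≠ ⊥)
    (hmin : ∀ N : Subgroup G, N.Normal → N ≤ M → N = ⊥ ∨ N = M)
    (hg : ∃ g, ∀ m ∈ M, Subgroup.zpowers (g * m) ⊓ M = ⊥)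
    (h : HasTorsionSaving ℓ (G ⧸ M)) : HasTorsionSaving ℓ G := by
  obtain ⟨δ, hδ, C, hC, h⟩ := h
  have hn : 2 ≤ Nat.card G := by
    have : Nontrivial M := (Subgroup.nontrivial_iff_ne_bot M).mpr hM0
    exact (Finite.one_lt_card_iff_nontrivial.mpr this).trans_le
      (Nat.card_le_card_of_injective _ M.subtype_injective)
  obtain ⟨δ', hδ', C', hC', hstep⟩ :=
    exists_card_torsion_le_of_fixedField (Nat.card G) ℓ hn hℓ δ C hδ hC
  refine ⟨δ', hδ', C', hC', fun L _ _ _ ⟨e⟩ ↦ ?_⟩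
  let M' : Subgroup (L ≃ₐ[ℚ] L) := M.comap e.toMonoidHom
  have hmap : M'.map e.toMonoidHom = M :=
    Subgroup.map_comap_eq_self_of_surjective e.surjective M
  have hM' : M'.Normal := inferInstanceAs (M.comap e.toMonoidHom).Normal
  refine hstep L ?_ M' hM' ?_ ?_ ?_ ?_
  · rw [← IsGalois.card_aut_eq_finrank, Nat.card_congr e.toEquiv]
  · rintro h0
    rw [h0, Subgroup.map_bot] at hmap
    exact hM0 hmap.symm
  · intro N hN hNM
    have hinj : Function.Injective (Subgroup.map e.toMonoidHom) :=
      Subgroup.map_injective e.injective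
    refine (hmin (N.map e.toMonoidHom) (hN.map _ e.surjective)
      ((Subgroup.map_mono hNM).trans hmap.le)).imp (fun h0 ↦ hinj ?_) fun h0 ↦ hinj ?_
    · rw [h0, Subgroup.map_bot]
    · rw [h0, hmap]
  · obtain ⟨g, hg⟩ := hg
    refine ⟨e.symm g, fun m hm ↦ ?_⟩
    refine Subgroup.map_injective (f := e.toMonoidHom) e.injective ?_
    rw [Subgroup.map_inf _ _ _ e.injective, hmap, MonoidHom.map_zpowers, Subgroup.map_bot]
    have := hg (e m) hm
    simpa using this
  · have : IsGalois ℚ (IntermediateField.fixedField M') :=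
      IsGalois.of_fixedField_normal_subgroup M'
    exact h _ ⟨(IsGalois.normalAutEquivQuotient M').symm.trans (QuotientGroup.congr M' M e hmap)⟩

theorem HasTorsionSaving.of_isForcingExtension {ℓ : ℕ} (hℓ : ℓ ≠ 0) {G : Type} [Group G]
    (h : HasTorsionSaving ℓ G) {G' : Type} [Group G'] [Finite G'] {π : G' →* G}
    (hπ : IsForcingExtension π) : HasTorsionSaving ℓ G' := by
  induction hk : Nat.card G' using Nat.strong_induction_on generalizing G' with
  | _ k ih =>
    by_cases hker : π.ker = ⊥
    · exact h.congr (MulEquiv.ofBijective π ⟨(MonoidHom.ker_eq_bot_iff π).mp hker, hπ.1⟩)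
    obtain ⟨M, hM, hM0, hMker, hmin⟩ := exists_minimal_normal_le π.normal_ker hker
    refine HasTorsionSaving.of_quotient hℓ M hM0 hmin ?_
      (ih _ ?_ (hπ.quotient_lift M hMker) rfl)
    · obtain ⟨g, hg⟩ := hπ.exists_zpowers_inf_ker_eq_bot
      exact ⟨g, fun m hm ↦ le_bot_iff.mp
        ((inf_le_inf_left _ hMker).trans (hg m (hMker hm)).le)⟩
    · have h1 := M.card_eq_card_quotient_mul_card_subgroup
      have : Nontrivial M := (Subgroup.nontrivial_iff_ne_bot M).mpr hM0
      have h2 : 1 < Nat.card M := Finite.one_lt_card_iff_nontrivial.mpr this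
      have h3 : 0 < Nat.card (G' ⧸ M) := Nat.card_pos
      rw [← hk, h1]
      nlinarith

end Induction

/-- **Extension Lemma, qualitative form.** If `π : G̃ → G` is a surjective forcing
extension and a pointwise power-saving bound on `ℓ`-torsion holds for all Galois number fields
with group `G`, then such a bound also holds for all Galois number fields with group `G̃`. -/
theorem extension_lemma (ℓ : ℕ) (hℓ : 1 < ℓ)
    (G G' : Type) [Group G] [Finite G] [Group G'] [Finite G'] (π : G' →* G)
    (hsurj : Function.Surjective π) (hforce : IsForcingExtension π)
    (hG : ∃ δ : ℝ, 0 < δ ∧ ∀ ε : ℝ, 0 < ε → ∃ C : ℝ, 0 < C ∧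
      ∀ (F : Type) [Field F] [NumberField F] [IsGalois ℚ F],
        Nonempty ((F ≃ₐ[ℚ] F) ≃* G) →
        (ellTorsion F ℓ : ℝ) ≤ C * (|discr F| : ℝ) ^ ((1 : ℝ) / 2 - δ + ε)) :
    ∃ δ' : ℝ, 0 < δ' ∧ ∀ ε : ℝ, 0 < ε → ∃ C' : ℝ, 0 < C' ∧
      ∀ (L : Type) [Field L] [NumberField L] [IsGalois ℚ L],
        Nonempty ((L ≃ₐ[ℚ] L) ≃* G') →
        (ellTorsion L ℓ : ℝ) ≤ C' * (|discr L| : ℝ) ^ ((1 : ℝ) / 2 - δ' + ε) := by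
  obtain ⟨δ, hδ, hG⟩ := hG
  have hsaving : HasTorsionSaving ℓ G := by
    obtain ⟨C, hC, h⟩ := hG (δ / 2) (by positivity)
    refine ⟨δ / 2, by positivity, C, hC, fun F _ _ _ e ↦ (h F e).trans_eq ?_⟩
    rw [absDisc]
    ring_nf
  obtain ⟨δ', hδ', C', hC', h⟩ := hsaving.of_isForcingExtension (by omega) hforce
  refine ⟨δ', hδ', fun ε hε ↦ ⟨C', hC', fun L _ _ _ e ↦ (h L e).trans ?_⟩⟩
  have := one_le_absDisc L
  change _ ≤ C' * absDisc L ^ _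
  gcongr
  linarith
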